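/- arXiv:2212.00610 — 5 statements merged into one kernel-verified Lean document; each statement's English description precedes it below -/
import Mathlib

section
/- If G is a planar graph with girth at least 12 and Δ(G) ≥ 7, then τ₂(G) = ⌈√(2Δ(G)+0.25) + 2.5⌉. -/
open SimpleGraph

/-- A `t`-tone `k`-coloring of a graph `G` assigns to each vertex a `t`-element subset of
`{1, …, k}` so that the labels of any two distinct vertices `v, w` share fewer than
`d(v,w)` colors (no constraint between different components, where the distance is infinite). -/
def IsTToneColoring {V : Type*} (G : SimpleGraph V) (t k : ℕ) (f : V → Finset ℕ) : Prop :=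
  (∀ v, f v ⊆ Finset.Icc 1 k) ∧ (∀ v, (f v).card = t) ∧
    ∀ ⦃v w : V⦄, v ≠ w → ((f v ∩ f w).card : ℕ∞) < G.edist v w

/-- The `t`-tone chromatic number: the least `k` admitting a `t`-tone `k`-coloring. -/
noncomputable def toneChromaticNumber {V : Type*} (G : SimpleGraph V) (t : ℕ) : ℕ :=
  sInf {k | ∃ f : V → Finset ℕ, IsTToneColoring G t k f}

/-- The maximum degree `Δ(G)` of a finite graph. -/
noncomputable def maxDeg {V : Type*} [Fintype V] (G : SimpleGraph V) : ℕ :=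
  Finset.univ.sup fun v => (G.neighborSet v).ncard

/-- `H` is a minor of `G`: disjoint connected branch sets, one for each vertex of `H`,
with an edge of `G` between the branch sets of any two adjacent vertices of `H`. -/
def IsMinor {W V : Type*} (H : SimpleGraph W) (G : SimpleGraph V) : Prop :=
  ∃ B : W → Set V,
    (∀ w, (G.induce (B w)).Connected) ∧
    (Pairwise fun w₁ w₂ => Disjoint (B w₁) (B w₂)) ∧
    ∀ ⦃w₁ w₂ : W⦄, H.Adj w₁ w₂ → ∃ u ∈ B w₁, ∃ v ∈ B w₂, G.Adj u v

/-- A graph is planar iff it has no `K₅` minor and no `K₃,₃` minor (Wagner's theorem). -/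
def IsPlanar {V : Type*} (G : SimpleGraph V) : Prop :=
  ¬ IsMinor (completeGraph (Fin 5)) G ∧ ¬ IsMinor (completeBipartiteGraph (Fin 3) (Fin 3)) G

section

variable {V : Type*}

theorem IsMinor.mono {W : Type*} {K : SimpleGraph W} {H G : SimpleGraph V} (hHG : H ≤ G)
    (h : IsMinor K H) : IsMinor K G := by
  obtain ⟨B, hc, hd, ha⟩ := h
  refine ⟨B, fun w => (hc w).mono ?_, hd, fun w₁ w₂ hw => ?_⟩
  · exact SimpleGraph.comap_monotone _ hHG
  · obtain ⟨u, hu, v, hv, huv⟩ := ha hw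
    exact ⟨u, hu, v, hv, hHG huv⟩

/-- `S` is nonempty and any two of its vertices are joined by a walk inside `S`. -/
def ConnSet (H : SimpleGraph V) (S : Set V) : Prop :=
  S.Nonempty ∧ ∀ a ∈ S, ∀ b ∈ S, Relation.ReflTransGen (fun u v => H.Adj u v ∧ v ∈ S) a b

theorem ConnSet.connected {H : SimpleGraph V} {S : Set V} (h : ConnSet H S) :
    (H.induce S).Connected := by
  obtain ⟨⟨a, ha⟩, h⟩ := h
  rw [connected_iff_exists_forall_reachable]
  refine ⟨⟨a, ha⟩, ?_⟩
  rintro ⟨b, hb⟩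
  have key : ∀ z, Relation.ReflTransGen (fun u v => H.Adj u v ∧ v ∈ S) a z →
      ∀ hz : z ∈ S, (H.induce S).Reachable ⟨a, ha⟩ ⟨z, hz⟩ := by
    intro z hz
    induction hz with
    | refl => intro _; exact Reachable.refl _
    | @tail b c hab hbc ih =>
      intro hc
      have hb : b ∈ S := by
        rcases hab.cases_tail with h | ⟨_, _, h⟩
        · exact h ▸ ha
        · exact h.2
      refine (ih hb).trans (Adj.reachable ?_)
      simpa using hbc.1
  exact key b (h a ha b hb) hb

theorem reflTransGen_symm_of_mem {H : SimpleGraph V} {S : Set V} {a b : V} (ha : a ∈ S)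
    (h : Relation.ReflTransGen (fun u v => H.Adj u v ∧ v ∈ S) a b) :
    b ∈ S ∧ Relation.ReflTransGen (fun u v => H.Adj u v ∧ v ∈ S) b a := by
  induction h with
  | refl => exact ⟨ha, .refl⟩
  | tail hab hbc ih => exact ⟨hbc.2, .head ⟨hbc.1.symm, ih.1⟩ ih.2⟩

/-- A set is connected if each of its points reaches a fixed connected subset. -/
theorem ConnSet.of_hub {H : SimpleGraph V} {S W : Set V} (hS : ConnSet H S) (hSW : S ⊆ W)
    (h : ∀ z ∈ W, z ∈ S ∨ ∃ T ⊆ W, z ∈ T ∧ ConnSet H T ∧ ∃ u ∈ T, ∃ v ∈ S, H.Adj u v) :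
    ConnSet H W := by
  obtain ⟨s, hs⟩ := hS.1
  have mono : ∀ {T : Set V}, T ⊆ W → ∀ {a b}, Relation.ReflTransGen
      (fun u v => H.Adj u v ∧ v ∈ T) a b →
      Relation.ReflTransGen (fun u v => H.Adj u v ∧ v ∈ W) a b :=
    fun hT _ _ h => Relation.ReflTransGen.mono (fun _ _ h => ⟨h.1, hT h.2⟩) _ _ h
  have key : ∀ z ∈ W, Relation.ReflTransGen (fun u v => H.Adj u v ∧ v ∈ W) z s := by
    intro z hz
    rcases h z hz with hzS | ⟨T, hTW, hzT, hT, u, hu, v, hv, huv⟩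
    · exact mono hSW (hS.2 z hzS s hs)
    · exact ((mono hTW (hT.2 z hzT u hu)).tail ⟨huv, hSW hv⟩).trans (mono hSW (hS.2 v hv s hs))
  refine ⟨⟨s, hSW hs⟩, fun a ha b hb => (key a ha).trans ?_⟩
  exact (reflTransGen_symm_of_mem hb (key b hb)).2

/-- The vertices reachable from `a` by walks whose later vertices lie in `Z`. -/
def compIn (H : SimpleGraph V) (Z : Set V) (a : V) : Set V :=
  {z | Relation.ReflTransGen (fun u v => H.Adj u v ∧ v ∈ Z) a z}

theorem self_mem_compIn (H : SimpleGraph V) (Z : Set V) (a : V) : a ∈ compIn H Z a :=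
  Relation.ReflTransGen.refl

theorem compIn_subset {H : SimpleGraph V} {Z : Set V} {a : V} (ha : a ∈ Z) : compIn H Z a ⊆ Z :=
  fun _ hz => (reflTransGen_symm_of_mem ha hz).1

theorem compIn_eq {H : SimpleGraph V} {Z : Set V} {a b : V} (ha : a ∈ Z)
    (hb : b ∈ compIn H Z a) : compIn H Z b = compIn H Z a := by
  ext z
  exact ⟨fun h => Relation.ReflTransGen.trans hb h,
    fun h => Relation.ReflTransGen.trans (reflTransGen_symm_of_mem ha hb).2 h⟩

theorem mem_compIn_of_adj {H : SimpleGraph V} {Z : Set V} {a b c : V} (hb : b ∈ compIn H Z a)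
    (hbc : H.Adj b c) (hc : c ∈ Z) : c ∈ compIn H Z a :=
  Relation.ReflTransGen.tail hb ⟨hbc, hc⟩

theorem connSet_compIn {H : SimpleGraph V} {Z : Set V} {a : V} :
    ConnSet H (compIn H Z a) := by
  have key : ∀ b, Relation.ReflTransGen (fun u v => H.Adj u v ∧ v ∈ Z) a b →
      Relation.ReflTransGen (fun u v => H.Adj u v ∧ v ∈ compIn H Z a) a b := by
    intro b hb
    induction hb with
    | refl => exact .refl
    | tail hab hbc ih => exact ih.tail ⟨hbc.1, mem_compIn_of_adj hab hbc.1 hbc.2⟩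
  refine ⟨⟨a, self_mem_compIn H Z a⟩, fun b hb c hc => ?_⟩
  exact (reflTransGen_symm_of_mem (self_mem_compIn H Z a) (key b hb)).2.trans (key c hc)

/-- The vertices of a sequence with index between `a` and `b`. -/
def seg (c : ℕ → V) (a b : ℕ) : Set V := {z | ∃ m, a ≤ m ∧ m ≤ b ∧ c m = z}

theorem mem_seg {c : ℕ → V} {a b m : ℕ} (h1 : a ≤ m) (h2 : m ≤ b) : c m ∈ seg c a b :=
  ⟨m, h1, h2, rfl⟩

theorem connSet_seg {H : SimpleGraph V} {c : ℕ → V} {a b : ℕ} (hab : a ≤ b)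
    (h : ∀ m, a ≤ m → m < b → H.Adj (c m) (c (m + 1))) : ConnSet H (seg c a b) := by
  have key : ∀ m, a ≤ m → m ≤ b →
      Relation.ReflTransGen (fun u v => H.Adj u v ∧ v ∈ seg c a b) (c a) (c m) := by
    intro m hm
    induction m, hm using Nat.le_induction with
    | base => intro _; exact .refl
    | succ m hm ih => exact fun hmb => (ih (by omega)).tail ⟨h m hm (by omega), mem_seg (by omega) hmb⟩
  refine ⟨⟨c a, mem_seg le_rfl hab⟩, ?_⟩
  rintro _ ⟨m, h1, h2, rfl⟩ _ ⟨m', h1', h2', rfl⟩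
  exact (reflTransGen_symm_of_mem (mem_seg le_rfl hab) (key m h1 h2)).2.trans (key m' h1' h2')

/-- There is an edge between `S` and `T`. -/
def Touch (H : SimpleGraph V) (S T : Set V) : Prop := ∃ u ∈ S, ∃ v ∈ T, H.Adj u v

theorem Touch.symm {H : SimpleGraph V} {S T : Set V} (h : Touch H S T) : Touch H T S := by
  obtain ⟨u, hu, v, hv, h⟩ := h
  exact ⟨v, hv, u, hu, h.symm⟩

theorem isMinor_completeBipartite {H : SimpleGraph V} (A B : Fin 3 → Set V)
    (hA : ∀ i, ConnSet H (A i)) (hB : ∀ i, ConnSet H (B i))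
    (hAA : Pairwise fun i j => Disjoint (A i) (A j))
    (hBB : Pairwise fun i j => Disjoint (B i) (B j))
    (hAB : ∀ i j, Disjoint (A i) (B j)) (h : ∀ i j, Touch H (A i) (B j)) :
    IsMinor (completeBipartiteGraph (Fin 3) (Fin 3)) H := by
  refine ⟨Sum.elim A B, ?_, ?_, ?_⟩
  · rintro (i | i)
    exacts [(hA i).connected, (hB i).connected]
  · rintro (i | i) (j | j) hij
    · exact hAA (by simpa using hij)
    · exact hAB i j
    · exact (hAB j i).symm
    · exact hBB (by simpa using hij)
  · rintro (i | i) (j | j) hij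
    · simp at hij
    · exact h i j
    · exact (h j i).symm
    · simp at hij

theorem isMinor_completeGraph {n : ℕ} {H : SimpleGraph V} (B : Fin n → Set V)
    (hB : ∀ i, ConnSet H (B i)) (hd : ∀ i j, i < j → Disjoint (B i) (B j))
    (h : ∀ i j, i < j → Touch H (B i) (B j)) : IsMinor (completeGraph (Fin n)) H := by
  refine ⟨B, fun i => (hB i).connected, fun i j hij => ?_, fun i j hij => ?_⟩
  · rcases lt_or_gt_of_ne hij with h1 | h1
    exacts [hd i j h1, (hd j i h1).symm]
  · rcases lt_or_gt_of_ne (show i ≠ j from hij) with h1 | h1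
    exacts [h i j h1, (h j i h1).symm]

end

section

variable {V : Type*}

/-- Two sequences agree exactly on a common prefix (up to index `r`) and a common suffix
(the last `s + 1` terms), with something in between. -/
structure Split (n m : ℕ) (p q : ℕ → V) (r s : ℕ) : Prop where
  lt_left : r + s + 1 < n
  lt_right : r + s + 1 < m
  prefix_eq : ∀ k ≤ r, p k = q k
  suffix_eq : ∀ k ≤ s, p (n - k) = q (m - k)
  meet : ∀ a b, a ≤ n → b ≤ m → p a = q b → (a = b ∧ a ≤ r) ∨ (n - a = m - b ∧ n - a ≤ s)

/-- A family of distinct paths from `y` to `x`, each closed to a chordless nonseparating cycle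
by the edge `xy`, any two of which agree before or after each common vertex. -/
structure Arcs {ι : Type*} (H : SimpleGraph V) (x y : V) (n : ι → ℕ) (c : ι → ℕ → V) : Prop where
  closing : H.Adj x y
  two_le : ∀ i, 2 ≤ n i
  adj : ∀ i m, m < n i → H.Adj (c i m) (c i (m + 1))
  inj : ∀ i a b, a ≤ n i → b ≤ n i → c i a = c i b → a = b
  zero : ∀ i, c i 0 = y
  last : ∀ i, c i (n i) = x
  chord : ∀ i a b, a < b → b ≤ n i → H.Adj (c i a) (c i b) → b = a + 1 ∨ (a = 0 ∧ b = n i)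
  meet : ∀ i j a b, i ≠ j → a ≤ n i → b ≤ n j → c i a = c j b →
    (a = b ∧ ∀ k ≤ a, c i k = c j k) ∨
      (n i - a = n j - b ∧ ∀ k ≤ n i - a, c i (n i - k) = c j (n j - k))
  ne : ∀ i j, i ≠ j → n i = n j → ∃ k ≤ n i, c i k ≠ c j k
  cut : ∀ i (D : Set V), (∀ u ∈ D, ∀ m ≤ n i, c i m ≠ u) → (∃ u ∈ D, ∃ w, H.Adj u w) →
    (∃ w, w ∉ D ∧ (∀ m ≤ n i, c i m ≠ w) ∧ ∃ w', H.Adj w w') →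
    ∃ u ∈ D, ∃ w, w ∉ D ∧ (∀ m ≤ n i, c i m ≠ w) ∧ H.Adj u w

namespace Arcs

variable {ι : Type*} {H : SimpleGraph V} {x y : V} {n : ι → ℕ} {c : ι → ℕ → V}

theorem reverse (h : Arcs H x y n c) : Arcs H y x n (fun i m => c i (n i - m)) where
  closing := h.closing.symm
  two_le := h.two_le
  adj i m hm := by
    have := (h.adj i (n i - (m + 1)) (by omega)).symm
    rwa [show n i - (m + 1) + 1 = n i - m by omega] at this
  inj i a b ha hb hab := by
    have := h.inj i _ _ (Nat.sub_le _ _) (Nat.sub_le _ _) hab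
    omega
  zero i := by simpa using h.last i
  last i := by simpa using h.zero i
  chord i a b hab hb hadj := by
    have := h.chord i (n i - b) (n i - a) (by omega) (by omega) hadj.symm
    omega
  meet i j a b hij ha hb hab := by
    rcases h.meet i j _ _ hij (Nat.sub_le _ _) (Nat.sub_le _ _) hab with ⟨h1, h2⟩ | ⟨h1, h2⟩
    · refine Or.inr ⟨h1, fun k hk => ?_⟩
      simp only [show n i - (n i - k) = k by omega, show n j - (n j - k) = k by omega]
      exact h2 k hk
    · refine Or.inl ⟨by omega, fun k hk => h2 k (by omega)⟩
  ne i j hij hn := by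
    obtain ⟨k, hk, hne⟩ := h.ne i j hij hn
    refine ⟨n i - k, Nat.sub_le _ _, ?_⟩
    simpa only [show n i - (n i - k) = k by omega, show n j - (n i - k) = k by omega] using hne
  cut i D hD hne hco := by
    have conv : ∀ w, (∀ m ≤ n i, c i (n i - m) ≠ w) ↔ ∀ m ≤ n i, c i m ≠ w := fun w =>
      ⟨fun hw m hm => by
        have := hw (n i - m) (Nat.sub_le _ _)
        rwa [show n i - (n i - m) = m by omega] at this,
       fun hw m _ => hw _ (Nat.sub_le _ _)⟩
    simp only [conv] at hD hco ⊢
    exact h.cut i D hD hne hco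

theorem lt_of_maximal (h : Arcs H x y n c) {i j : ι} (hij : i ≠ j) {r s : ℕ}
    (hri : r ≤ n i) (hrj : r ≤ n j) (hsi : s ≤ n i) (hsj : s ≤ n j)
    (hr : ∀ k ≤ r, c i k = c j k) (hs : ∀ k ≤ s, c i (n i - k) = c j (n j - k)) :
    r + s + 1 < n i := by
  have hsame : ¬ (n i = n j ∧ n i ≤ r + s + 1) := by
    rintro ⟨hn, hle⟩
    obtain ⟨k, hk, hne⟩ := h.ne i j hij hn
    rcases le_or_gt k r with h1 | h1
    · exact hne (hr k h1)
    · have := hs (n i - k) (by omega)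
      rw [show n i - (n i - k) = k by omega, show n j - (n i - k) = k by omega] at this
      exact hne this
  by_contra hlt
  push Not at hlt
  rcases Nat.lt_or_ge r (n i - s) with h1 | h1
  · have h2 : r + 1 = n i - s := by omega
    have e1 : c i (r + 1) = c j (n j - s) := by rw [h2]; exact hs s le_rfl
    have hadj := h.adj i r (by omega)
    rw [hr r le_rfl, e1] at hadj
    rcases lt_trichotomy r (n j - s) with h3 | h3 | h3
    · have := h.chord j r (n j - s) h3 (Nat.sub_le _ _) hadj
      have := h.two_le i
      omega
    · rw [← h3] at hadj
      exact H.loopless.irrefl _ hadj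
    · have := h.inj i (r + 1) (n j - s) (by omega) (by omega) (by rw [e1, hr _ h3.le])
      omega
  · have e1 : c j (n i - s) = c j (n j - s) := by rw [← hr _ h1]; exact hs s le_rfl
    have := h.inj j _ _ (by omega) (Nat.sub_le _ _) e1
    omega

theorem exists_split (h : Arcs H x y n c) {i j : ι} (hij : i ≠ j) :
    ∃ r s, Split (n i) (n j) (c i) (c j) r s := by
  classical
  let P : ℕ → Prop := fun r => r ≤ n j ∧ ∀ k ≤ r, c i k = c j k
  let Q : ℕ → Prop := fun s => s ≤ n j ∧ ∀ k ≤ s, c i (n i - k) = c j (n j - k)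
  have hP : P (Nat.findGreatest P (n i)) := Nat.findGreatest_spec (Nat.zero_le _)
    ⟨Nat.zero_le _, fun k hk => by rw [Nat.le_zero.1 hk, h.zero, h.zero]⟩
  have hQ : Q (Nat.findGreatest Q (n i)) := Nat.findGreatest_spec (Nat.zero_le _)
    ⟨Nat.zero_le _, fun k hk => by rw [Nat.le_zero.1 hk]; simp [h.last]⟩
  have hPn := Nat.findGreatest_le (P := P) (n i)
  have hQn := Nat.findGreatest_le (P := Q) (n i)
  refine ⟨_, _, h.lt_of_maximal hij hPn hP.1 hQn hQ.1 hP.2 hQ.2,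
    h.lt_of_maximal hij.symm hP.1 hPn hQ.1 hQn (fun k hk => (hP.2 k hk).symm)
      (fun k hk => (hQ.2 k hk).symm), hP.2, hQ.2, fun a b ha hb hab => ?_⟩
  rcases h.meet i j a b hij ha hb hab with ⟨h1, h2⟩ | ⟨h1, h2⟩
  · exact Or.inl ⟨h1, Nat.le_findGreatest ha ⟨by omega, h2⟩⟩
  · exact Or.inr ⟨h1, Nat.le_findGreatest (Nat.sub_le _ _) ⟨by omega, h2⟩⟩

theorem exists_adj (h : Arcs H x y n c) (i : ι) {m : ℕ} (hm : m ≤ n i) :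
    ∃ w, H.Adj (c i m) w := by
  rcases Nat.lt_or_ge m (n i) with h1 | h1
  · exact ⟨_, h.adj i m h1⟩
  · obtain rfl : m = n i := le_antisymm hm h1
    exact ⟨y, by rw [h.last]; exact h.closing⟩

/-- If the common prefix of two arcs has an inner vertex with a neighbour off both of them,
there is a `K₃,₃` minor. -/
theorem isMinor_of_inner (h : Arcs H x y n c) {i j : ι} {r s : ℕ}
    (hs : Split (n i) (n j) (c i) (c j) r s) {m₀ : ℕ} (hm₀ : m₀ < r) {a : V}
    (hai : ∀ m ≤ n i, c i m ≠ a) (haj : ∀ m ≤ n j, c j m ≠ a) (ha : H.Adj (c i m₀) a) :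
    IsMinor (completeBipartiteGraph (Fin 3) (Fin 3)) H := by
  have l1 := hs.lt_left
  have l2 := hs.lt_right
  let Z : Set V := {z | (∀ m ≤ n i, c i m ≠ z) ∧ ∀ m ≤ n j, c j m ≠ z}
  have haZ : a ∈ Z := ⟨hai, haj⟩
  have hKZ := compIn_subset (H := H) haZ
  have hK := connSet_compIn (H := H) (Z := Z) (a := a)
  set K := compIn H Z a with hKdef
  let Q := seg (c i) 0 m₀
  let U := seg (c i) (m₀ + 1) r
  let P := seg (c i) (n i - s) (n i)
  let A := seg (c i) (r + 1) (n i - s - 1)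
  let B := seg (c j) (r + 1) (n j - s - 1)
  have disj : ∀ {k l k' l'}, l < k' → l' ≤ n i → Disjoint (seg (c i) k l) (seg (c i) k' l') := by
    intro k l k' l' h1 h2
    rw [Set.disjoint_left]
    rintro _ ⟨m, hm1, hm2, rfl⟩ ⟨m', hm1', hm2', e⟩
    have := h.inj i _ _ (by omega) (by omega) e
    omega
  have disjB : ∀ {k l}, l ≤ n i → Disjoint (seg (c i) k l) B := by
    intro k l h1
    rw [Set.disjoint_left]
    rintro _ ⟨m, hm1, hm2, rfl⟩ ⟨m', hm1', hm2', e⟩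
    have := hs.meet _ _ (by omega) (by omega) e.symm
    omega
  have disjK : ∀ {k l}, l ≤ n i → Disjoint (seg (c i) k l) K := by
    intro k l h1
    rw [Set.disjoint_left]
    rintro _ ⟨m, hm1, hm2, rfl⟩ hz
    exact (hKZ hz).1 m (by omega) rfl
  have disjBK : Disjoint B K := by
    rw [Set.disjoint_left]
    rintro _ ⟨m, hm1, hm2, rfl⟩ hz
    exact (hKZ hz).2 m (by omega) rfl
  have conn : ∀ {k l}, k ≤ l → l ≤ n i → ConnSet H (seg (c i) k l) := fun h1 h2 =>
    connSet_seg h1 fun m _ hm => h.adj i m (by omega)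
  have connB : ConnSet H B := connSet_seg (by omega) fun m _ hm => h.adj j m (by omega)
  have tKA : Touch H K A := by
    obtain ⟨u, hu, w, hw, hwj, huw⟩ := h.cut j K (fun u hu => (hKZ hu).2)
      ⟨a, self_mem_compIn _ _ _, _, ha.symm⟩
      ⟨c i (r + 1), fun hh => (hKZ hh).1 _ (by omega) rfl, fun m hm e => by
        have := hs.meet _ _ (by omega) hm e.symm
        omega, h.exists_adj i (by omega)⟩
    refine ⟨u, hu, w, ?_, huw⟩
    by_cases hwZ : w ∈ Z
    · exact (hw (mem_compIn_of_adj hu huw hwZ)).elim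
    · have : ∃ m ≤ n i, c i m = w := by
        by_contra hcon
        push Not at hcon
        exact hwZ ⟨hcon, hwj⟩
      obtain ⟨m, hm, rfl⟩ := this
      refine mem_seg ?_ ?_
      · by_contra hlt
        exact hwj m (by omega) (hs.prefix_eq m (by omega)).symm
      · by_contra hlt
        have := hs.suffix_eq (n i - m) (by omega)
        rw [show n i - (n i - m) = m by omega] at this
        exact hwj _ (Nat.sub_le _ _) this.symm
  have tKB : Touch H K B := by
    obtain ⟨u, hu, w, hw, hwi, huw⟩ := h.cut i K (fun u hu => (hKZ hu).1)
      ⟨a, self_mem_compIn _ _ _, _, ha.symm⟩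
      ⟨c j (r + 1), fun hh => (hKZ hh).2 _ (by omega) rfl, fun m hm e => by
        have := hs.meet _ _ hm (by omega) e
        omega, h.exists_adj j (by omega)⟩
    refine ⟨u, hu, w, ?_, huw⟩
    by_cases hwZ : w ∈ Z
    · exact (hw (mem_compIn_of_adj hu huw hwZ)).elim
    · have : ∃ m ≤ n j, c j m = w := by
        by_contra hcon
        push Not at hcon
        exact hwZ ⟨hwi, hcon⟩
      obtain ⟨m, hm, rfl⟩ := this
      refine mem_seg ?_ ?_
      · by_contra hlt
        exact hwi m (by omega) (hs.prefix_eq m (by omega))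
      · by_contra hlt
        have := hs.suffix_eq (n j - m) (by omega)
        rw [show n j - (n j - m) = m by omega] at this
        exact hwi _ (Nat.sub_le _ _) this
  have step : ∀ {k l k' l' m}, m < n i → k ≤ m → m ≤ l → k' ≤ m + 1 → m + 1 ≤ l' →
      Touch H (seg (c i) k l) (seg (c i) k' l') := fun h1 h2 h3 h4 h5 =>
    ⟨_, mem_seg h2 h3, _, mem_seg h4 h5, h.adj i _ h1⟩
  have tPQ : Touch H P Q := ⟨_, mem_seg (Nat.sub_le _ _) le_rfl, _, mem_seg le_rfl (Nat.zero_le _),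
    by rw [h.last, h.zero]; exact h.closing⟩
  have tPA : Touch H P A := (step (m := n i - s - 1) (by omega) (by omega) (by omega) (by omega)
    (by omega)).symm
  have tPB : Touch H P B := by
    refine ⟨c i (n i - s), mem_seg le_rfl (Nat.sub_le _ _), c j (n j - s - 1),
      mem_seg (by omega) le_rfl, ?_⟩
    rw [hs.suffix_eq s le_rfl]
    have := (h.adj j (n j - s - 1) (by omega)).symm
    rwa [show n j - s - 1 + 1 = n j - s by omega] at this
  have tUQ : Touch H U Q := (step (m := m₀) (by omega) (by omega) (by omega) (by omega)
    (by omega)).symm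
  have tUA : Touch H U A := step (m := r) (by omega) (by omega) (by omega) (by omega) (by omega)
  have tUB : Touch H U B := ⟨c i r, mem_seg (by omega) le_rfl, c j (r + 1),
    mem_seg le_rfl (by omega), by rw [hs.prefix_eq r le_rfl]; exact h.adj j r (by omega)⟩
  have tKQ : Touch H K Q := ⟨a, self_mem_compIn _ _ _, _, mem_seg (Nat.zero_le _) le_rfl, ha.symm⟩
  have cQ : ConnSet H Q := conn (by omega) (by omega)
  have cU : ConnSet H U := conn (by omega) (by omega)
  have cP : ConnSet H P := conn (by omega) (by omega)
  have cA : ConnSet H A := conn (by omega) (by omega)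
  have dPU : Disjoint P U := (disj (by omega) (by omega)).symm
  have dPK : Disjoint P K := disjK (by omega)
  have dUK : Disjoint U K := disjK (by omega)
  have dQA : Disjoint Q A := disj (by omega) (by omega)
  have dQB : Disjoint Q B := disjB (by omega)
  have dAB : Disjoint A B := disjB (by omega)
  have dPQ : Disjoint P Q := (disj (by omega) (by omega)).symm
  have dPA : Disjoint P A := (disj (by omega) (by omega)).symm
  have dPB : Disjoint P B := disjB (by omega)
  have dUQ : Disjoint U Q := (disj (by omega) (by omega)).symm
  have dUA : Disjoint U A := disj (by omega) (by omega)
  have dUB : Disjoint U B := disjB (by omega)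
  have dKQ : Disjoint K Q := (disjK (by omega)).symm
  have dKA : Disjoint K A := (disjK (by omega)).symm
  refine isMinor_completeBipartite ![P, U, K] ![Q, A, B] ?_ ?_ ?_ ?_ ?_ ?_
  · intro k; fin_cases k <;> assumption
  · intro k; fin_cases k <;> assumption
  · intro k l hkl
    fin_cases k <;> fin_cases l <;> first | exact (hkl rfl).elim | assumption | (symm; assumption)
  · intro k l hkl
    fin_cases k <;> fin_cases l <;> first | exact (hkl rfl).elim | assumption | (symm; assumption)
  · intro k l
    fin_cases k <;> fin_cases l <;> first | assumption | (symm; assumption)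
  · intro k l
    fin_cases k <;> fin_cases l <;> assumption

end Arcs

end

section

variable {V : Type*}

theorem Split.le_of_prefix {n m r s t : ℕ} {p q : ℕ → V} (hs : Split n m p q r s) (htn : t ≤ n)
    (htm : t ≤ m) (h : ∀ k ≤ t, p k = q k) : t ≤ r := by
  by_contra hlt
  have := hs.meet (r + 1) (r + 1) (by omega) (by omega) (h _ (by omega))
  have := hs.lt_left
  omega

theorem Split.reverse {n m r s : ℕ} {p q : ℕ → V} (hs : Split n m p q r s) :
    Split n m (fun k => p (n - k)) (fun k => q (m - k)) s r where
  lt_left := by have := hs.lt_left; omega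
  lt_right := by have := hs.lt_right; omega
  prefix_eq := hs.suffix_eq
  suffix_eq k hk := by
    have := hs.lt_left
    have := hs.lt_right
    simp only [show n - (n - k) = k by omega, show m - (m - k) = k by omega]
    exact hs.prefix_eq k hk
  meet a b ha hb hab := by
    have := hs.meet _ _ (Nat.sub_le _ _) (Nat.sub_le _ _) hab
    omega

namespace Arcs

section

variable {ι : Type*} {H : SimpleGraph V} {x y : V} {n : ι → ℕ} {c : ι → ℕ → V}

theorem prefix_le (h : Arcs H x y n c) (hH : ¬ IsMinor (completeBipartiteGraph (Fin 3) (Fin 3)) H)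
    {i j k : ι} {r s r' s' r'' s'' : ℕ}
    (hij : Split (n i) (n j) (c i) (c j) r s) (hik : Split (n i) (n k) (c i) (c k) r' s')
    (hjk : Split (n j) (n k) (c j) (c k) r'' s'') : r ≤ r' := by
  by_contra hlt
  push Not at hlt
  have l1 := hij.lt_left
  have l2 := hij.lt_right
  have l3 := hik.lt_right
  have l4 := hjk.lt_right
  have hle : r' ≤ r'' := hjk.le_of_prefix (by omega) (by omega) fun t ht => by
    rw [← hij.prefix_eq t (by omega), hik.prefix_eq t ht]
  have hai : ∀ m ≤ n i, c i m ≠ c k (r' + 1) := fun m hm e => by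
    have := hik.meet _ _ hm (by omega) e
    omega
  refine hH (h.isMinor_of_inner hij hlt hai (fun m hm e => ?_) (a := c k (r' + 1)) ?_)
  · rcases hjk.meet _ _ hm (by omega) e with ⟨h1, h2⟩ | h1
    · subst h1
      exact hai (r' + 1) (by omega) ((hij.prefix_eq _ (by omega)).trans e)
    · omega
  · rw [hik.prefix_eq r' le_rfl]
    exact h.adj k r' (by omega)

end

variable {H : SimpleGraph V} {x y : V} {n : Fin 3 → ℕ} {c : Fin 3 → ℕ → V}

theorem exists_common_prefix (h : Arcs H x y n c)
    (hH : ¬ IsMinor (completeBipartiteGraph (Fin 3) (Fin 3)) H) :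
    ∃ R, ∀ i j r s, i ≠ j → Split (n i) (n j) (c i) (c j) r s → r = R := by
  obtain ⟨R, S, hRS⟩ := h.exists_split (show (0 : Fin 3) ≠ 1 by decide)
  have symm : ∀ i j r s r' s', Split (n i) (n j) (c i) (c j) r s →
      Split (n j) (n i) (c j) (c i) r' s' → r = r' := by
    intro i j r s r' s' h1 h2
    have := h1.lt_left
    have := h1.lt_right
    have := h2.lt_left
    have := h2.lt_right
    apply le_antisymm
    · exact h2.le_of_prefix (by omega) (by omega) fun k hk => (h1.prefix_eq k hk).symm
    · exact h1.le_of_prefix (by omega) (by omega) fun k hk => (h2.prefix_eq k hk).symm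
  have other : ∀ i j k r s r' s', i ≠ j → i ≠ k → j ≠ k → Split (n i) (n j) (c i) (c j) r s →
      Split (n i) (n k) (c i) (c k) r' s' → r = r' := by
    intro i j k r s r' s' _ _ hjk h1 h2
    obtain ⟨_, _, h3⟩ := h.exists_split hjk
    obtain ⟨_, _, h4⟩ := h.exists_split hjk.symm
    exact le_antisymm (h.prefix_le hH h1 h2 h3) (h.prefix_le hH h2 h1 h4)
  obtain ⟨r10, s10, h10⟩ := h.exists_split (show (1 : Fin 3) ≠ 0 by decide)
  obtain ⟨r02, s02, h02⟩ := h.exists_split (show (0 : Fin 3) ≠ 2 by decide)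
  obtain ⟨r20, s20, h20⟩ := h.exists_split (show (2 : Fin 3) ≠ 0 by decide)
  obtain ⟨r12, s12, h12⟩ := h.exists_split (show (1 : Fin 3) ≠ 2 by decide)
  have e10 := symm _ _ _ _ _ _ hRS h10
  have e02 := other _ _ _ _ _ _ _ (by decide) (by decide) (by decide) hRS h02
  have e20 := symm _ _ _ _ _ _ h02 h20
  have e12 := other _ _ _ _ _ _ _ (by decide) (by decide) (by decide) h10 h12
  refine ⟨R, fun i j r s hij hs => ?_⟩
  fin_cases i <;> fin_cases j
  · exact (hij rfl).elim
  · exact (symm _ _ _ _ _ _ hs h10).trans e10.symm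
  · exact (symm _ _ _ _ _ _ hs h20).trans (e20.symm.trans e02.symm)
  · exact (symm _ _ _ _ _ _ hs hRS)
  · exact (hij rfl).elim
  · exact (other _ _ _ _ _ _ _ (by decide) (by decide) (by decide) hs h10).trans e10.symm
  · exact (symm _ _ _ _ _ _ hs h02).trans e02.symm
  · exact (symm _ _ _ _ _ _ hs h12).trans (e12.symm.trans e10.symm)
  · exact (hij rfl).elim

theorem exists_common_split (h : Arcs H x y n c)
    (hH : ¬ IsMinor (completeBipartiteGraph (Fin 3) (Fin 3)) H) :
    ∃ R S, ∀ i j, i ≠ j → Split (n i) (n j) (c i) (c j) R S := by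
  obtain ⟨R, hR⟩ := h.exists_common_prefix hH
  obtain ⟨S, hS⟩ := h.reverse.exists_common_prefix hH
  refine ⟨R, S, fun i j hij => ?_⟩
  obtain ⟨r, s, hs⟩ := h.exists_split hij
  obtain rfl := hR i j r s hij hs
  obtain rfl := hS i j s r hij hs.reverse
  exact hs

/-- Three arcs produce a `K₅` or a `K₃,₃` minor. -/
theorem isMinor (h : Arcs H x y n c) : IsMinor (completeGraph (Fin 5)) H ∨
    IsMinor (completeBipartiteGraph (Fin 3) (Fin 3)) H := by
  by_contra hcon
  push Not at hcon
  obtain ⟨hK5, hK33⟩ := hcon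
  obtain ⟨R, S, hs⟩ := h.exists_common_split hK33
  have lt : ∀ i, R + S + 1 < n i := fun i => (hs i (i + 1) (by fin_cases i <;> decide)).lt_left
  have lt0 := lt 0
  let X := seg (c 0) (n 0 - S) (n 0)
  let Y := seg (c 0) 0 R
  let A : Fin 3 → Set V := fun i => seg (c i) (R + 1) (n i - S - 1)
  let Z : Set V := {z | ∀ i, ∀ m ≤ n i, c i m ≠ z}
  let T : V → Fin 3 → Prop := fun z i => Touch H (compIn H Z z) (A i)
  have memX : ∀ i, ∀ k ≤ S, c i (n i - k) ∈ X := by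
    intro i k hk
    rcases eq_or_ne i 0 with rfl | hi
    · exact mem_seg (by omega) (by omega)
    · rw [(hs i 0 hi).suffix_eq k hk]
      exact mem_seg (by omega) (by omega)
  have memY : ∀ i, ∀ k ≤ R, c i k ∈ Y := by
    intro i k hk
    rcases eq_or_ne i 0 with rfl | hi
    · exact mem_seg (by omega) (by omega)
    · rw [(hs i 0 hi).prefix_eq k hk]
      exact mem_seg (by omega) (by omega)
  have cX : ConnSet H X := connSet_seg (by omega) fun m _ hm => h.adj 0 m (by omega)
  have cY : ConnSet H Y := connSet_seg (by omega) fun m _ hm => h.adj 0 m (by omega)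
  have cA : ∀ i, ConnSet H (A i) := fun i => by
    have := lt i
    exact connSet_seg (by omega) fun m _ hm => h.adj i m (by omega)
  have dXY : Disjoint X Y := by
    rw [Set.disjoint_left]
    rintro _ ⟨m, h1, h2, rfl⟩ ⟨m', h1', h2', e⟩
    have := h.inj 0 _ _ (by omega) (by omega) e
    omega
  have nA : ∀ i j, i ≠ j → ∀ m ≤ n j, c j m ∉ A i := by
    rintro i j hij m hm ⟨m', h1, h2, e⟩
    have := lt i
    have := (hs i j hij).meet _ _ (by omega) hm e
    omega
  have dAA : Pairwise fun i j => Disjoint (A i) (A j) := by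
    intro i j hij
    rw [Set.disjoint_left]
    rintro _ hz ⟨m, h1, h2, rfl⟩
    have := lt j
    exact nA i j hij m (by omega) hz
  have dAX : ∀ i, Disjoint (A i) X := by
    intro i
    rw [Set.disjoint_right]
    rintro _ ⟨m, h1, h2, rfl⟩ hz
    rcases eq_or_ne i 0 with rfl | hi
    · obtain ⟨m', h1', h2', e⟩ := hz
      have := h.inj 0 _ _ (by omega) (by omega) e
      omega
    · exact nA i 0 hi m (by omega) hz
  have dAY : ∀ i, Disjoint (A i) Y := by
    intro i
    rw [Set.disjoint_right]
    rintro _ ⟨m, h1, h2, rfl⟩ hz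
    rcases eq_or_ne i 0 with rfl | hi
    · obtain ⟨m', h1', h2', e⟩ := hz
      have := h.inj 0 _ _ (by omega) (by omega) e
      omega
    · exact nA i 0 hi m (by omega) hz
  have dXZ : Disjoint X Z := by
    rw [Set.disjoint_left]
    rintro _ ⟨m, h1, h2, rfl⟩ hz
    exact hz 0 m (by omega) rfl
  have dYZ : Disjoint Y Z := by
    rw [Set.disjoint_left]
    rintro _ ⟨m, h1, h2, rfl⟩ hz
    exact hz 0 m (by omega) rfl
  have dAZ : ∀ i, Disjoint (A i) Z := by
    intro i
    rw [Set.disjoint_left]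
    rintro _ ⟨m, h1, h2, rfl⟩ hz
    exact hz i m (by omega) rfl
  have tXY : Touch H X Y := ⟨_, memX 0 0 (Nat.zero_le _), _, memY 0 0 (Nat.zero_le _), by
    rw [Nat.sub_zero, h.last, h.zero]; exact h.closing⟩
  have tXA : ∀ i, Touch H X (A i) := by
    intro i
    have := lt i
    refine ⟨_, memX i S le_rfl, c i (n i - S - 1), mem_seg (by omega) le_rfl, ?_⟩
    have := (h.adj i (n i - S - 1) (by omega)).symm
    rwa [show n i - S - 1 + 1 = n i - S by omega] at this
  have tYA : ∀ i, Touch H Y (A i) := by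
    intro i
    have := lt i
    exact ⟨_, memY i R le_rfl, c i (R + 1), mem_seg le_rfl (by omega), h.adj i R (by omega)⟩
  have memA : ∀ i j, i ≠ j → ∀ m ≤ n i, (∀ m' ≤ n j, c j m' ≠ c i m) → c i m ∈ A i := by
    intro i j hij m hm hne
    have l1 := lt i
    have l2 := lt j
    refine mem_seg ?_ ?_
    · by_contra hlt
      exact hne m (by omega) ((hs i j hij).prefix_eq m (by omega)).symm
    · by_contra hlt
      have := (hs i j hij).suffix_eq (n i - m) (by omega)
      rw [show n i - (n i - m) = m by omega] at this
      exact hne _ (Nat.sub_le _ _) this.symm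
  have noThree : ∀ z ∈ Z, ¬ ∀ i, T z i := by
    intro z hz hT
    have hKZ := compIn_subset (H := H) hz
    refine hK33 (isMinor_completeBipartite A ![X, Y, compIn H Z z] cA ?_ dAA ?_ ?_ ?_)
    · intro k; fin_cases k
      exacts [cX, cY, connSet_compIn]
    · intro k l hkl
      have d1 : Disjoint X (compIn H Z z) := dXZ.mono_right hKZ
      have d2 : Disjoint Y (compIn H Z z) := dYZ.mono_right hKZ
      fin_cases k <;> fin_cases l <;> first | exact (hkl rfl).elim | assumption | (symm; assumption)
    · intro i k; fin_cases k
      exacts [dAX i, dAY i, (dAZ i).mono_right hKZ]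
    · intro i k; fin_cases k
      exacts [(tXA i).symm, (tYA i).symm, (hT i).symm]
  let B : Fin 3 → Set V := fun i => A i ∪ {z | z ∈ Z ∧ T z i ∧ T z (i + 1)}
  have cB : ∀ i, ConnSet H (B i) := by
    intro i
    refine (cA i).of_hub Set.subset_union_left ?_
    rintro z (hz | ⟨hz, h1, h2⟩)
    · exact Or.inl hz
    · refine Or.inr ⟨compIn H Z z, fun w hw => Or.inr ⟨compIn_subset hz hw, ?_, ?_⟩,
        self_mem_compIn _ _ _, connSet_compIn, h1⟩
      · simpa only [T, compIn_eq hz hw] using h1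
      · simpa only [T, compIn_eq hz hw] using h2
  have dBX : ∀ i, Disjoint X (B i) := fun i =>
    Set.disjoint_union_right.2 ⟨(dAX i).symm, dXZ.mono_right fun _ hz => hz.1⟩
  have dBY : ∀ i, Disjoint Y (B i) := fun i =>
    Set.disjoint_union_right.2 ⟨(dAY i).symm, dYZ.mono_right fun _ hz => hz.1⟩
  have dBB : ∀ i j, i ≠ j → Disjoint (B i) (B j) := by
    intro i j hij
    rw [Set.disjoint_left]
    rintro z (hz | ⟨hz, h1, h2⟩) (hz' | ⟨hz', h1', h2'⟩)
    · exact Set.disjoint_left.1 (dAA hij) hz hz'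
    · exact Set.disjoint_left.1 (dAZ i) hz hz'
    · exact Set.disjoint_left.1 (dAZ j) hz' hz
    · refine noThree z hz fun k => ?_
      have : k = i ∨ k = i + 1 ∨ k = j ∨ k = j + 1 :=
        (by decide : ∀ i j : Fin 3, i ≠ j → ∀ k, k = i ∨ k = i + 1 ∨ k = j ∨ k = j + 1) i j hij k
      rcases this with rfl | rfl | rfl | rfl <;> assumption
  have tBX : ∀ i, Touch H X (B i) := fun i => by
    obtain ⟨u, hu, v, hv, huv⟩ := tXA i
    exact ⟨u, hu, v, Or.inl hv, huv⟩
  have tBY : ∀ i, Touch H Y (B i) := fun i => by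
    obtain ⟨u, hu, v, hv, huv⟩ := tYA i
    exact ⟨u, hu, v, Or.inl hv, huv⟩
  have tBB : ∀ i, Touch H (B i) (B (i + 1)) := by
    intro i
    have i1 : i ≠ i + 2 := by revert i; decide
    have i2 : i + 1 ≠ i + 2 := by revert i; decide
    have i3 : i ≠ i + 1 := by revert i; decide
    have l1 := lt i
    have l2 := lt (i + 1)
    have mA : c (i + 1) (R + 1) ∈ A (i + 1) := mem_seg le_rfl (by omega)
    have hD : ∀ u ∈ A i ∪ {z | z ∈ Z ∧ T z i}, ∀ m ≤ n (i + 2), c (i + 2) m ≠ u := by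
      rintro u (hu | ⟨hu, -⟩) m hm rfl
      · exact nA _ _ i1 m hm hu
      · exact hu _ m hm rfl
    have hcD : c (i + 1) (R + 1) ∉ A i ∪ {z | z ∈ Z ∧ T z i} := by
      rintro (hu | ⟨hu, -⟩)
      · exact Set.disjoint_left.1 (dAA i3) hu mA
      · exact Set.disjoint_left.1 (dAZ _) mA hu
    obtain ⟨u, hu, w, hw, hwc, huw⟩ := h.cut (i + 2) (A i ∪ {z | z ∈ Z ∧ T z i}) hD
      ⟨c i (R + 1), Or.inl (mem_seg le_rfl (by omega)), _, h.adj i _ (by omega)⟩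
      ⟨c (i + 1) (R + 1), hcD, fun m hm e => nA _ _ i2 m hm (e ▸ mA), h.exists_adj _ (by omega)⟩
    have hwZ : w ∉ Z := by
      intro hwZ
      refine hw (Or.inr ⟨hwZ, ?_⟩)
      rcases hu with hu | ⟨hu, v, hv, t, ht, hvt⟩
      · exact ⟨w, self_mem_compIn _ _ _, u, hu, huw.symm⟩
      · refine ⟨v, ?_, t, ht, hvt⟩
        rwa [compIn_eq hu (mem_compIn_of_adj (self_mem_compIn _ _ _) huw hwZ)]
    have hwA : w ∈ A (i + 1) := by
      have : ∃ j, ∃ m ≤ n j, c j m = w := by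
        by_contra hcon
        push Not at hcon
        exact hwZ hcon
      obtain ⟨j, m, hm, rfl⟩ := this
      have : j = i ∨ j = i + 1 ∨ j = i + 2 :=
        (by decide : ∀ i j : Fin 3, j = i ∨ j = i + 1 ∨ j = i + 2) i j
      rcases this with rfl | rfl | rfl
      · exact (hw (Or.inl (memA _ _ i1 m hm hwc))).elim
      · exact memA _ _ i2 m hm hwc
      · exact (hwc m hm rfl).elim
    refine ⟨u, ?_, w, Or.inl hwA, huw⟩
    rcases hu with hu | ⟨hu, hT⟩
    · exact Or.inl hu
    · exact Or.inr ⟨hu, hT, u, self_mem_compIn _ _ _, w, hwA, huw⟩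
  refine hK5 (isMinor_completeGraph ![X, Y, B 0, B 1, B 2] ?_ ?_ ?_)
  · intro k; fin_cases k
    exacts [cX, cY, cB 0, cB 1, cB 2]
  · have d1 := dBX 0
    have d2 := dBX 1
    have d3 := dBX 2
    have d4 := dBY 0
    have d5 := dBY 1
    have d6 := dBY 2
    have d7 := dBB 0 1 (by decide)
    have d8 := dBB 0 2 (by decide)
    have d9 := dBB 1 2 (by decide)
    intro k l hkl
    fin_cases k <;> fin_cases l <;> first | assumption | exact absurd hkl (by decide)
  · have d1 := tBX 0
    have d2 := tBX 1
    have d3 := tBX 2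
    have d4 := tBY 0
    have d5 := tBY 1
    have d6 := tBY 2
    have d7 : Touch H (B 0) (B 1) := tBB 0
    have d8 : Touch H (B 0) (B 2) := (tBB 2).symm
    have d9 : Touch H (B 1) (B 2) := tBB 1
    intro k l hkl
    fin_cases k <;> fin_cases l <;> first | assumption | exact absurd hkl (by decide)

end Arcs

end

section

variable {V : Type*}

open Classical in
/-- The edges of a graph on a finite vertex set. -/
noncomputable def edgeF [Fintype V] (H : SimpleGraph V) : Finset (Sym2 V) :=
  Finset.univ.filter (· ∈ H.edgeSet)

open Classical in
/-- The non-isolated vertices of a graph on a finite vertex set. -/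
noncomputable def suppF [Fintype V] (H : SimpleGraph V) : Finset V :=
  Finset.univ.filter fun v => ∃ w, H.Adj v w

section

variable [Fintype V] {H : SimpleGraph V}

@[simp] theorem mem_edgeF {e : Sym2 V} : e ∈ edgeF H ↔ e ∈ H.edgeSet := by simp [edgeF]

@[simp] theorem mem_suppF {v : V} : v ∈ suppF H ↔ ∃ w, H.Adj v w := by simp [suppF]

theorem card_suppF_le (h : ∀ v w, H.Adj v w → ∃ w', w' ≠ w ∧ H.Adj v w') :
    (suppF H).card ≤ (edgeF H).card := by
  classical
  have h1 := H.sum_degrees_eq_twice_card_edges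
  have h2 : H.edgeFinset = edgeF H := by ext; simp
  have h3 : ∑ v ∈ suppF H, 2 ≤ ∑ v, H.degree v := by
    refine (Finset.sum_le_sum fun v hv => ?_).trans
      (Finset.sum_le_sum_of_subset (Finset.subset_univ (suppF H)))
    obtain ⟨w, hw⟩ := mem_suppF.1 hv
    obtain ⟨w', hne, hw'⟩ := h v w hw
    rw [← card_neighborFinset_eq_degree]
    exact Finset.one_lt_card.2 ⟨w, by simpa, w', by simpa, hne.symm⟩
  rw [h1, h2, Finset.sum_const, smul_eq_mul] at h3
  omega

theorem IsAcyclic.card_edgeF_lt (hH : H.IsAcyclic) (hpos : 0 < (edgeF H).card) :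
    (edgeF H).card < (suppF H).card := by
  classical
  obtain ⟨e, he⟩ := Finset.card_pos.1 hpos
  induction e using Sym2.ind with | _ a b =>
  have hab : H.Adj a b := by simpa using he
  have : Nonempty (suppF H) := ⟨⟨a, mem_suppF.2 ⟨b, hab⟩⟩⟩
  have hconn : (⊤ : SimpleGraph (suppF H)).Connected := connected_top
  obtain ⟨T, hle, -, hT⟩ := hconn.exists_isTree_le_of_le_of_isAcyclic le_top
    (hH.comap (G := H.comap (Subtype.val : suppF H → V)) ⟨Subtype.val, fun h => h⟩
      Subtype.val_injective)
  have hc := hT.card_edgeFinset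
  rw [Fintype.card_coe] at hc
  have : (edgeF H).card ≤ T.edgeFinset.card := by
    refine Finset.card_le_card_of_surjOn (Sym2.map Subtype.val) ?_
    intro e he
    induction e using Sym2.ind with | _ a b =>
    have hab : H.Adj a b := by simpa using he
    have hT' : T.Adj ⟨a, mem_suppF.2 ⟨b, hab⟩⟩ ⟨b, mem_suppF.2 ⟨a, hab.symm⟩⟩ := hle hab
    exact ⟨s(_, _), by simpa using hT', rfl⟩
  omega

end

/-- `C` is the edge set of a cycle. -/
def IsCyc (H : SimpleGraph V) (C : Finset (Sym2 V)) : Prop :=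
  ∃ v, ∃ w : H.Walk v v, w.IsCycle ∧ ∀ e, e ∈ C ↔ e ∈ w.edges

theorem IsCyc.mono {H G : SimpleGraph V} {C : Finset (Sym2 V)} (hHG : H ≤ G) (h : IsCyc H C) :
    IsCyc G C := by
  obtain ⟨v, w, hw, hC⟩ := h
  exact ⟨v, w.mapLe hHG, hw.mapLe hHG, by simpa using hC⟩

theorem IsCyc.subset [Fintype V] {H : SimpleGraph V} {C : Finset (Sym2 V)} (h : IsCyc H C) :
    C ⊆ edgeF H := by
  obtain ⟨v, w, hw, hC⟩ := h
  exact fun e he => mem_edgeF.2 (w.edges_subset_edgeSet ((hC e).1 he))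

theorem SimpleGraph.Walk.IsCycle.isCyc [DecidableEq V] {H : SimpleGraph V} {v : V} {w : H.Walk v v}
    (hw : w.IsCycle) : IsCyc H w.edges.toFinset :=
  ⟨v, w, hw, by simp⟩

theorem sum_toFinset_edges [DecidableEq V] {H : SimpleGraph V} {u v : V} {w : H.Walk u v}
    (hw : w.IsTrail) (f : Sym2 V → ℝ) : ∑ e ∈ w.edges.toFinset, f e = (w.edges.map f).sum :=
  List.sum_toFinset _ hw.edges_nodup

theorem IsCyc.sum_eq {H : SimpleGraph V} {C : Finset (Sym2 V)} {v : V} {w : H.Walk v v}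
    (hw : w.IsCycle) (hC : ∀ e, e ∈ C ↔ e ∈ w.edges) (f : Sym2 V → ℝ) :
    ∑ e ∈ C, f e = (w.edges.map f).sum := by
  classical
  rw [← sum_toFinset_edges hw.isTrail]
  congr 1
  ext e
  simp [hC]

theorem exists_isCyc [Fintype V] {H : SimpleGraph V} (hpos : 0 < (edgeF H).card)
    (hn : (suppF H).card ≤ (edgeF H).card) : ∃ C, IsCyc H C := by
  classical
  by_contra hcon
  push Not at hcon
  have : H.IsAcyclic := fun v w hw => hcon _ hw.isCyc
  have := IsAcyclic.card_edgeF_lt this hpos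
  omega

/-- A cycle through two vertices splits into two paths. -/
theorem IsCyc.exists_paths {H : SimpleGraph V} {v x y : V} {w : H.Walk v v} (hw : w.IsCycle)
    (hx : x ∈ w.support) (hy : y ∈ w.support) (hxy : x ≠ y) :
    ∃ p q : H.Walk y x, p.IsPath ∧ q.IsPath ∧ (∀ e, e ∈ w.edges ↔ e ∈ p.edges ∨ e ∈ q.edges) ∧
      (∀ e, e ∈ p.edges → e ∉ q.edges) ∧ ∀ f : Sym2 V → ℝ,
      (w.edges.map f).sum = (p.edges.map f).sum + (q.edges.map f).sum := by
  classical
  have hr := hw.rotate hy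
  have hx' : x ∈ (w.rotate y hy).support := (Walk.mem_support_rotate_iff ..).2 hx
  have hperm : (w.rotate y hy).edges.Perm w.edges := (w.rotate_edges y hy).perm
  set W := w.rotate y hy
  have hspec := W.take_spec hx'
  have hedges : W.edges = (W.takeUntil x hx').edges ++ (W.dropUntil x hx').edges := by
    rw [← Walk.edges_append, hspec]
  have hnd := hr.isTrail.edges_nodup
  rw [hedges, List.nodup_append] at hnd
  refine ⟨W.takeUntil x hx', (W.dropUntil x hx').reverse, hr.isPath_takeUntil hx', ?_, ?_, ?_, ?_⟩
  · refine Walk.IsPath.reverse ?_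
    rw [← hspec] at hr
    exact hr.isPath_of_append_right (by simpa using hxy.symm)
  · intro e
    rw [← hperm.mem_iff, hedges]
    simp
  · intro e he he'
    exact hnd.2.2 e he e (by simpa using he') rfl
  · intro f
    rw [← (hperm.map f).sum_eq, hedges]
    simp [List.sum_reverse]

theorem IsCyc.exists_path {H : SimpleGraph V} {l : Sym2 V → ℝ} {g : ℝ} {C : Finset (Sym2 V)} (hC : IsCyc H C)
    (ht : ∑ e ∈ C, l e = g) {x y : V} (he : s(x, y) ∈ C) :
    ∃ p : H.Walk y x, p.IsPath ∧ s(x, y) ∉ p.edges ∧ l s(x, y) + (p.edges.map l).sum = g ∧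
      ∀ e, e ∈ C ↔ e = s(x, y) ∨ e ∈ p.edges := by
  obtain ⟨v, w, hw, hC⟩ := hC
  rw [IsCyc.sum_eq hw hC] at ht
  have he' := (hC _).1 he
  have hxy : H.Adj x y := w.edges_subset_edgeSet he'
  obtain ⟨p, q, hp, hq, hpq, hdisj, hsum⟩ := IsCyc.exists_paths hw
    (Walk.fst_mem_support_of_mem_edges _ he') (Walk.snd_mem_support_of_mem_edges _ he') hxy.ne
  have single : ∀ {r : H.Walk y x}, r.IsPath → s(x, y) ∈ r.edges → r.edges = [s(x, y)] := by
    intro r hr hmem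
    have hlen := hr.length_eq_one_of_mem_edges (Sym2.eq_swap ▸ hmem)
    rw [← Walk.length_edges, List.length_eq_one_iff] at hlen
    obtain ⟨e, hre⟩ := hlen
    rw [hre, List.mem_singleton] at hmem
    rw [hre, hmem]
  have hs := hsum l
  rcases (hpq _).1 he' with hmem | hmem
  · have h1 := single hp hmem
    refine ⟨q, hq, hdisj _ hmem, ?_, fun e => ?_⟩
    · rw [← ht, hs, h1]; simp
    · rw [hC, hpq, h1, List.mem_singleton]
  · have h1 := single hq hmem
    refine ⟨p, hp, fun hh => hdisj _ hh hmem, ?_, fun e => ?_⟩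
    · rw [← ht, hs, h1]; simp [add_comm]
    · rw [hC, hpq, h1, List.mem_singleton, or_comm]

end

section

variable {α : Type*} [DecidableEq α]

/-- A feasible point of a system of covering constraints can be moved, without increasing its
total weight, to a point determined by its tight constraints. -/
theorem exists_extreme (E : Finset α) (K : Finset (Finset α)) (b : Finset α → ℝ)
    (hE : ∀ e ∈ E, {e} ∈ K) (l : α → ℝ) (hl : ∀ C ∈ K, b C ≤ ∑ e ∈ C, l e) :
    ∃ l' : α → ℝ, (∀ C ∈ K, b C ≤ ∑ e ∈ C, l' e) ∧ ∑ e ∈ E, l' e ≤ ∑ e ∈ E, l e ∧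
      ∀ d : α → ℝ, (∀ e ∉ E, d e = 0) →
        (∀ C ∈ K, ∑ e ∈ C, l' e = b C → ∑ e ∈ C, d e = 0) → d = 0 := by
  induction hk : (K.filter fun C => ∑ e ∈ C, l e ≠ b C).card using Nat.strong_induction_on
    generalizing l with
  | _ k ih =>
  by_cases hex : ∀ d : α → ℝ, (∀ e ∉ E, d e = 0) →
      (∀ C ∈ K, ∑ e ∈ C, l e = b C → ∑ e ∈ C, d e = 0) → d = 0
  · exact ⟨l, hl, le_rfl, hex⟩
  push Not at hex
  obtain ⟨d, hdE, hdK, hd0, hd⟩ : ∃ d : α → ℝ, (∀ e ∉ E, d e = 0) ∧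
      (∀ C ∈ K, ∑ e ∈ C, l e = b C → ∑ e ∈ C, d e = 0) ∧ d ≠ 0 ∧ ∑ e ∈ E, d e ≤ 0 := by
    obtain ⟨d, h1, h2, h3⟩ := hex
    rcases le_total (∑ e ∈ E, d e) 0 with h | h
    · exact ⟨d, h1, h2, h3, h⟩
    · refine ⟨-d, fun e he => by simp [h1 e he], fun C hC ht => by simp [h2 C hC ht],
        by simpa using h3, by simpa using h⟩
  have hneg : ∃ e ∈ E, d e < 0 := by
    by_contra hcon
    push Not at hcon
    have h0 := (Finset.sum_eq_zero_iff_of_nonneg hcon).1 (le_antisymm hd (Finset.sum_nonneg hcon))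
    refine hd0 (funext fun e => ?_)
    by_cases he : e ∈ E
    exacts [h0 e he, hdE e he]
  obtain ⟨e₀, he₀, hlt₀⟩ := hneg
  obtain ⟨C₀, hC₀, hmin⟩ := Finset.exists_min_image (K.filter fun C => ∑ e ∈ C, d e < 0)
    (fun C => (∑ e ∈ C, l e - b C) / -∑ e ∈ C, d e)
    ⟨{e₀}, by simp [hE e₀ he₀, hlt₀]⟩
  rw [Finset.mem_filter] at hC₀
  set s := (∑ e ∈ C₀, l e - b C₀) / -∑ e ∈ C₀, d e with hs
  have hs0 : 0 ≤ s := div_nonneg (sub_nonneg.2 (hl _ hC₀.1)) (by linarith [hC₀.2])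
  have hsum : ∀ C : Finset α, ∑ e ∈ C, (l e + s * d e) = ∑ e ∈ C, l e + s * ∑ e ∈ C, d e :=
    fun C => by rw [Finset.sum_add_distrib, Finset.mul_sum]
  have hcard : (K.filter fun C => ∑ e ∈ C, (l e + s * d e) ≠ b C).card < k := by
    rw [← hk]
    refine Finset.card_lt_card ⟨fun C hC => ?_, fun hsub => ?_⟩
    · rw [Finset.mem_filter] at hC ⊢
      refine ⟨hC.1, fun ht => hC.2 ?_⟩
      rw [hsum, hdK C hC.1 ht, ht]
      simp
    · have hmem : C₀ ∈ K.filter fun C => ∑ e ∈ C, l e ≠ b C :=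
        Finset.mem_filter.2 ⟨hC₀.1, fun ht => hC₀.2.ne (hdK _ hC₀.1 ht)⟩
      refine (Finset.mem_filter.1 (hsub hmem)).2 ?_
      rw [hsum, hs]
      have := hC₀.2.ne
      field_simp
      ring
  have hfeas : ∀ C ∈ K, b C ≤ ∑ e ∈ C, (l e + s * d e) := by
    intro C hC
    rw [hsum]
    rcases lt_or_ge (∑ e ∈ C, d e) 0 with h | h
    · have := hmin C (Finset.mem_filter.2 ⟨hC, h⟩)
      rw [le_div_iff₀ (by linarith)] at this
      linarith
    · have := hl C hC
      nlinarith
  obtain ⟨l', h1, h2, h3⟩ := ih _ hcard (fun e => l e + s * d e) hfeas rfl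
  refine ⟨l', h1, h2.trans ?_, h3⟩
  rw [hsum]
  nlinarith

/-- If a vector supported on `P` is determined by its sums over the members of `T`, each of which
meets `P` at least three times, then some point of `P` lies in three members of `T`. -/
theorem exists_three_le {P : Finset α} (hP : P.Nonempty) {T : Finset (Finset α)}
    (h3 : ∀ C ∈ T, 3 ≤ (P.filter (· ∈ C)).card)
    (hd : ∀ d : α → ℝ, (∀ e ∉ P, d e = 0) → (∀ C ∈ T, ∑ e ∈ C, d e = 0) → d = 0) :
    ∃ e ∈ P, 3 ≤ (T.filter (e ∈ ·)).card := by
  by_contra hcon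
  push Not at hcon
  have hcount := Finset.sum_card_bipartiteAbove_eq_sum_card_bipartiteBelow
    (s := P) (t := T) (fun e C => e ∈ C)
  simp only [Finset.bipartiteAbove, Finset.bipartiteBelow] at hcount
  have h1 : ∑ e ∈ P, (T.filter (e ∈ ·)).card ≤ ∑ e ∈ P, 2 :=
    Finset.sum_le_sum fun e he => Nat.le_of_lt_succ (hcon e he)
  have h2 : ∑ C ∈ T, 3 ≤ ∑ C ∈ T, (P.filter (· ∈ C)).card := Finset.sum_le_sum h3
  rw [hcount] at h1
  simp only [Finset.sum_const, smul_eq_mul] at h1 h2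
  have hpos := hP.card_pos
  have hlt : T.card < P.card := by omega
  let F : (P → ℝ) →ₗ[ℝ] (T → ℝ) := LinearMap.pi fun C => ∑ e ∈ C.1,
    if h : e ∈ P then LinearMap.proj ⟨e, h⟩ else 0
  have hker : LinearMap.ker F ≠ ⊥ := LinearMap.ker_ne_bot_of_finrank_lt (by simpa using hlt)
  obtain ⟨v, hv, hv0⟩ := Submodule.exists_mem_ne_zero_of_ne_bot hker
  refine hv0 (funext fun e => ?_)
  have := hd (fun e => if h : e ∈ P then v ⟨e, h⟩ else 0) (fun e he => by simp [he]) ?_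
  · simpa using congrFun this e.1
  · intro C hC
    have hFC := congrFun (LinearMap.mem_ker.1 hv) ⟨C, hC⟩
    simp only [F, LinearMap.pi_apply, LinearMap.sum_apply, Pi.zero_apply] at hFC
    refine Eq.trans ?_ hFC
    refine Finset.sum_congr rfl fun e _ => ?_
    split_ifs <;> simp

end

section

variable {V : Type*}

/-- The spanning subgraph consisting of the edges inside `S`. -/
def restr (H : SimpleGraph V) (S : Set V) : SimpleGraph V where
  Adj u v := H.Adj u v ∧ u ∈ S ∧ v ∈ S
  symm := ⟨fun _ _ h => ⟨h.1.symm, h.2.2, h.2.1⟩⟩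
  loopless := ⟨fun _ h => H.loopless.irrefl _ h.1⟩

theorem restr_adj {H : SimpleGraph V} {S : Set V} {u v : V} :
    (restr H S).Adj u v ↔ H.Adj u v ∧ u ∈ S ∧ v ∈ S := Iff.rfl

theorem restr_le (H : SimpleGraph V) (S : Set V) : restr H S ≤ H := fun _ _ h => h.1

theorem exists_other_edge {H : SimpleGraph V} {u v : V} {w : H.Walk u u} (hw : w.IsCycle)
    (hv : v ∈ w.support) (z : V) : ∃ z', z' ≠ z ∧ s(v, z') ∈ w.edges := by
  have h2 := hw.ncard_neighborSet_toSubgraph_eq_two hv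
  obtain ⟨z', hz', hne⟩ := Set.exists_ne_of_one_lt_ncard
    (s := w.toSubgraph.neighborSet v) (by omega) z
  exact ⟨z', hne, Walk.adj_toSubgraph_iff_mem_edges.1 hz'⟩

/-- A graph violating the weighted Euler inequality while all its smaller subgraphs satisfy it. -/
structure Crit [Fintype V] (H : SimpleGraph V) (l : Sym2 V → ℝ) (g : ℝ) : Prop where
  pos : 0 < g
  nonneg : ∀ e ∈ edgeF H, 0 ≤ l e
  cyc : ∀ C, IsCyc H C → g ≤ ∑ e ∈ C, l e
  ih : ∀ H' ≤ H, (edgeF H').card < (edgeF H).card → 0 < (edgeF H').card →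
    (suppF H').card ≤ (edgeF H').card →
    ((edgeF H').card - (suppF H').card + 2 : ℝ) * g ≤ 2 * ∑ e ∈ edgeF H', l e
  card_pos : 0 < (edgeF H).card
  card_le : (suppF H).card ≤ (edgeF H).card
  fail : 2 * ∑ e ∈ edgeF H, l e < ((edgeF H).card - (suppF H).card + 2 : ℝ) * g

namespace Crit

variable [Fintype V] {H : SimpleGraph V} {l : Sym2 V → ℝ} {g : ℝ}

theorem cyc' (h : Crit H l g) {v : V} {w : H.Walk v v} (hw : w.IsCycle) :
    g ≤ (w.edges.map l).sum := by
  classical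
  rw [← IsCyc.sum_eq hw (C := w.edges.toFinset) (by simp)]
  exact h.cyc _ hw.isCyc

theorem card_lt (h : Crit H l g) : (suppF H).card < (edgeF H).card := by
  refine lt_of_le_of_ne h.card_le fun heq => ?_
  obtain ⟨C, hC⟩ := exists_isCyc h.card_pos h.card_le
  have h1 := h.cyc C hC
  have h2 := Finset.sum_le_sum_of_subset_of_nonneg hC.subset fun e he _ => h.nonneg e he
  have h3 := h.fail
  rw [heq] at h3
  linarith

theorem delete (h : Crit H l g) {e : Sym2 V} (he : e ∈ edgeF H) :
    ((edgeF H).card - 1 - (suppF (H.deleteEdges {e})).card + 2 : ℝ) * g ≤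
      2 * (∑ e ∈ edgeF H, l e - l e) := by
  classical
  have hE : edgeF (H.deleteEdges {e}) = (edgeF H).erase e := by
    ext e'; simp [and_comm]
  have hn : (suppF (H.deleteEdges {e})).card ≤ (suppF H).card := by
    refine Finset.card_le_card fun v hv => ?_
    obtain ⟨w, hw⟩ := mem_suppF.1 hv
    exact mem_suppF.2 ⟨w, H.deleteEdges_le _ hw⟩
  have hlt := h.card_lt
  have hs : 0 < (suppF H).card := by
    induction e using Sym2.ind with | _ a b =>
    exact Finset.card_pos.2 ⟨a, mem_suppF.2 ⟨b, by simpa using he⟩⟩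
  have hcard := Finset.card_erase_of_mem he
  have := h.ih (H.deleteEdges {e}) (H.deleteEdges_le _) (by rw [hE]; omega) (by rw [hE]; omega)
    (by rw [hE]; omega)
  have hsum := Finset.sum_erase_eq_sub (f := l) he
  rw [hE, hcard, hsum, Nat.cast_sub (by omega)] at this
  simpa using this

theorem exists_other (h : Crit H l g) {v w : V} (hvw : H.Adj v w) :
    ∃ w', w' ≠ w ∧ H.Adj v w' := by
  classical
  by_contra hcon
  push Not at hcon
  have he : s(v, w) ∈ edgeF H := by simpa using hvw
  have h1 := h.delete he
  have hv : v ∈ suppF H := mem_suppF.2 ⟨w, hvw⟩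
  have hn : (suppF (H.deleteEdges {s(v, w)})).card ≤ ((suppF H).erase v).card := by
    refine Finset.card_le_card fun a ha => ?_
    obtain ⟨b, hb⟩ := mem_suppF.1 ha
    rw [deleteEdges_adj] at hb
    refine Finset.mem_erase.2 ⟨?_, mem_suppF.2 ⟨b, hb.1⟩⟩
    rintro rfl
    by_cases hbw : b = w
    · exact hb.2 (by simp [hbw])
    · exact hcon b hbw hb.1
  rw [Finset.card_erase_of_mem hv] at hn
  have hpos := Finset.card_pos.2 ⟨v, hv⟩
  have hn' : ((suppF (H.deleteEdges {s(v, w)})).card : ℝ) + 1 ≤ (suppF H).card := by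
    exact_mod_cast (by omega : (suppF (H.deleteEdges {s(v, w)})).card + 1 ≤ (suppF H).card)
  have := h.fail
  have := h.nonneg _ he
  nlinarith [h.pos]

theorem lt_half (h : Crit H l g) {e : Sym2 V} (he : e ∈ edgeF H) : 2 * l e < g := by
  classical
  by_contra hcon
  push Not at hcon
  have h1 := h.delete he
  have hn : (suppF (H.deleteEdges {e})).card ≤ (suppF H).card := by
    refine Finset.card_le_card fun v hv => ?_
    obtain ⟨w, hw⟩ := mem_suppF.1 hv
    exact mem_suppF.2 ⟨w, H.deleteEdges_le _ hw⟩
  have hn' : ((suppF (H.deleteEdges {e})).card : ℝ) ≤ (suppF H).card := by exact_mod_cast hn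
  have := h.fail
  nlinarith [h.pos]

theorem chordless (h : Crit H l g) {v₀ : V} {w : H.Walk v₀ v₀} (hw : w.IsCycle)
    (ht : (w.edges.map l).sum = g) {u v : V} (hu : u ∈ w.support) (hv : v ∈ w.support)
    (huv : H.Adj u v) : s(u, v) ∈ w.edges := by
  by_contra hne
  obtain ⟨p, q, hp, hq, hpq, -, hsum⟩ := IsCyc.exists_paths hw hu hv huv.ne
  have h1 := h.cyc' ((Walk.cons_isCycle_iff p huv).2 ⟨hp, fun hh => hne ((hpq _).2 (Or.inl hh))⟩)
  have h2 := h.cyc' ((Walk.cons_isCycle_iff q huv).2 ⟨hq, fun hh => hne ((hpq _).2 (Or.inr hh))⟩)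
  have h3 := h.lt_half (e := s(u, v)) (by simpa using huv)
  have h4 := hsum l
  simp only [Walk.edges_cons, List.map_cons, List.sum_cons] at h1 h2
  linarith

theorem cut (h : Crit H l g) {v₀ : V} {w : H.Walk v₀ v₀} (hw : w.IsCycle)
    (ht : (w.edges.map l).sum = g) {D : Set V} (hD : ∀ u ∈ D, u ∉ w.support)
    (hne : ∃ u ∈ D, ∃ v, H.Adj u v)
    (hco : ∃ z, z ∉ D ∧ z ∉ w.support ∧ ∃ v, H.Adj z v) :
    ∃ u ∈ D, ∃ z, z ∉ D ∧ z ∉ w.support ∧ H.Adj u z := by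
  classical
  by_contra hcon
  push Not at hcon
  let P : Set V := {v | v ∈ D ∨ v ∈ w.support}
  have hadj : ∀ {a b}, s(a, b) ∈ w.edges → H.Adj a b := fun hab =>
    w.edges_subset_edgeSet hab
  have hsnd : ∀ {a b}, s(a, b) ∈ w.edges → b ∈ w.support := fun hab =>
    Walk.snd_mem_support_of_mem_edges _ hab
  have hfst : ∀ {a b}, s(a, b) ∈ w.edges → a ∈ w.support := fun hab =>
    Walk.fst_mem_support_of_mem_edges _ hab
  set C := w.edges.toFinset with hC
  set S := w.support.toFinset with hS
  have hCS : C.card = S.card := by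
    have h1 : C.card = w.length := by
      rw [hC, List.toFinset_card_of_nodup hw.isTrail.edges_nodup, Walk.length_edges]
    have h2 : S = w.support.tail.toFinset := by
      ext a
      rw [hS, List.mem_toFinset, List.mem_toFinset]
      refine ⟨fun ha => ?_, List.mem_of_mem_tail⟩
      rcases (Walk.mem_support_iff _).1 ha with rfl | ha
      · exact Walk.end_mem_tail_support (hw.not_nil)
      · exact ha
    rw [h1, h2, List.toFinset_card_of_nodup hw.support_nodup]
    simp
  have hinter : edgeF (restr H P) ∩ edgeF (restr H Dᶜ) = C := by
    ext e
    induction e using Sym2.ind with | _ a b =>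
    simp only [Finset.mem_inter, mem_edgeF, mem_edgeSet, restr_adj, hC, List.mem_toFinset]
    constructor
    · rintro ⟨⟨hab, ha, hb⟩, -, ha', hb'⟩
      exact h.chordless hw ht (ha.resolve_left ha') (hb.resolve_left hb') hab
    · intro hab
      exact ⟨⟨hadj hab, Or.inr (hfst hab), Or.inr (hsnd hab)⟩, hadj hab,
        fun hh => hD _ hh (hfst hab), fun hh => hD _ hh (hsnd hab)⟩
  have hunion : edgeF (restr H P) ∪ edgeF (restr H Dᶜ) = edgeF H := by
    ext e
    induction e using Sym2.ind with | _ a b =>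
    simp only [Finset.mem_union, mem_edgeF, mem_edgeSet, restr_adj]
    constructor
    · rintro (hh | hh) <;> exact hh.1
    · intro hab
      have key : ∀ {a b}, H.Adj a b → a ∈ D → b ∈ P := by
        intro a b hab ha
        by_contra hb
        exact hcon a ha b (fun hh => hb (Or.inl hh)) (fun hh => hb (Or.inr hh)) hab
      by_cases ha : a ∈ D
      · exact Or.inl ⟨hab, Or.inl ha, key hab ha⟩
      · by_cases hb : b ∈ D
        · exact Or.inl ⟨hab, key hab.symm hb, Or.inl hb⟩
        · exact Or.inr ⟨hab, ha, hb⟩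
  have hsum : ∑ e ∈ edgeF (restr H P), l e + ∑ e ∈ edgeF (restr H Dᶜ), l e =
      ∑ e ∈ edgeF H, l e + g := by
    rw [← Finset.sum_union_inter, hinter, hunion, hC, sum_toFinset_edges hw.isTrail, ht]
  have hcard : (edgeF (restr H P)).card + (edgeF (restr H Dᶜ)).card = (edgeF H).card + S.card := by
    rw [← Finset.card_union_add_card_inter, hinter, hunion, hCS]
  have hsupp : (suppF (restr H P)).card + (suppF (restr H Dᶜ)).card ≤
      (suppF H).card + S.card := by
    rw [← Finset.card_union_add_card_inter]
    refine add_le_add (Finset.card_le_card fun a ha => ?_) (Finset.card_le_card fun a ha => ?_)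
    · rcases Finset.mem_union.1 ha with ha | ha <;> obtain ⟨b, hb⟩ := mem_suppF.1 ha <;>
        exact mem_suppF.2 ⟨b, hb.1⟩
    · obtain ⟨h1, h2⟩ := Finset.mem_inter.1 ha
      obtain ⟨b, hb⟩ := mem_suppF.1 h1
      obtain ⟨c, hc⟩ := mem_suppF.1 h2
      exact List.mem_toFinset.2 (hb.2.1.resolve_left hc.2.1)
  have hle1 : (suppF (restr H P)).card ≤ (edgeF (restr H P)).card := by
    refine card_suppF_le fun a b hab => ?_
    rcases hab.2.1 with ha | ha
    · obtain ⟨c, hc, hac⟩ := h.exists_other hab.1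
      refine ⟨c, hc, hac, Or.inl ha, ?_⟩
      by_contra hcP
      exact hcon a ha c (fun hh => hcP (Or.inl hh)) (fun hh => hcP (Or.inr hh)) hac
    · obtain ⟨c, hc, hac⟩ := exists_other_edge hw ha b
      exact ⟨c, hc, hadj hac, Or.inr ha, Or.inr (hsnd hac)⟩
  have hle2 : (suppF (restr H Dᶜ)).card ≤ (edgeF (restr H Dᶜ)).card := by
    refine card_suppF_le fun a b hab => ?_
    by_cases ha : a ∈ w.support
    · obtain ⟨c, hc, hac⟩ := exists_other_edge hw ha b
      exact ⟨c, hc, hadj hac, hab.2.1, fun hh => hD _ hh (hsnd hac)⟩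
    · obtain ⟨c, hc, hac⟩ := h.exists_other hab.1
      exact ⟨c, hc, hac, hab.2.1, fun hh => hcon c hh a hab.2.1 ha hac.symm⟩
  have hCpos : 0 < C.card := by
    obtain ⟨z, -, hz⟩ := exists_other_edge hw w.start_mem_support v₀
    exact Finset.card_pos.2 ⟨_, List.mem_toFinset.2 hz⟩
  have hC1 : C.card ≤ (edgeF (restr H P)).card := by
    rw [← hinter]; exact Finset.card_le_card Finset.inter_subset_left
  have hC2 : C.card ≤ (edgeF (restr H Dᶜ)).card := by
    rw [← hinter]; exact Finset.card_le_card Finset.inter_subset_right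
  have hlt1 : (edgeF (restr H P)).card < (edgeF H).card := by
    obtain ⟨z, hzD, hzS, v, hzv⟩ := hco
    refine Finset.card_lt_card ⟨hunion ▸ Finset.subset_union_left, fun hsub => ?_⟩
    have := hsub (show s(z, v) ∈ edgeF H by simpa using hzv)
    simp only [mem_edgeF, mem_edgeSet, restr_adj] at this
    exact this.2.1.elim hzD hzS
  have hlt2 : (edgeF (restr H Dᶜ)).card < (edgeF H).card := by
    obtain ⟨z, hzD, v, hzv⟩ := hne
    refine Finset.card_lt_card ⟨hunion ▸ Finset.subset_union_right, fun hsub => ?_⟩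
    have := hsub (show s(z, v) ∈ edgeF H by simpa using hzv)
    simp only [mem_edgeF, mem_edgeSet, restr_adj] at this
    exact this.2.1 hzD
  have i1 := h.ih _ (restr_le H P) hlt1 (by omega) hle1
  have i2 := h.ih _ (restr_le H Dᶜ) hlt2 (by omega) hle2
  have hf := h.fail
  have hcard' : ((edgeF (restr H P)).card + (edgeF (restr H Dᶜ)).card : ℝ) =
    (edgeF H).card + S.card := by exact_mod_cast hcard
  have hsupp' : ((suppF (restr H P)).card + (suppF (restr H Dᶜ)).card : ℝ) ≤
    (suppF H).card + S.card := by exact_mod_cast hsupp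
  nlinarith [h.pos, mul_le_mul_of_nonneg_right hsupp' h.pos.le]

theorem eq_of_short (h : Crit H l g) {u v : V} {p q : H.Walk u v} (hp : p.IsPath) (hq : q.IsPath)
    (hs : (p.edges.map l).sum + (q.edges.map l).sum < g) : p = q := by
  by_contra hne
  obtain ⟨u', v', p', q', hp', hq', hcyc⟩ := hp.exists_isCycle_of_ne hq hne
  have h1 := h.cyc' hcyc
  have mono : ∀ {a b a' b' : V} {r : H.Walk a b} {r' : H.Walk a' b'}, r'.IsSubwalk r →
      (r'.edges.map l).sum ≤ (r.edges.map l).sum := by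
    intro a b a' b' r r' hr
    refine List.Sublist.sum_le_sum (hr.edges_isInfix.sublist.map l) fun x hx => ?_
    obtain ⟨e, he, rfl⟩ := List.mem_map.1 hx
    exact h.nonneg e (mem_edgeF.2 (r.edges_subset_edgeSet he))
  have h2 := mono hp'
  have h3 := mono hq'
  simp only [Walk.edges_append, Walk.edges_reverse, List.map_append, List.sum_append,
    List.map_reverse, List.sum_reverse] at h1
  linarith

theorem takeUntil_eq_or [DecidableEq V] (h : Crit H l g) {u v z : V} {p q : H.Walk u v}
    (hp : p.IsPath) (hq : q.IsPath) (hps : (p.edges.map l).sum < g)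
    (hqs : (q.edges.map l).sum < g) (hzp : z ∈ p.support) (hzq : z ∈ q.support) :
    p.takeUntil z hzp = q.takeUntil z hzq ∨ p.dropUntil z hzp = q.dropUntil z hzq := by
  have split : ∀ {r : H.Walk u v} (hz : z ∈ r.support), (r.edges.map l).sum =
      ((r.takeUntil z hz).edges.map l).sum + ((r.dropUntil z hz).edges.map l).sum := by
    intro r hz
    rw [← List.sum_append, ← List.map_append, ← Walk.edges_append, r.take_spec hz]
  have h1 := split hzp
  have h2 := split hzq
  rcases lt_or_ge (((p.takeUntil z hzp).edges.map l).sum + ((q.takeUntil z hzq).edges.map l).sum) g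
    with h3 | h3
  · exact Or.inl (h.eq_of_short (hp.takeUntil hzp) (hq.takeUntil hzq) h3)
  · exact Or.inr (h.eq_of_short (hp.dropUntil hzp) (hq.dropUntil hzq) (by linarith))

end Crit

end

section

variable {V : Type*} [Fintype V] {H : SimpleGraph V} {l : Sym2 V → ℝ} {g : ℝ}

namespace Crit

theorem arcs (h : Crit H l g) {ι : Type*} {x y : V} (hxy : H.Adj x y) (hl : 0 < l s(x, y))
    (p : ι → H.Walk y x) (hp : ∀ i, (p i).IsPath) (hne : ∀ i, s(x, y) ∉ (p i).edges)
    (hs : ∀ i, l s(x, y) + ((p i).edges.map l).sum = g) (hinj : ∀ i j, i ≠ j → p i ≠ p j) :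
    Arcs H x y (fun i => (p i).length) (fun i m => (p i).getVert m) := by
  classical
  have hcyc : ∀ i, (Walk.cons hxy (p i)).IsCycle := fun i =>
    (Walk.cons_isCycle_iff _ _).2 ⟨hp i, hne i⟩
  have htight : ∀ i, ((Walk.cons hxy (p i)).edges.map l).sum = g := fun i => by simpa using hs i
  have hsupp : ∀ i z, z ∈ (Walk.cons hxy (p i)).support ↔ ∃ m ≤ (p i).length, (p i).getVert m = z := by
    intro i z
    rw [Walk.support_cons, List.mem_cons, Walk.mem_support_iff_exists_getVert]
    constructor
    · rintro (rfl | ⟨m, hm, hm'⟩)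
      · exact ⟨_, le_rfl, (p i).getVert_length⟩
      · exact ⟨m, hm', hm⟩
    · rintro ⟨m, hm, hm'⟩
      exact Or.inr ⟨m, hm', hm⟩
  have hinj' : ∀ i a b, a ≤ (p i).length → b ≤ (p i).length →
      (p i).getVert a = (p i).getVert b → a = b := fun i a b ha hb hab =>
    (hp i).getVert_injOn ha hb hab
  refine ⟨hxy, fun i => ?_, fun i m hm => (p i).adj_getVert_succ hm, hinj', fun i => by simp,
    fun i => by simp, fun i a b hab hb hadj => ?_, fun i j a b hij ha hb hab => ?_,
    fun i j hij hn => ?_, fun i D hD hne hco => ?_⟩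
  · have := (hcyc i).three_le_length
    rw [Walk.length_cons] at this
    omega
  · have hmem := h.chordless (hcyc i) (htight i) ((hsupp i _).2 ⟨a, by omega, rfl⟩)
      ((hsupp i _).2 ⟨b, hb, rfl⟩) hadj
    rw [Walk.edges_cons, List.mem_cons] at hmem
    rcases hmem with he | he
    · rcases Sym2.eq_iff.1 he with ⟨h1, h2⟩ | ⟨h1, h2⟩
      · have := hinj' i a (p i).length (by omega) le_rfl (by rw [h1, Walk.getVert_length])
        omega
      · have h3 := hinj' i a 0 (by omega) (Nat.zero_le _) (by rw [h1, Walk.getVert_zero])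
        have h4 := hinj' i b (p i).length hb le_rfl (by rw [h2, Walk.getVert_length])
        exact Or.inr ⟨h3, h4⟩
    · obtain ⟨m, hm, he⟩ := (Walk.mk_mem_edges_iff_exists _).1 he
      rcases Sym2.eq_iff.1 he with ⟨h1, h2⟩ | ⟨h1, h2⟩
      · have h3 := hinj' i _ _ (by omega) (by omega) h1
        have h4 := hinj' i _ _ (by omega) (by omega) h2
        omega
      · have h3 := hinj' i _ _ (by omega) (by omega) h1
        have h4 := hinj' i _ _ (by omega) (by omega) h2
        omega
  · have hzp : (p i).getVert a ∈ (p i).support := Walk.getVert_mem_support _ _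
    have hzq : (p i).getVert a ∈ (p j).support := hab ▸ Walk.getVert_mem_support _ _
    have la : ((p i).takeUntil _ hzp).length = a :=
      hinj' i _ _ (Walk.length_takeUntil_le_length _ _) ha (Walk.getVert_length_takeUntil _)
    have lb : ((p j).takeUntil _ hzq).length = b :=
      hinj' j _ _ (Walk.length_takeUntil_le_length _ _) hb ((Walk.getVert_length_takeUntil _).trans hab)
    rcases h.takeUntil_eq_or (hp i) (hp j) (by linarith [hs i]) (by linarith [hs j]) hzp hzq
      with heq | heq
    · have hab' : a = b := by rw [← la, ← lb, heq]
      refine Or.inl ⟨hab', fun k hk => ?_⟩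
      rw [← Walk.getVert_takeUntil hzp (by omega), ← Walk.getVert_takeUntil hzq (by omega), heq]
    · have drop : ∀ {r : H.Walk y x} {z : V} (hz : z ∈ r.support) (k : ℕ),
          r.getVert ((r.takeUntil z hz).length + k) = (r.dropUntil z hz).getVert k := by
        intro r z hz k
        conv_lhs => arg 1; rw [← r.take_spec hz]
        rw [Walk.getVert_append, if_neg (by omega), Nat.add_sub_cancel_left]
      have len : ∀ {r : H.Walk y x} {z : V} (hz : z ∈ r.support),
          (r.takeUntil z hz).length + (r.dropUntil z hz).length = r.length := by
        intro r z hz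
        rw [← Walk.length_append, r.take_spec]
      have l1 := len hzp
      have l2 := len hzq
      rw [la] at l1
      rw [lb, ← heq] at l2
      have hsub : (p i).length - a = (p j).length - b := by omega
      refine Or.inr ⟨hsub, fun k hk => ?_⟩
      have e1 := drop hzp ((p i).length - a - k)
      have e2 := drop hzq ((p i).length - a - k)
      rw [la, show a + ((p i).length - a - k) = (p i).length - k by omega] at e1
      rw [lb, show b + ((p i).length - a - k) = (p j).length - k by omega, ← heq] at e2
      exact e1.trans e2.symm
  · by_contra hcon
    push Not at hcon
    exact hinj i j hij (Walk.ext_getVert_le_length hn hcon)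
  · have key : ∀ z, (∀ m ≤ (p i).length, (p i).getVert m ≠ z) ↔
        z ∉ (Walk.cons hxy (p i)).support := by
      intro z
      rw [hsupp]
      push Not
      rfl
    simp only [key] at hD hco ⊢
    exact h.cut (hcyc i) (htight i) hD hne hco

theorem isMinor_of_extreme (h : Crit H l g)
    (hex : ∀ d : Sym2 V → ℝ, (∀ e ∉ edgeF H, d e = 0) →
      (∀ C, IsCyc H C → ∑ e ∈ C, l e = g → ∑ e ∈ C, d e = 0) →
      (∀ e ∈ edgeF H, l e = 0 → d e = 0) → d = 0) :
    IsMinor (completeGraph (Fin 5)) H ∨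
      IsMinor (completeBipartiteGraph (Fin 3) (Fin 3)) H := by
  classical
  let P := (edgeF H).filter (0 < l ·)
  let T := (Finset.univ : Finset (Finset (Sym2 V))).filter fun C => IsCyc H C ∧ ∑ e ∈ C, l e = g
  have hT : ∀ C, C ∈ T ↔ IsCyc H C ∧ ∑ e ∈ C, l e = g := fun C => by simp [T]
  have hsum : ∀ C, IsCyc H C → ∑ e ∈ C, l e = ∑ e ∈ P.filter (· ∈ C), l e := by
    intro C hC
    symm
    refine Finset.sum_subset (fun e he => (Finset.mem_filter.1 he).2) fun e he hne => ?_
    have h1 := h.nonneg e (hC.subset he)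
    by_contra h2
    exact hne (Finset.mem_filter.2 ⟨Finset.mem_filter.2
      ⟨hC.subset he, lt_of_le_of_ne h1 (Ne.symm h2)⟩, he⟩)
  have hP : P.Nonempty := by
    obtain ⟨C, hC⟩ := exists_isCyc h.card_pos h.card_le
    by_contra hP
    rw [Finset.not_nonempty_iff_eq_empty] at hP
    have h1 := h.cyc C hC
    rw [hsum C hC, hP] at h1
    simp only [Finset.filter_empty, Finset.sum_empty] at h1
    exact absurd h.pos (not_lt.2 h1)
  obtain ⟨e, heP, he3⟩ := exists_three_le hP (T := T) (fun C hC => by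
    obtain ⟨hC, ht⟩ := (hT C).1 hC
    by_contra hlt
    push Not at hlt
    have h1 : ∑ e ∈ P.filter (· ∈ C), l e ≤ ∑ e ∈ P.filter (· ∈ C), g / 2 :=
      Finset.sum_le_sum fun e he => by
        linarith [h.lt_half (Finset.mem_filter.1 (Finset.mem_filter.1 he).1).1]
    have h2 : (P.filter (· ∈ C)).Nonempty := by
      rw [Finset.nonempty_iff_ne_empty]
      intro hempty
      rw [hsum C hC, hempty, Finset.sum_empty] at ht
      exact h.pos.ne ht
    have h3 : ∑ e ∈ P.filter (· ∈ C), l e < ∑ e ∈ P.filter (· ∈ C), g / 2 :=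
      Finset.sum_lt_sum_of_nonempty h2 fun e he => by
        linarith [h.lt_half (Finset.mem_filter.1 (Finset.mem_filter.1 he).1).1]
    rw [← hsum C hC, ht, Finset.sum_const, nsmul_eq_mul] at h3
    have h4 : ((P.filter (· ∈ C)).card : ℝ) ≤ 2 := by exact_mod_cast Nat.le_of_lt_succ hlt
    nlinarith [h.pos]) (fun d hd hdT => hex d (fun e he => hd e fun hh =>
      he (Finset.mem_filter.1 hh).1) (fun C hC ht => hdT C ((hT C).2 ⟨hC, ht⟩))
      fun e _ h0 => hd e fun hh => (Finset.mem_filter.1 hh).2.ne' h0)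
  obtain ⟨F, hFsub, hF3⟩ := Finset.exists_subset_card_eq he3
  have eqv := (Finset.equivFinOfCardEq hF3).symm
  have hmem : ∀ i, (eqv i).1 ∈ T ∧ e ∈ (eqv i).1 := fun i =>
    Finset.mem_filter.1 (hFsub (eqv i).2)
  induction e using Sym2.ind with | _ x y =>
  obtain ⟨heE, hpos⟩ := Finset.mem_filter.1 heP
  have hxy : H.Adj x y := by simpa using heE
  have hpath := fun i => ((hT _).1 (hmem i).1).1.exists_path ((hT _).1 (hmem i).1).2 (hmem i).2
  choose p hp hne hs hC using hpath
  refine (h.arcs hxy hpos p hp hne hs fun i j hij heq => hij (eqv.injective ?_)).isMinor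
  apply Subtype.ext
  ext e
  rw [hC, hC, heq]

end Crit

/-- The weighted Euler inequality for graphs without `K₅` and `K₃,₃` minors. -/
theorem weighted_euler (hK5 : ¬ IsMinor (completeGraph (Fin 5)) H)
    (hK33 : ¬ IsMinor (completeBipartiteGraph (Fin 3) (Fin 3)) H) (hg : 0 < g)
    (hl : ∀ e ∈ edgeF H, 0 ≤ l e) (hcyc : ∀ C, IsCyc H C → g ≤ ∑ e ∈ C, l e)
    (hpos : 0 < (edgeF H).card) (hle : (suppF H).card ≤ (edgeF H).card) :
    ((edgeF H).card - (suppF H).card + 2 : ℝ) * g ≤ 2 * ∑ e ∈ edgeF H, l e := by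
  classical
  induction hk : (edgeF H).card using Nat.strong_induction_on generalizing H l with
  | _ k ih =>
  rw [← hk]
  by_contra hcon
  push Not at hcon
  let K := (Finset.univ : Finset (Finset (Sym2 V))).filter fun C =>
    IsCyc H C ∨ ∃ e ∈ edgeF H, C = {e}
  have hnot : ∀ e, ¬ IsCyc H {e} := by
    rintro e ⟨v, w, hw, hC⟩
    have h1 := hw.three_le_length
    have h2 := List.toFinset_card_of_nodup hw.isTrail.edges_nodup
    have h3 : w.edges.toFinset = {e} := by ext; simp [← hC]
    rw [h3, Walk.length_edges, Finset.card_singleton] at h2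
    omega
  obtain ⟨l', h1, h2, h3⟩ := exists_extreme (edgeF H) K (fun C => if IsCyc H C then g else 0)
    (fun e he => by simpa [K] using Or.inr (by simpa using he)) l (fun C hC => by
      rcases (Finset.mem_filter.1 hC).2 with hC | ⟨e, he, rfl⟩
      · simpa [hC] using hcyc C hC
      · simpa [hnot] using hl e he)
  have hcyc' : ∀ C, IsCyc H C → g ≤ ∑ e ∈ C, l' e := fun C hC => by
    simpa [hC] using h1 C (by simp [K, hC])
  have hl' : ∀ e ∈ edgeF H, 0 ≤ l' e := fun e he => by
    simpa [hnot] using h1 {e} (Finset.mem_filter.2 ⟨Finset.mem_univ _, Or.inr ⟨e, he, rfl⟩⟩)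
  have hcrit : Crit H l' g := by
    refine ⟨hg, hl', hcyc', fun H' hH' hlt hpos hle => ?_, hpos, hle, by linarith⟩
    refine ih _ (hk ▸ hlt) (fun hh => hK5 (hh.mono hH')) (fun hh => hK33 (hh.mono hH'))
      (fun e he => hl' e ?_) (fun C hC => hcyc' C (hC.mono hH')) hpos hle rfl
    simp only [mem_edgeF] at he ⊢
    exact edgeSet_mono hH' he
  refine (hcrit.isMinor_of_extreme fun d hd hdC hd0 => h3 d hd fun C hC ht => ?_).elim hK5 hK33
  rcases (Finset.mem_filter.1 hC).2 with hC | ⟨e, he, rfl⟩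
  · exact hdC C hC (by simpa [hC] using ht)
  · simpa using hd0 e he (by simpa [hnot] using ht)

end

section PartialColorings

variable {V : Type*} {G : SimpleGraph V} {k : ℕ} {S T : Finset V} {f : V → Finset ℕ}

open Classical in
/-- The neighbors of `v` inside `S`. -/
noncomputable def nbr (G : SimpleGraph V) (S : Finset V) (v : V) : Finset V :=
  S.filter (G.Adj v)

@[simp] theorem mem_nbr {v w : V} : w ∈ nbr G S v ↔ w ∈ S ∧ G.Adj v w := by simp [nbr]

theorem card_nbr_lt {u x : V} (hTS : T ⊆ S) (hx : x ∈ S) (hxT : x ∉ T) (hux : G.Adj u x) :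
    (nbr G T u).card < (nbr G S u).card := by
  refine Finset.card_lt_card ⟨fun z hz => ?_, fun h => ?_⟩
  · rw [mem_nbr] at hz ⊢
    exact ⟨hTS hz.1, hz.2⟩
  · exact hxT (mem_nbr.1 (h (mem_nbr.2 ⟨hx, hux⟩))).1

/-- `f` restricted to `S` assigns pairs of colors so that adjacent vertices get disjoint pairs and
vertices with a common neighbor in `S` get distinct pairs. -/
structure IsTwoToneOn (G : SimpleGraph V) (k : ℕ) (S : Finset V) (f : V → Finset ℕ) : Prop where
  subset : ∀ v ∈ S, f v ⊆ Finset.Icc 1 k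
  card : ∀ v ∈ S, (f v).card = 2
  disjoint : ∀ v ∈ S, ∀ w ∈ S, G.Adj v w → Disjoint (f v) (f w)
  ne : ∀ u ∈ S, ∀ v ∈ S, ∀ w ∈ S, u ≠ v → G.Adj w u → G.Adj w v → f u ≠ f v

theorem exists_pair {A : Finset ℕ} {B : Finset (Finset ℕ)} (h : B.card < A.card.choose 2) :
    ∃ c ⊆ A, c.card = 2 ∧ c ∉ B := by
  rw [← Finset.card_powersetCard] at h
  obtain ⟨c, hc, hcB⟩ := Finset.exists_mem_notMem_of_card_lt_card h
  rw [Finset.mem_powersetCard] at hc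
  exact ⟨c, hc.1, hc.2, hcB⟩

namespace IsTwoToneOn

variable [DecidableEq V]

theorem exists_insert (h : IsTwoToneOn G k S f) {v : V} {c : Finset ℕ} (hv : v ∉ S)
    (hck : c ⊆ Finset.Icc 1 k) (hc : c.card = 2)
    (hdisj : ∀ u ∈ S, G.Adj v u → Disjoint c (f u))
    (hne : ∀ u ∈ S, G.Adj v u → ∀ w ∈ S, G.Adj u w → f w ≠ c)
    (hinj : ∀ u ∈ S, G.Adj v u → ∀ w ∈ S, G.Adj v w → u ≠ w → f u ≠ f w) :
    ∃ f' : V → Finset ℕ, IsTwoToneOn G k (insert v S) f' ∧ f' v = c ∧ ∀ w, w ≠ v → f' w = f w := by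
  have hf : ∀ w ∈ S, Function.update f v c w = f w := by
    intro w hw
    exact Function.update_of_ne (by rintro rfl; exact hv hw) _ _
  have hself : Function.update f v c v = c := Function.update_self ..
  refine ⟨Function.update f v c, ⟨?_, ?_, ?_, ?_⟩, hself, fun w hw => Function.update_of_ne hw _ _⟩
  · intro u hu
    obtain rfl | hu := Finset.mem_insert.1 hu
    · rwa [hself]
    · rw [hf u hu]; exact h.subset u hu
  · intro u hu
    obtain rfl | hu := Finset.mem_insert.1 hu
    · rwa [hself]
    · rw [hf u hu]; exact h.card u hu
  · intro u hu w hw huw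
    obtain rfl | hu' := Finset.mem_insert.1 hu <;> obtain rfl | hw' := Finset.mem_insert.1 hw
    · exact (huw.ne rfl).elim
    · rw [hself, hf w hw']; exact hdisj w hw' huw
    · rw [hself, hf u hu']; exact (hdisj u hu' huw.symm).symm
    · rw [hf u hu', hf w hw']; exact h.disjoint u hu' w hw' huw
  · intro u hu x hx w hw hux hwu hwx
    obtain rfl | hw' := Finset.mem_insert.1 hw
    · obtain rfl | hu := Finset.mem_insert.1 hu
      · exact (hwu.ne rfl).elim
      obtain rfl | hx := Finset.mem_insert.1 hx
      · exact (hwx.ne rfl).elim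
      rw [hf u hu, hf x hx]; exact hinj u hu hwu x hx hwx hux
    · obtain rfl | hu' := Finset.mem_insert.1 hu <;> obtain rfl | hx' := Finset.mem_insert.1 hx
      · exact (hux rfl).elim
      · rw [hself, hf x hx']; exact (hne w hw' hwu.symm x hx' hwx).symm
      · rw [hself, hf u hu']; exact hne w hw' hwx.symm u hu' hwu
      · rw [hf u hu', hf x hx']; exact h.ne u hu' x hx' w hw' hux hwu hwx

theorem exists_extend (h : IsTwoToneOn G k S f) {v : V} {A : Finset ℕ} {B : Finset (Finset ℕ)}
    (hv : v ∉ S) (hA : A ⊆ Finset.Icc 1 k)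
    (hdisj : ∀ u ∈ S, G.Adj v u → Disjoint A (f u))
    (hB : ∀ u ∈ S, G.Adj v u → ∀ w ∈ S, G.Adj u w → ¬ f w ⊆ A ∨ f w ∈ B)
    (hinj : ∀ u ∈ S, G.Adj v u → ∀ w ∈ S, G.Adj v w → u ≠ w → f u ≠ f w)
    (hcard : B.card < A.card.choose 2) :
    ∃ f' : V → Finset ℕ, IsTwoToneOn G k (insert v S) f' ∧ f' v ∉ B ∧ f' v ⊆ A ∧
      ∀ w, w ≠ v → f' w = f w := by
  obtain ⟨c, hcA, hc, hcB⟩ := exists_pair hcard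
  obtain ⟨f', hf', rfl, hff'⟩ := h.exists_insert hv (hcA.trans hA) hc
    (fun u hu hvu => (hdisj u hu hvu).mono_left hcA)
    (fun u hu hvu w hw huw e => by
      obtain hd | hB := hB u hu hvu w hw huw
      · exact hd (e ▸ hcA)
      · exact hcB (e ▸ hB)) hinj
  exact ⟨f', hf', hcB, hcA, hff'⟩

theorem exists_leaf (h : IsTwoToneOn G k S f) {v u : V} {F : Finset (Finset ℕ)}
    (hv : v ∉ S) (hu : u ∈ S) (huniq : ∀ z ∈ S, G.Adj v z → z = u)
    (hcard : (nbr G S u).card + F.card < (k - 2).choose 2) :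
    ∃ f' : V → Finset ℕ, IsTwoToneOn G k (insert v S) f' ∧ f' v ∉ F ∧
      ∀ w, w ≠ v → f' w = f w := by
  have hA : (Finset.Icc 1 k \ f u).card = k - 2 := by
    rw [Finset.card_sdiff_of_subset (h.subset u hu), h.card u hu, Nat.card_Icc]
    rfl
  obtain ⟨f', hf', hB, -, hff'⟩ := h.exists_extend (A := Finset.Icc 1 k \ f u)
    (B := (nbr G S u).image f ∪ F) hv Finset.sdiff_subset
    (fun z hz hvz => by rw [huniq z hz hvz]; exact Finset.sdiff_disjoint)
    (fun z hz hvz w hw hzw => by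
      rw [huniq z hz hvz] at hzw
      exact Or.inr (Finset.mem_union_left _ (Finset.mem_image_of_mem _ (mem_nbr.2 ⟨hw, hzw⟩))))
    (fun z hz hvz w hw hvw hzw => (hzw ((huniq z hz hvz).trans (huniq w hw hvw).symm)).elim)
    (by
      rw [hA]
      refine lt_of_le_of_lt ((Finset.card_union_le _ _).trans ?_) hcard
      gcongr
      exact Finset.card_image_le)
  exact ⟨f', hf', fun hF => hB (Finset.mem_union_right _ hF), hff'⟩

theorem exists_between (h : IsTwoToneOn G k S f) {v a b : V} {B : Finset (Finset ℕ)}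
    (hv : v ∉ S) (ha : a ∈ S) (hb : b ∈ S) (huniq : ∀ z ∈ S, G.Adj v z → z = a ∨ z = b)
    (hab : f a ≠ f b)
    (hBa : ∀ w ∈ S, G.Adj a w → ¬ f w ⊆ Finset.Icc 1 k \ (f a ∪ f b) ∨ f w ∈ B)
    (hBb : ∀ w ∈ S, G.Adj b w → ¬ f w ⊆ Finset.Icc 1 k \ (f a ∪ f b) ∨ f w ∈ B)
    (hcard : B.card < (k - (f a ∪ f b).card).choose 2) :
    ∃ f' : V → Finset ℕ, IsTwoToneOn G k (insert v S) f' ∧ ∀ w, w ≠ v → f' w = f w := by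
  have hA : (Finset.Icc 1 k \ (f a ∪ f b)).card = k - (f a ∪ f b).card := by
    rw [Finset.card_sdiff_of_subset (Finset.union_subset (h.subset a ha) (h.subset b hb)),
      Nat.card_Icc]
    rfl
  obtain ⟨f', hf', -, -, hff'⟩ := h.exists_extend (A := Finset.Icc 1 k \ (f a ∪ f b))
    (B := B) hv Finset.sdiff_subset
    (fun z hz hvz => by
      obtain rfl | rfl := huniq z hz hvz
      · exact Finset.sdiff_disjoint.mono_right Finset.subset_union_left
      · exact Finset.sdiff_disjoint.mono_right Finset.subset_union_right)
    (fun z hz hvz w hw hzw => by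
      obtain rfl | rfl := huniq z hz hvz
      · exact hBa w hw hzw
      · exact hBb w hw hzw)
    (fun z hz hvz w hw hvw hzw => by
      obtain rfl | rfl := huniq z hz hvz <;> obtain rfl | rfl := huniq w hw hvw
      · exact (hzw rfl).elim
      · exact hab
      · exact hab.symm
      · exact (hzw rfl).elim)
    (by rwa [hA])
  exact ⟨f', hf', hff'⟩

end IsTwoToneOn
end PartialColorings

section Reducible

variable {V : Type*} {G : SimpleGraph V} {k : ℕ} {S : Finset V}

/-- Inside `S`, the vertex `u` has exactly the two neighbors `a` and `b`. -/
structure IsTwo (G : SimpleGraph V) (S : Finset V) (a u b : V) : Prop where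
  mem : u ∈ S
  mem_left : a ∈ S
  mem_right : b ∈ S
  left : G.Adj u a
  right : G.Adj u b
  ne : a ≠ b
  eq : ∀ z ∈ S, G.Adj u z → z = a ∨ z = b

/-- Every proper subset of `S` has a coloring, all degrees in `S` are small enough for a leaf to be
colored, and `G` has no cycles of length at most four. -/
structure Reducible (G : SimpleGraph V) (k : ℕ) (S : Finset V) : Prop where
  le : 7 ≤ k
  ih : ∀ T ⊂ S, ∃ f, IsTwoToneOn G k T f
  card_nbr_le : ∀ v, (nbr G S v).card ≤ (k - 2).choose 2
  triangle : ∀ a b c, G.Adj a b → G.Adj b c → ¬ G.Adj c a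
  square : ∀ a b c d, G.Adj a b → G.Adj b c → G.Adj c d → G.Adj d a → a ≠ c → b = d

theorem Reducible.ten_le (h : Reducible G k S) : 10 ≤ (k - 2).choose 2 :=
  Nat.choose_le_choose 2 (show 5 ≤ k - 2 by have := h.le; omega)

theorem Reducible.three_le (h : Reducible G k S) {n : ℕ} (hn : n ≤ 4) :
    3 ≤ (k - n).choose 2 :=
  Nat.choose_le_choose 2 (show 3 ≤ k - n by have := h.le; omega)

variable [DecidableEq V]

theorem Reducible.of_card_le_one (h : Reducible G k S) {v : V} (hv : v ∈ S)
    (hcard : (nbr G S v).card ≤ 1) : ∃ f, IsTwoToneOn G k S f := by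
  obtain ⟨f, hf⟩ := h.ih _ (Finset.erase_ssubset hv)
  have hvT : v ∉ S.erase v := Finset.notMem_erase v S
  rw [← Finset.insert_erase hv]
  by_cases hu : ∃ u, u ∈ S ∧ G.Adj v u
  · obtain ⟨u, hu, hvu⟩ := hu
    have huniq : ∀ z ∈ S.erase v, G.Adj v z → z = u := fun z hz hvz =>
      Finset.card_le_one.1 hcard _ (mem_nbr.2 ⟨Finset.mem_of_mem_erase hz, hvz⟩) _
        (mem_nbr.2 ⟨hu, hvu⟩)
    have := card_nbr_lt (Finset.erase_subset v S) hv hvT hvu.symm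
    obtain ⟨f', hf', -⟩ := hf.exists_leaf (F := ∅) hvT (Finset.mem_erase.2 ⟨hvu.ne', hu⟩) huniq
      (by simpa using this.trans_le (h.card_nbr_le u))
    exact ⟨f', hf'⟩
  · have hno : ∀ u ∈ S.erase v, ¬ G.Adj v u := fun u hu' hvu =>
      hu ⟨u, Finset.mem_of_mem_erase hu', hvu⟩
    have h10 : 0 < k.choose 2 := Nat.choose_pos (by have := h.le; omega)
    obtain ⟨f', hf', -⟩ := hf.exists_extend (A := Finset.Icc 1 k) (B := ∅) hvT subset_rfl
      (fun u hu hvu => (hno u hu hvu).elim) (fun u hu hvu => (hno u hu hvu).elim)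
      (fun u hu hvu => (hno u hu hvu).elim) (by simpa using h10)
    exact ⟨f', hf'⟩

theorem Reducible.of_four_thread (h : Reducible G k S) {x₀ x₁ x₂ x₃ x₄ x₅ : V}
    (h₁ : IsTwo G S x₀ x₁ x₂) (h₂ : IsTwo G S x₁ x₂ x₃) (h₃ : IsTwo G S x₂ x₃ x₄)
    (h₄ : IsTwo G S x₃ x₄ x₅) : ∃ f, IsTwoToneOn G k S f := by
  have n14 : x₁ ≠ x₄ := by
    rintro rfl; exact h.triangle _ _ _ h₁.right h₂.right h₃.right
  have n03 : x₀ ≠ x₃ := by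
    rintro rfl; exact h.triangle _ _ _ h₁.right h₂.right h₁.left.symm
  have n04 : x₀ ≠ x₄ := by
    rintro rfl; exact h₁.ne (h.square _ _ _ _ h₁.left h₃.right.symm h₂.right.symm h₂.left h₂.ne)
  have n25 : x₂ ≠ x₅ := by
    rintro rfl; exact h.triangle _ _ _ h₂.right h₃.right h₄.right
  have n15 : x₁ ≠ x₅ := by
    rintro rfl; exact h₃.ne (h.square _ _ _ _ h₁.right h₂.right h₃.right h₄.right h₂.ne)
  have a10 := h₁.left.ne
  have a12 := h₁.right.ne
  have a23 := h₂.right.ne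
  have a34 := h₃.right.ne
  have a45 := h₄.right.ne
  obtain ⟨T, hT⟩ : ∃ T, T = S \ {x₁, x₂, x₃, x₄} := ⟨_, rfl⟩
  have hmem : ∀ z, z ∈ T ↔ z ∈ S ∧ z ≠ x₁ ∧ z ≠ x₂ ∧ z ≠ x₃ ∧ z ≠ x₄ := by
    intro z; simp [hT]
  have hTS : T ⊂ S := ⟨fun z hz => ((hmem z).1 hz).1, fun hh => ((hmem x₁).1 (hh h₁.mem)).2.1 rfl⟩
  have hT1 : insert x₁ T ⊆ S := Finset.insert_subset h₁.mem hTS.1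
  have hS : insert x₃ (insert x₂ (insert x₄ (insert x₁ T))) = S := by
    ext z; have := h₁.mem; have := h₂.mem; have := h₃.mem; have := h₄.mem
    simp only [Finset.mem_insert, hmem]; grind
  obtain ⟨f, hf⟩ := h.ih T hTS
  have hx₁ : x₁ ∉ T := by simp [hmem]
  have hx₄ : x₄ ∉ insert x₁ T := by simp [hmem, n14.symm]
  have hc₁ := card_nbr_lt hTS.1 h₁.mem hx₁ h₁.left.symm
  have hc₄ := card_nbr_lt hT1 h₄.mem hx₄ h₄.right.symm
  obtain ⟨f₁, hf₁, -, -⟩ := hf.exists_leaf (F := ∅) hx₁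
    ((hmem x₀).2 ⟨h₁.mem_left, a10.symm, h₁.ne, n03, n04⟩)
    (fun z hz hvz => (h₁.eq z (hTS.1 hz) hvz).resolve_right ((hmem z).1 hz).2.2.1)
    (by simpa using hc₁.trans_le (h.card_nbr_le x₀))
  obtain ⟨f₂, hf₂, -, -⟩ := hf₁.exists_leaf (F := ∅) (u := x₅) hx₄
    (Finset.mem_insert_of_mem ((hmem x₅).2 ⟨h₄.mem_right, n15.symm, n25.symm, h₄.ne.symm, a45.symm⟩))
    (fun z hz hvz => (h₄.eq z (hT1 hz) hvz).resolve_left (by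
      rintro rfl; simp [hmem, h₂.ne.symm] at hz))
    (by simpa using hc₄.trans_le (h.card_nbr_le x₅))
  have hx₂ : x₂ ∉ insert x₄ (insert x₁ T) := by simp [hmem, a12.symm, h₃.ne]
  have hT2 : insert x₄ (insert x₁ T) ⊆ S := Finset.insert_subset h₄.mem hT1
  have hc₂ : (nbr G (insert x₄ (insert x₁ T)) x₁).card ≤ 1 := by
    refine (Finset.card_le_card (t := {x₀}) fun z hz => ?_).trans (by simp)
    rw [mem_nbr] at hz
    obtain rfl | rfl := h₁.eq z (hT2 hz.1) hz.2
    · simp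
    · exact (hx₂ hz.1).elim
  obtain ⟨f₃, hf₃, hne, hff₃⟩ := hf₂.exists_leaf (F := {f₂ x₄}) (u := x₁) hx₂ (by simp)
    (fun z hz hvz => (h₂.eq z (hT2 hz) hvz).resolve_right (by
      rintro rfl; simp [hmem, a34, h₂.ne.symm] at hz))
    (by have := h.ten_le; rw [Finset.card_singleton]; omega)
  have hx₃ : x₃ ∉ insert x₂ (insert x₄ (insert x₁ T)) := by
    simp [hmem, a23.symm, a34, h₂.ne.symm]
  have hT3 : insert x₂ (insert x₄ (insert x₁ T)) ⊆ S := Finset.insert_subset h₂.mem hT2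
  obtain ⟨f₄, hf₄, -⟩ := hf₃.exists_between (a := x₂) (b := x₄) (B := {f₃ x₁, f₃ x₅}) hx₃
    (by simp) (by simp) (fun z hz hvz => h₃.eq z (hT3 hz) hvz)
    (by rw [hff₃ x₄ h₃.ne.symm]; simpa using hne)
    (fun w hw haw => by
      obtain rfl | rfl := h₂.eq w (hT3 hw) haw
      · simp
      · exact (hx₃ hw).elim)
    (fun w hw haw => by
      obtain rfl | rfl := h₄.eq w (hT3 hw) haw
      · exact (hx₃ hw).elim
      · simp)
    (by
      have h1 := Finset.card_union_le (f₃ x₂) (f₃ x₄)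
      rw [hf₃.card x₂ (by simp), hf₃.card x₄ (by simp)] at h1
      exact Finset.card_le_two.trans_lt (h.three_le h1))
  exact ⟨f₄, hS ▸ hf₄⟩

theorem Reducible.of_three_thread (h : Reducible G k S) {x₀ x₁ x₂ x₃ x₄ : V}
    (h₁ : IsTwo G S x₀ x₁ x₂) (h₂ : IsTwo G S x₁ x₂ x₃) (h₃ : IsTwo G S x₂ x₃ x₄)
    (hx₀ : (nbr G S x₀).card ≤ 5) : ∃ f, IsTwoToneOn G k S f := by
  have n14 : x₁ ≠ x₄ := by
    rintro rfl; exact h.triangle _ _ _ h₁.right h₂.right h₃.right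
  have n03 : x₀ ≠ x₃ := by
    rintro rfl; exact h.triangle _ _ _ h₁.right h₂.right h₁.left.symm
  have a10 := h₁.left.ne
  have a12 := h₁.right.ne
  have a23 := h₂.right.ne
  have a34 := h₃.right.ne
  obtain ⟨T, hT⟩ : ∃ T, T = S \ {x₁, x₂, x₃} := ⟨_, rfl⟩
  have hmem : ∀ z, z ∈ T ↔ z ∈ S ∧ z ≠ x₁ ∧ z ≠ x₂ ∧ z ≠ x₃ := by
    intro z; simp [hT]
  have hTS : T ⊂ S := ⟨fun z hz => ((hmem z).1 hz).1, fun hh => ((hmem x₁).1 (hh h₁.mem)).2.1 rfl⟩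
  have hT1 : insert x₃ T ⊆ S := Finset.insert_subset h₃.mem hTS.1
  have hT2 : insert x₁ (insert x₃ T) ⊆ S := Finset.insert_subset h₁.mem hT1
  have hS : insert x₂ (insert x₁ (insert x₃ T)) = S := by
    ext z; have := h₁.mem; have := h₂.mem; have := h₃.mem
    simp only [Finset.mem_insert, hmem]; grind
  obtain ⟨f, hf⟩ := h.ih T hTS
  have hx₃ : x₃ ∉ T := by simp [hmem]
  have hx₁ : x₁ ∉ insert x₃ T := by simp [hmem, h₂.ne]
  have hx₂ : x₂ ∉ insert x₁ (insert x₃ T) := by simp [hmem, a12.symm, a23]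
  have hc₃ := card_nbr_lt hTS.1 h₃.mem hx₃ h₃.right.symm
  have hc₁ := card_nbr_lt hT1 h₁.mem hx₁ h₁.left.symm
  obtain ⟨f₁, hf₁, -, -⟩ := hf.exists_leaf (F := ∅) (u := x₄) hx₃
    ((hmem x₄).2 ⟨h₃.mem_right, n14.symm, h₃.ne.symm, a34.symm⟩)
    (fun z hz hvz => (h₃.eq z (hTS.1 hz) hvz).resolve_left ((hmem z).1 hz).2.2.1)
    (by simpa using hc₃.trans_le (h.card_nbr_le x₄))
  obtain ⟨f₂, hf₂, hne, hff₂⟩ := hf₁.exists_leaf (F := {f₁ x₃}) (u := x₀) hx₁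
    (Finset.mem_insert_of_mem ((hmem x₀).2 ⟨h₁.mem_left, a10.symm, h₁.ne, n03⟩))
    (fun z hz hvz => (h₁.eq z (hT1 hz) hvz).resolve_right (by
      rintro rfl; exact hx₂ (Finset.mem_insert_of_mem hz)))
    (by have := h.ten_le; rw [Finset.card_singleton]; omega)
  obtain ⟨f₄, hf₄, -⟩ := hf₂.exists_between (a := x₁) (b := x₃) (B := {f₂ x₀, f₂ x₄}) hx₂
    (by simp) (by simp) (fun z hz hvz => h₂.eq z (hT2 hz) hvz)
    (by rw [hff₂ x₃ h₂.ne.symm]; simpa using hne)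
    (fun w hw haw => by
      obtain rfl | rfl := h₁.eq w (hT2 hw) haw
      · simp
      · exact (hx₂ hw).elim)
    (fun w hw haw => by
      obtain rfl | rfl := h₃.eq w (hT2 hw) haw
      · exact (hx₂ hw).elim
      · simp)
    (by
      have h1 := Finset.card_union_le (f₂ x₁) (f₂ x₃)
      rw [hf₂.card x₁ (by simp), hf₂.card x₃ (by simp)] at h1
      exact Finset.card_le_two.trans_lt (h.three_le h1))
  exact ⟨f₄, hS ▸ hf₄⟩

theorem exists_pair_inter {A B D : Finset ℕ} {F : Finset (Finset ℕ)} (hA : A.card = 2)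
    (hAB : Disjoint A B) (hBD : Disjoint B D) (hAD : Disjoint A D) (hF : F.card < 2 * B.card) :
    ∃ c ⊆ A ∪ B, c.card = 2 ∧ Disjoint c D ∧ (A ∪ c).card ≤ A.card + 1 ∧ c ≠ A ∧ c ∉ F := by
  have hne : ∀ p ∈ A, ∀ q ∈ B, p ≠ q := fun p hp q hq => Finset.disjoint_iff_ne.1 hAB p hp q hq
  have hcard : ((A ×ˢ B).image fun pq => ({pq.1, pq.2} : Finset ℕ)).card = 2 * B.card := by
    rw [Finset.card_image_of_injOn, Finset.card_product, hA]
    rintro ⟨p, q⟩ hpq ⟨p', q'⟩ hpq' h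
    simp only [Finset.coe_product, Set.mem_prod, Finset.mem_coe] at hpq hpq'
    have h1 := hne p hpq.1 q' hpq'.2
    have h2 := hne p' hpq'.1 q hpq.2
    have e1 : p ∈ ({p', q'} : Finset ℕ) := by
      rw [← show ({p, q} : Finset ℕ) = {p', q'} from h]; simp
    have e2 : q ∈ ({p', q'} : Finset ℕ) := by
      rw [← show ({p, q} : Finset ℕ) = {p', q'} from h]; simp
    simp only [Finset.mem_insert, Finset.mem_singleton] at e1 e2
    rw [Prod.mk.injEq]
    exact ⟨e1.resolve_right h1, e2.resolve_left h2.symm⟩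
  rw [← hcard] at hF
  obtain ⟨c, hc, hcF⟩ := Finset.exists_mem_notMem_of_card_lt_card hF
  obtain ⟨⟨p, q⟩, hpq, rfl⟩ := Finset.mem_image.1 hc
  obtain ⟨hp, hq⟩ := Finset.mem_product.1 hpq
  dsimp only at hp hq hcF ⊢
  refine ⟨{p, q}, ?_, Finset.card_pair (hne p hp q hq), ?_, ?_, ?_, hcF⟩
  · simp [Finset.insert_subset_iff, hp, hq]
  · simp [Finset.disjoint_left.1 hAD hp, Finset.disjoint_left.1 hBD hq]
  · have : A ∪ {p, q} = insert q A := by ext z; simp; grind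
    rw [this]
    exact Finset.card_insert_le _ _
  · rintro h
    have : q ∈ A := by rw [← h]; simp
    exact hne q this q hq rfl

theorem Reducible.of_two_thread (h : Reducible G k S) {x₀ x₁ x₂ x₃ : V}
    (h₁ : IsTwo G S x₀ x₁ x₂) (h₂ : IsTwo G S x₁ x₂ x₃)
    (hx₀ : (nbr G S x₀).card ≤ 3) (hx₃ : (nbr G S x₃).card ≤ 5) :
    ∃ f, IsTwoToneOn G k S f := by
  have n03 : x₀ ≠ x₃ := by
    rintro rfl; exact h.triangle _ _ _ h₁.right h₂.right h₁.left.symm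
  have a10 := h₁.left.ne
  have a12 := h₁.right.ne
  have a23 := h₂.right.ne
  obtain ⟨T, hT⟩ : ∃ T, T = S \ {x₁, x₂} := ⟨_, rfl⟩
  have hmem : ∀ z, z ∈ T ↔ z ∈ S ∧ z ≠ x₁ ∧ z ≠ x₂ := by
    intro z; simp [hT]
  have hTS : T ⊂ S := ⟨fun z hz => ((hmem z).1 hz).1, fun hh => ((hmem x₁).1 (hh h₁.mem)).2.1 rfl⟩
  have hT1 : insert x₂ T ⊆ S := Finset.insert_subset h₂.mem hTS.1
  have hS : insert x₁ (insert x₂ T) = S := by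
    ext z; have := h₁.mem; have := h₂.mem
    simp only [Finset.mem_insert, hmem]; grind
  obtain ⟨f, hf⟩ := h.ih T hTS
  have hx₂ : x₂ ∉ T := by simp [hmem]
  have hx₁ : x₁ ∉ insert x₂ T := by simp [hmem, a12]
  have hx₁' : x₁ ∉ T := by simp [hmem]
  have hx₀T : x₀ ∈ T := (hmem x₀).2 ⟨h₁.mem_left, a10.symm, h₁.ne⟩
  have hx₃T : x₃ ∈ T := (hmem x₃).2 ⟨h₂.mem_right, h₂.ne.symm, a23.symm⟩
  have hc₃ := card_nbr_lt hTS.1 h₂.mem hx₂ h₂.right.symm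
  have hc₀ := card_nbr_lt hTS.1 h₁.mem hx₁' h₁.left.symm
  have huniq₂ : ∀ z ∈ T, G.Adj x₂ z → z = x₃ := fun z hz hvz =>
    (h₂.eq z (hTS.1 hz) hvz).resolve_left (by rintro rfl; exact hx₁' hz)
  have hle := h.le
  have hne₀ : ∀ w ∈ insert x₂ T, G.Adj x₀ w → w ∈ nbr G T x₀ := by
    intro w hw haw
    obtain rfl | hw := Finset.mem_insert.1 hw
    · obtain e | e := h₂.eq _ h₁.mem_left haw.symm
      · exact (a10 e.symm).elim
      · exact (n03 e).elim
    · exact mem_nbr.2 ⟨hw, haw⟩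
  suffices hsuff : ∃ (f₁ : V → Finset ℕ) (B : Finset (Finset ℕ)),
      IsTwoToneOn G k (insert x₂ T) f₁ ∧ f₁ x₀ ≠ f₁ x₂ ∧ (nbr G T x₀).image f₁ ⊆ B ∧
      (¬ f₁ x₃ ⊆ Finset.Icc 1 k \ (f₁ x₀ ∪ f₁ x₂) ∨ f₁ x₃ ∈ B) ∧
      B.card < (k - (f₁ x₀ ∪ f₁ x₂).card).choose 2 by
    obtain ⟨f₁, B, hf₁, hne, hB, hx, hcard⟩ := hsuff
    obtain ⟨f₂, hf₂, -⟩ := hf₁.exists_between (a := x₀) (b := x₂) (B := B) hx₁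
      (Finset.mem_insert_of_mem hx₀T) (by simp) (fun z hz hvz => h₁.eq z (hT1 hz) hvz) hne
      (fun w hw haw => Or.inr (hB (Finset.mem_image_of_mem _ (hne₀ w hw haw))))
      (fun w hw haw => by
        obtain rfl | rfl := h₂.eq w (hT1 hw) haw
        · exact (hx₁ hw).elim
        · exact hx)
      hcard
    exact ⟨f₂, hS ▸ hf₂⟩
  have himg : ∀ f' : V → Finset ℕ, ((nbr G T x₀).image f').card ≤ 2 := fun f' =>
    Finset.card_image_le.trans (by omega)
  by_cases hd : Disjoint (f x₀) (f x₃)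
  · have hR : (Finset.Icc 1 k \ (f x₀ ∪ f x₃)).card = k - 4 := by
      rw [Finset.card_sdiff_of_subset
        (Finset.union_subset (hf.subset x₀ hx₀T) (hf.subset x₃ hx₃T)), Nat.card_Icc,
        Finset.card_union_of_disjoint hd, hf.card x₀ hx₀T, hf.card x₃ hx₃T]
      rfl
    have hF : ((nbr G T x₃).image f).card < 2 * (Finset.Icc 1 k \ (f x₀ ∪ f x₃)).card := by
      have := Finset.card_image_le (s := nbr G T x₃) (f := f)
      omega
    obtain ⟨c, hc, hc2, hcd, hcu, hcne, hcF⟩ := exists_pair_inter (D := f x₃) (hf.card x₀ hx₀T)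
      (Finset.sdiff_disjoint.mono_right Finset.subset_union_left).symm
      (Finset.sdiff_disjoint.mono_right Finset.subset_union_right) hd hF
    obtain ⟨f₁, hf₁, rfl, hff₁⟩ := hf.exists_insert hx₂
      (hc.trans (Finset.union_subset (hf.subset x₀ hx₀T) Finset.sdiff_subset)) hc2
      (fun u hu hvu => by rwa [huniq₂ u hu hvu])
      (fun u hu hvu w hw huw e => by
        rw [huniq₂ u hu hvu] at huw
        exact hcF (e ▸ Finset.mem_image_of_mem f (mem_nbr.2 ⟨hw, huw⟩)))
      (fun u hu hvu w hw hvw hne => (hne ((huniq₂ u hu hvu).trans (huniq₂ w hw hvw).symm)).elim)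
    rw [← hff₁ x₀ h₁.ne] at hcne hcu
    refine ⟨f₁, (nbr G T x₀).image f₁ ∪ {f₁ x₃}, hf₁, hcne.symm, Finset.subset_union_left,
      Or.inr (by simp), ?_⟩
    rw [hf₁.card x₀ (Finset.mem_insert_of_mem hx₀T)] at hcu
    refine lt_of_lt_of_le (b := 6) ?_
      (Nat.choose_le_choose 2 (show 4 ≤ k - (f₁ x₀ ∪ f₁ x₂).card by omega))
    have := Finset.card_union_le ((nbr G T x₀).image f₁) {f₁ x₃}
    have := himg f₁
    rw [Finset.card_singleton] at *
    omega
  · obtain ⟨f₁, hf₁, -, hff₁⟩ := hf.exists_leaf (F := ∅) hx₂ hx₃T huniq₂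
      (by simpa using hc₃.trans_le (h.card_nbr_le x₃))
    have hm₀ : x₀ ∈ insert x₂ T := Finset.mem_insert_of_mem hx₀T
    have hm₃ : x₃ ∈ insert x₂ T := Finset.mem_insert_of_mem hx₃T
    have hd₁ := hf₁.disjoint x₂ (by simp) x₃ hm₃ h₂.right
    rw [← hff₁ x₀ h₁.ne, ← hff₁ x₃ a23.symm] at hd
    refine ⟨f₁, (nbr G T x₀).image f₁, hf₁, fun e => hd (e ▸ hd₁), subset_rfl, Or.inl fun hsub => ?_, ?_⟩
    · exact hd ((Finset.disjoint_sdiff.mono_right hsub).mono_left Finset.subset_union_left)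
    · have hu := Finset.card_union_le (f₁ x₀) (f₁ x₂)
      rw [hf₁.card x₀ hm₀, hf₁.card x₂ (by simp)] at hu
      exact (himg f₁).trans_lt (h.three_le hu)

end Reducible

section Discharging

variable {V : Type*} {G : SimpleGraph V} {k : ℕ} {S : Finset V}

theorem IsTwo.symm {a u b : V} (h : IsTwo G S a u b) : IsTwo G S b u a :=
  ⟨h.mem, h.mem_right, h.mem_left, h.right, h.left, h.ne.symm, fun z hz huz => (h.eq z hz huz).symm⟩

theorem exists_isTwo {u a : V} (hu : u ∈ S) (ha : a ∈ S) (hua : G.Adj u a)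
    (hcard : (nbr G S u).card = 2) : ∃ b, IsTwo G S a u b := by
  classical
  obtain ⟨x, y, hxy, hN⟩ := Finset.card_eq_two.1 hcard
  have hmem : ∀ z, z ∈ S ∧ G.Adj u z ↔ z = x ∨ z = y := fun z => by
    rw [← mem_nbr, hN]; simp
  obtain ⟨hx, hux⟩ := (hmem x).2 (Or.inl rfl)
  obtain ⟨hy, huy⟩ := (hmem y).2 (Or.inr rfl)
  obtain rfl | rfl := (hmem a).1 ⟨ha, hua⟩
  · exact ⟨y, hu, ha, hy, hua, huy, hxy, fun z hz huz => (hmem z).1 ⟨hz, huz⟩⟩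
  · exact ⟨x, hu, ha, hx, hua, hux, hxy.symm, fun z hz huz => ((hmem z).1 ⟨hz, huz⟩).symm⟩

theorem IsTwo.sum_nbr {a u b : V} (h : IsTwo G S a u b) (F : V → ℤ) :
    ∑ q ∈ nbr G S u, F q = F a + F b := by
  classical
  have : nbr G S u = {a, b} := by
    ext z
    rw [mem_nbr, Finset.mem_insert, Finset.mem_singleton]
    refine ⟨fun hz => h.eq z hz.1 hz.2, ?_⟩
    rintro (rfl | rfl)
    · exact ⟨h.mem_left, h.left⟩
    · exact ⟨h.mem_right, h.right⟩
  rw [this, Finset.sum_pair h.ne]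

theorem IsTwo.card_nbr {a u b : V} (h : IsTwo G S a u b) : (nbr G S u).card = 2 := by
  have := h.sum_nbr fun _ => 1
  rw [Finset.sum_const, nsmul_one] at this
  exact_mod_cast this

/-- The charge a vertex of degree `n` sends to each of its neighbors of degree two. -/
def pay (n : ℕ) : ℤ := if n ≤ 2 then 0 else if n ≤ 3 then 1 else if n ≤ 5 then 2 else 3

theorem pay_mul_le {n : ℕ} (hn : 2 ≤ n) :
    pay n * n - (if n = 2 then 2 else 0) ≤ 5 * n - 12 := by
  unfold pay
  split_ifs <;> omega

theorem pay_nonneg (n : ℕ) : 0 ≤ pay n := by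
  unfold pay
  split_ifs <;> omega

/-- The charge received by a vertex. -/
noncomputable def received (G : SimpleGraph V) (S : Finset V) (u : V) : ℤ :=
  ∑ p ∈ nbr G S u, pay (nbr G S p).card

/-- The level of a vertex of degree two: adjacent vertices of degree two even out their levels. -/
noncomputable def level (G : SimpleGraph V) (S : Finset V) (u : V) : ℤ :=
  max (received G S u - 2) (-1)

/-- The vertices of degree two in `S`. -/
noncomputable def twos (G : SimpleGraph V) (S : Finset V) : Finset V :=
  S.filter fun u => (nbr G S u).card = 2

theorem sum_received_le :
    ∑ u ∈ twos G S, received G S u ≤ ∑ p ∈ S, pay (nbr G S p).card * (nbr G S p).card := by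
  classical
  calc ∑ u ∈ twos G S, received G S u
      = ∑ u ∈ twos G S, ∑ p ∈ S, if G.Adj u p then pay (nbr G S p).card else 0 := by
        refine Finset.sum_congr rfl fun u _ => ?_
        rw [received, nbr, Finset.sum_filter]
    _ ≤ ∑ u ∈ S, ∑ p ∈ S, if G.Adj u p then pay (nbr G S p).card else 0 := by
        refine Finset.sum_le_sum_of_subset_of_nonneg (Finset.filter_subset _ _) fun u _ _ =>
          Finset.sum_nonneg fun p _ => ?_
        split_ifs
        · exact pay_nonneg _
        · exact le_rfl
    _ = ∑ p ∈ S, pay (nbr G S p).card * (nbr G S p).card := by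
        rw [Finset.sum_comm]
        refine Finset.sum_congr rfl fun p _ => ?_
        rw [← Finset.sum_filter, Finset.sum_const, nsmul_eq_mul, mul_comm]
        congr 3
        ext z
        simp [G.adj_comm]

theorem sum_level_sub :
    ∑ u ∈ twos G S, ∑ q ∈ nbr G S u,
      (if (nbr G S q).card = 2 then level G S u - level G S q else 0) = 0 := by
  classical
  have h : ∀ u, ∑ q ∈ nbr G S u,
      (if (nbr G S q).card = 2 then level G S u - level G S q else 0) =
      ∑ q ∈ twos G S, if G.Adj u q then level G S u - level G S q else 0 := fun u => by
    rw [← Finset.sum_filter, ← Finset.sum_filter, nbr, twos, Finset.filter_filter,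
      Finset.filter_filter]
    refine Finset.sum_congr ?_ fun _ _ => rfl
    ext z
    simp only [Finset.mem_filter]
    tauto
  simp only [h]
  have h2 := Finset.sum_comm (s := twos G S) (t := twos G S)
    (f := fun u q => if G.Adj u q then level G S u - level G S q else 0)
  have h3 : ∑ q ∈ twos G S, ∑ u ∈ twos G S,
      (if G.Adj u q then level G S u - level G S q else 0) =
      - ∑ u ∈ twos G S, ∑ q ∈ twos G S,
      (if G.Adj u q then level G S u - level G S q else 0) := by
    rw [← Finset.sum_neg_distrib]
    refine Finset.sum_congr rfl fun q _ => ?_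
    rw [← Finset.sum_neg_distrib]
    refine Finset.sum_congr rfl fun u _ => ?_
    rw [G.adj_comm]
    split_ifs <;> ring
  linarith

/-- Degree conditions on threads that hold when none of the reducible configurations occurs. -/
structure Unreducible (G : SimpleGraph V) (S : Finset V) : Prop where
  two_le : ∀ v ∈ S, 2 ≤ (nbr G S v).card
  four : ∀ x₀ x₁ x₂ x₃ x₄ x₅, IsTwo G S x₀ x₁ x₂ → IsTwo G S x₁ x₂ x₃ → IsTwo G S x₂ x₃ x₄ →
    ¬ IsTwo G S x₃ x₄ x₅
  three : ∀ x₀ x₁ x₂ x₃ x₄, IsTwo G S x₀ x₁ x₂ → IsTwo G S x₁ x₂ x₃ → IsTwo G S x₂ x₃ x₄ →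
    5 < (nbr G S x₀).card
  two : ∀ x₀ x₁ x₂ x₃, IsTwo G S x₀ x₁ x₂ → IsTwo G S x₁ x₂ x₃ →
    (nbr G S x₀).card ≤ 3 → 5 < (nbr G S x₃).card

namespace Unreducible

theorem of_left (h : Unreducible G S) {a u b : V} (hu : IsTwo G S a u b)
    (ha : (nbr G S a).card = 2) (hb : (nbr G S b).card ≠ 2) :
    0 ≤ received G S u - 2 + level G S a ∧ level G S u = received G S u - 2 := by
  obtain ⟨p, hp⟩ := exists_isTwo hu.mem_left hu.mem hu.left.symm ha
  have hb2 := h.two_le b hu.mem_right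
  have hru : received G S u = pay (nbr G S b).card := by
    rw [received, hu.sum_nbr, ha]; simp [pay]
  have h1 : 1 ≤ pay (nbr G S b).card := by unfold pay; split_ifs <;> omega
  refine ⟨?_, ?_⟩
  · by_cases hp2 : (nbr G S p).card = 2
    · obtain ⟨q, hq⟩ := exists_isTwo hp.mem_right hp.mem hp.right.symm hp2
      have h5 := h.three _ _ _ _ _ hu.symm hp hq
      have hl : -1 ≤ level G S a := le_max_right _ _
      have : pay (nbr G S b).card = 3 := by unfold pay; split_ifs <;> omega
      omega
    · have hp3 := h.two_le p hp.mem_right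
      have hu2 := hu.card_nbr
      have hra : received G S a = pay (nbr G S p).card := by
        rw [received, hp.sum_nbr, hu2]; simp [pay]
      have hl : received G S a - 2 ≤ level G S a := le_max_left _ _
      have e1 := h.two _ _ _ _ hu.symm hp
      have e2 := h.two _ _ _ _ hp.symm hu
      have : 4 ≤ pay (nbr G S b).card + pay (nbr G S p).card := by
        unfold pay; split_ifs <;> omega
      omega
  · exact max_eq_left (by omega)

theorem level_eq (h : Unreducible G S) {a u b : V} (hu : IsTwo G S a u b)
    (ha : (nbr G S a).card = 2) (hb : (nbr G S b).card = 2) : level G S a = 1 := by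
  obtain ⟨p, hp⟩ := exists_isTwo hu.mem_left hu.mem hu.left.symm ha
  obtain ⟨q, hq⟩ := exists_isTwo hu.mem_right hu.mem hu.right.symm hb
  have h5 := h.three _ _ _ _ _ hp.symm hu hq
  have hu2 := hu.card_nbr
  rw [level, received, hp.sum_nbr, hu2]
  have h0 : pay 2 = 0 := rfl
  have h3 : pay (nbr G S p).card = 3 := by unfold pay; split_ifs <;> omega
  rw [h0, h3]
  rfl

theorem sum_level_le (h : Unreducible G S) {u : V} (hu : u ∈ twos G S) :
    ∑ q ∈ nbr G S u, (if (nbr G S q).card = 2 then level G S u - level G S q else 0) ≤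
      2 * (received G S u - 2) := by
  obtain ⟨huS, hu2⟩ := Finset.mem_filter.1 hu
  obtain ⟨a, haN⟩ := Finset.card_pos.1 (show 0 < (nbr G S u).card by omega)
  rw [mem_nbr] at haN
  obtain ⟨b, hab⟩ := exists_isTwo huS haN.1 haN.2 hu2
  rw [hab.sum_nbr]
  have ha2 := h.two_le a hab.mem_left
  have hb2 := h.two_le b hab.mem_right
  have hr : received G S u = pay (nbr G S a).card + pay (nbr G S b).card := hab.sum_nbr _
  by_cases ha : (nbr G S a).card = 2 <;> by_cases hb : (nbr G S b).card = 2
  · have h0 : pay 2 = 0 := rfl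
    rw [ha, hb, h0] at hr
    have hl : level G S u = -1 := by rw [level, hr]; rfl
    rw [if_pos ha, if_pos hb, h.level_eq hab ha hb, h.level_eq hab.symm hb ha, hl, hr]
    norm_num
  · have := h.of_left hab ha hb
    rw [if_pos ha, if_neg hb]
    linarith
  · have := h.of_left hab.symm hb ha
    rw [if_neg ha, if_pos hb]
    linarith
  · rw [if_neg ha, if_neg hb, hr]
    have h1 : 1 ≤ pay (nbr G S a).card := by unfold pay; split_ifs <;> omega
    have h2 : 1 ≤ pay (nbr G S b).card := by unfold pay; split_ifs <;> omega
    linarith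

/-- The average degree of a graph without reducible configurations is at least `12/5`. -/
theorem le_sum_card (h : Unreducible G S) :
    12 * S.card ≤ 5 * ∑ v ∈ S, (nbr G S v).card := by
  have h1 := Finset.sum_le_sum fun u hu => h.sum_level_le (u := u) hu
  rw [sum_level_sub, ← Finset.mul_sum, Finset.sum_sub_distrib, Finset.sum_const] at h1
  have h2 := sum_received_le (G := G) (S := S)
  have h3 := Finset.sum_le_sum fun v hv => pay_mul_le (h.two_le v hv)
  rw [Finset.sum_sub_distrib, Finset.sum_sub_distrib, ← Finset.sum_filter, Finset.sum_const,
    Finset.sum_const, ← Finset.mul_sum] at h3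
  rw [twos] at *
  simp only [nsmul_eq_mul] at *
  zify
  linarith

end Unreducible

/-- A sparse graph whose proper subgraphs are colorable is colorable. -/
theorem Reducible.exists_coloring (h : Reducible G k S)
    (hsparse : (∀ v ∈ S, 2 ≤ (nbr G S v).card) → 5 * ∑ v ∈ S, (nbr G S v).card < 12 * S.card) :
    ∃ f, IsTwoToneOn G k S f := by
  classical
  by_contra hcon
  have htwo : ∀ v ∈ S, 2 ≤ (nbr G S v).card := by
    intro v hv
    by_contra hlt
    exact hcon (h.of_card_le_one hv (by omega))
  refine (hsparse htwo).not_ge (Unreducible.le_sum_card ⟨htwo, ?_, ?_, ?_⟩)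
  · exact fun x₀ x₁ x₂ x₃ x₄ x₅ h₁ h₂ h₃ h₄ => hcon (h.of_four_thread h₁ h₂ h₃ h₄)
  · intro x₀ x₁ x₂ x₃ x₄ h₁ h₂ h₃
    by_contra hlt
    exact hcon (h.of_three_thread h₁ h₂ h₃ (by omega))
  · intro x₀ x₁ x₂ x₃ h₁ h₂ h0
    by_contra hlt
    exact hcon (h.of_two_thread h₁ h₂ h0 (by omega))

end Discharging

section Main

variable {V : Type*} {G : SimpleGraph V} {k : ℕ} {S : Finset V}

theorem not_triangle (hgirth : 12 ≤ G.egirth) (a b c : V) (hab : G.Adj a b) (hbc : G.Adj b c) :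
    ¬ G.Adj c a := by
  intro hca
  have hcyc : (Walk.cons hab (Walk.cons hbc (Walk.cons hca Walk.nil))).IsCycle := by
    have := hab.ne
    have := hbc.ne
    have := hca.ne
    simp [Walk.cons_isCycle_iff, Walk.cons_isPath_iff]
    grind
  have := hgirth.trans (egirth_le_length hcyc)
  simp only [Walk.length_cons, Walk.length_nil] at this
  exact absurd this (by decide)

theorem eq_of_square (hgirth : 12 ≤ G.egirth) (a b c d : V) (hab : G.Adj a b) (hbc : G.Adj b c)
    (hcd : G.Adj c d) (hda : G.Adj d a) (hac : a ≠ c) : b = d := by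
  by_contra hbd
  have hcyc : (Walk.cons hab (Walk.cons hbc (Walk.cons hcd (Walk.cons hda Walk.nil)))).IsCycle := by
    have := hab.ne
    have := hbc.ne
    have := hcd.ne
    have := hda.ne
    simp [Walk.cons_isCycle_iff, Walk.cons_isPath_iff]
    grind
  have := hgirth.trans (egirth_le_length hcyc)
  simp only [Walk.length_cons, Walk.length_nil] at this
  exact absurd this (by decide)

theorem sum_card_nbr_lt [Fintype V] (hG : IsPlanar G) (hgirth : 12 ≤ G.egirth) (hS : S.Nonempty)
    (htwo : ∀ v ∈ S, 2 ≤ (nbr G S v).card) :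
    5 * ∑ v ∈ S, (nbr G S v).card < 12 * S.card := by
  classical
  obtain ⟨H, hH⟩ : ∃ H, H = restr G (S : Set V) := ⟨_, rfl⟩
  have hadj : ∀ u v, H.Adj u v ↔ G.Adj u v ∧ u ∈ S ∧ v ∈ S := by
    rintro u v; rw [hH, restr_adj]; rfl
  have hHG : H ≤ G := hH ▸ restr_le G _
  have hsupp : suppF H = S := by
    ext v
    simp only [mem_suppF, hadj]
    refine ⟨fun ⟨w, hw⟩ => hw.2.1, fun hv => ?_⟩
    obtain ⟨w, hw⟩ := Finset.card_pos.1 (show 0 < (nbr G S v).card by have := htwo v hv; omega)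
    rw [mem_nbr] at hw
    exact ⟨w, hw.2, hv, hw.1⟩
  have hle : (suppF H).card ≤ (edgeF H).card := by
    refine card_suppF_le fun v w hvw => ?_
    obtain ⟨w', hw', hne⟩ := Finset.exists_mem_ne (htwo v ((hadj v w).1 hvw).2.1) w
    rw [mem_nbr] at hw'
    exact ⟨w', hne, (hadj v w').2 ⟨hw'.2, ((hadj v w).1 hvw).2.1, hw'.1⟩⟩
  have hpos : 0 < (edgeF H).card := by
    have := hS.card_pos
    rw [← hsupp] at this
    omega
  have hdeg : ∑ v ∈ S, (nbr G S v).card = 2 * (edgeF H).card := by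
    have h2 : H.edgeFinset = edgeF H := by ext; simp
    rw [← h2, ← H.sum_degrees_eq_twice_card_edges]
    rw [← Finset.sum_subset (Finset.subset_univ S)]
    · refine Finset.sum_congr rfl fun v hv => ?_
      rw [← card_neighborFinset_eq_degree]
      congr 1
      ext w
      simp [hadj, hv, and_comm]
    · intro v _ hv
      rw [← card_neighborFinset_eq_degree, Finset.card_eq_zero]
      ext w
      simp [hadj, hv]
  have hw := weighted_euler (H := H) (l := fun _ => 1) (g := 12)
    (fun h => hG.1 (h.mono hHG)) (fun h => hG.2 (h.mono hHG)) (by norm_num)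
    (fun _ _ => zero_le_one) ?_ hpos hle
  · rw [Finset.sum_const, nsmul_one, hsupp] at hw
    rw [hdeg]
    have : (5 * (2 * (edgeF H).card) : ℝ) < 12 * S.card := by linarith
    exact_mod_cast this
  · intro C hC
    obtain ⟨v, w, hw, hwC⟩ := hC.mono hHG
    rw [IsCyc.sum_eq hw hwC]
    have := hgirth.trans (egirth_le_length hw)
    have h12 : 12 ≤ w.length := by exact_mod_cast this
    simpa using h12

theorem exists_isTwoToneOn [Fintype V] (hG : IsPlanar G) (hgirth : 12 ≤ G.egirth) (hk : 7 ≤ k)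
    (hdeg : maxDeg G ≤ (k - 2).choose 2) (S : Finset V) : ∃ f, IsTwoToneOn G k S f := by
  classical
  induction S using Finset.strongInduction with
  | H S ih =>
    obtain rfl | hS := S.eq_empty_or_nonempty
    · exact ⟨fun _ => ∅, by constructor <;> simp⟩
    refine Reducible.exists_coloring ⟨hk, ih, fun v => le_trans ?_ hdeg, not_triangle hgirth,
      eq_of_square hgirth⟩ (sum_card_nbr_lt hG hgirth hS)
    refine le_trans ?_ (Finset.le_sup (f := fun v => (G.neighborSet v).ncard) (Finset.mem_univ v))
    rw [← Set.ncard_coe_finset]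
    exact Set.ncard_le_ncard (fun w hw => (mem_nbr.1 hw).2) (Set.toFinite _)

theorem IsTwoToneOn.isTToneColoring [Fintype V] {f : V → Finset ℕ}
    (h : IsTwoToneOn G k Finset.univ f) : IsTToneColoring G 2 k f := by
  refine ⟨fun v => h.subset v (Finset.mem_univ v), fun v => h.card v (Finset.mem_univ v),
    fun v w hvw => ?_⟩
  by_cases hadj : G.Adj v w
  · rw [Finset.disjoint_iff_inter_eq_empty.1
      (h.disjoint v (Finset.mem_univ v) w (Finset.mem_univ w) hadj), edist_eq_one_iff_adj.2 hadj]
    simp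
  by_cases hcom : G.commonNeighbors v w = ∅
  · refine lt_of_le_of_lt ?_ (two_lt_edist_iff.2 ⟨hvw, hadj, hcom⟩)
    have := Finset.card_le_card (Finset.inter_subset_left (s₁ := f v) (s₂ := f w))
    rw [h.card v (Finset.mem_univ v)] at this
    exact_mod_cast this
  · obtain ⟨u, hu⟩ := Set.nonempty_iff_ne_empty.2 hcom
    rw [mem_commonNeighbors] at hu
    have hne := h.ne v (Finset.mem_univ v) w (Finset.mem_univ w) u (Finset.mem_univ u) hvw
      hu.1.symm hu.2.symm
    rw [edist_eq_two_iff.2 ⟨hvw, hadj, ⟨u, hu⟩⟩]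
    have hlt : (f v ∩ f w).card < 2 := by
      by_contra hlt
      have h1 : f v ∩ f w = f v := Finset.eq_of_subset_of_card_le Finset.inter_subset_left
        (by rw [h.card v (Finset.mem_univ v)]; omega)
      have h2 : f v ∩ f w = f w := Finset.eq_of_subset_of_card_le Finset.inter_subset_right
        (by rw [h.card w (Finset.mem_univ w)]; omega)
      exact hne (h1.symm.trans h2)
    exact_mod_cast hlt

theorem IsTToneColoring.maxDeg_le [Fintype V] {f : V → Finset ℕ} (h : IsTToneColoring G 2 k f) :
    maxDeg G ≤ (k - 2).choose 2 := by
  classical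
  obtain ⟨hk, hcard, hdist⟩ := h
  refine Finset.sup_le fun v _ => ?_
  have hA : (Finset.Icc 1 k \ f v).card = k - 2 := by
    rw [Finset.card_sdiff_of_subset (hk v), hcard v, Nat.card_Icc]
    rfl
  rw [Set.ncard_eq_toFinset_card', ← hA, ← Finset.card_powersetCard]
  refine Finset.card_le_card_of_injOn f (fun u hu => ?_) fun u hu w hw huw => ?_
  · have hvu : G.Adj v u := by simpa using hu
    have h1 := hdist hvu.ne'
    rw [edist_eq_one_iff_adj.2 hvu.symm] at h1
    have h0 : (f u ∩ f v).card < 1 := by exact_mod_cast h1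
    have hd : Disjoint (f u) (f v) := by
      rw [Finset.disjoint_iff_inter_eq_empty, ← Finset.card_eq_zero]
      omega
    exact Finset.mem_powersetCard.2 ⟨Finset.subset_sdiff.2 ⟨hk u, hd⟩, hcard u⟩
  · have hvu : G.Adj v u := by simpa using hu
    have hvw : G.Adj v w := by simpa using hw
    by_contra hne
    have h1 := hdist hne
    rw [huw, Finset.inter_self, hcard w] at h1
    have h2 := (Walk.cons hvu.symm (Walk.cons hvw Walk.nil)).edist_le
    exact absurd (h1.trans_le h2) (by simp)

theorem ceil_le_iff {d m : ℕ} (hd : 0 < d) :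
    ⌈Real.sqrt (2 * (d : ℝ) + 0.25) + 2.5⌉₊ ≤ m ↔ d ≤ (m - 2).choose 2 := by
  rw [Nat.ceil_le]
  obtain hm | ⟨n, rfl⟩ : m < 3 ∨ ∃ n, m = n + 3 := by
    obtain h | h := lt_or_ge m 3
    · exact Or.inl h
    · exact Or.inr ⟨m - 3, by omega⟩
  · have h1 : 0.5 < Real.sqrt (2 * (d : ℝ) + 0.25) := by
      refine Real.lt_sqrt_of_sq_lt ?_
      have : (0 : ℝ) < d := by exact_mod_cast hd
      norm_num
      linarith
    have h2 : (m : ℝ) ≤ 2 := by exact_mod_cast Nat.lt_succ_iff.1 hm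
    have h3 : (m - 2).choose 2 = 0 := Nat.choose_eq_zero_of_lt (by omega)
    rw [h3]
    refine ⟨fun h => ?_, fun h => by omega⟩
    norm_num at h1 h
    linarith
  · rw [show n + 3 - 2 = n + 1 by omega, ← Nat.cast_le (α := ℝ), Nat.cast_choose_two]
    push_cast
    rw [← le_sub_iff_add_le, Real.sqrt_le_left (by have := n.cast_nonneg (α := ℝ); linarith)]
    constructor <;> intro h <;> norm_num at h ⊢ <;> nlinarith

end Main

/-- If `G` is planar with girth at least 12 and `Δ(G) ≥ 7`, then
`τ₂(G) = ⌈√(2Δ(G)+0.25) + 2.5⌉`. -/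
theorem two_tone_girth_twelve {V : Type*} [Fintype V] (G : SimpleGraph V)
    (hG : IsPlanar G) (hgirth : 12 ≤ G.egirth) (hΔ : 7 ≤ maxDeg G) :
    toneChromaticNumber G 2 = ⌈Real.sqrt (2 * (maxDeg G : ℝ) + 0.25) + 2.5⌉₊ := by
  have hiff := fun m => ceil_le_iff (d := maxDeg G) (m := m) (by omega)
  have hdeg := (hiff _).1 le_rfl
  have hk : 7 ≤ ⌈Real.sqrt (2 * (maxDeg G : ℝ) + 0.25) + 2.5⌉₊ := by
    by_contra hlt
    have h6 := (hiff 6).1 (by omega)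
    have : (6 - 2).choose 2 = 6 := rfl
    omega
  obtain ⟨f, hf⟩ := exists_isTwoToneOn hG hgirth hk hdeg Finset.univ
  refine le_antisymm (Nat.sInf_le ⟨f, hf.isTToneColoring⟩) ?_
  refine le_csInf ⟨_, f, hf.isTToneColoring⟩ ?_
  rintro m ⟨f', hf'⟩
  exact (hiff m).2 hf'.maxDeg_le
end

section
/- Let G be a graph and φ a partial 2-tone k-coloring of G. For any uncolored vertex v of G, if C(k − 2|N(v)|, 2) > |N²(v)|, then φ can be extended to a partial 2-tone k-coloring that additionally assigns a 2-set to v (i.e., colors v). -/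
open SimpleGraph

/-- A partial `t`-tone `k`-coloring: each vertex gets a `t`-element subset of `{1,…,k}`
or the empty set, and labels of distinct vertices `v, w` share fewer than `d(v,w)` colors. -/
def IsPartialTToneColoring {V : Type*} (G : SimpleGraph V) (t k : ℕ) (f : V → Finset ℕ) :
    Prop :=
  (∀ v, f v ⊆ Finset.Icc 1 k) ∧ (∀ v, (f v).card = t ∨ f v = ∅) ∧
    ∀ ⦃v w : V⦄, v ≠ w → ((f v ∩ f w).card : ℕ∞) < G.edist v w

/-- Some `t`-subset of `A \ B` avoids any family of fewer than `C(|A| - m, t)` sets when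
`|B| ≤ m`. -/
theorem Finset.exists_powersetCard_sdiff_notMem {α : Type*} [DecidableEq α] {A B : Finset α}
    {t m : ℕ} (hB : B.card ≤ m) {F : Finset (Finset α)}
    (hF : F.card < (A.card - m).choose t) :
    ∃ S ∈ (A \ B).powersetCard t, S ∉ F := by
  refine Finset.exists_mem_notMem_of_card_lt_card (hF.trans_le ?_)
  rw [Finset.card_powersetCard]
  exact Nat.choose_le_choose t (by have := Finset.le_card_sdiff B A; omega)

/-- A partial coloring may be extended at `v` by any `t`-set of colors that is compatible with the
labels of the other vertices. -/
theorem IsPartialTToneColoring.update {V : Type*} [DecidableEq V] {G : SimpleGraph V} {t k : ℕ}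
    {f : V → Finset ℕ} (hf : IsPartialTToneColoring G t k f) {v : V} {S : Finset ℕ}
    (hSk : S ⊆ Finset.Icc 1 k) (hSt : S.card = t)
    (hS : ∀ w, v ≠ w → ((S ∩ f w).card : ℕ∞) < G.edist v w) :
    IsPartialTToneColoring G t k (Function.update f v S) := by
  refine ⟨fun w => ?_, fun w => ?_, fun u w huw => ?_⟩
  · rcases eq_or_ne w v with rfl | hw
    · simpa using hSk
    · simpa [hw] using hf.1 w
  · rcases eq_or_ne w v with rfl | hw
    · simpa using Or.inl hSt
    · simpa [hw] using hf.2.1 w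
  · rcases eq_or_ne u v with rfl | hu
    · simpa [huw.symm] using hS w huw
    · rcases eq_or_ne w v with rfl | hw
      · simpa [hu, Finset.inter_comm, edist_comm] using hS u huw.symm
      · simpa [hu, hw] using hf.2.2 huw

/-- A 2-set is compatible with a label of size at most 2 at another vertex as soon as it is disjoint
from it at distance 1 and different from it at distance 2. -/
theorem card_inter_lt_edist {V : Type*} {G : SimpleGraph V} {v w : V} (hvw : v ≠ w)
    {S T : Finset ℕ} (hS : S.card = 2) (hT : T.card ≤ 2) (hadj : G.Adj v w → Disjoint S T)
    (hne : G.edist v w = 2 → T ≠ S) :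
    ((S ∩ T).card : ℕ∞) < G.edist v w := by
  have hle : (S ∩ T).card ≤ 2 := hS ▸ Finset.card_le_card Finset.inter_subset_left
  have hpos : G.edist v w ≠ 0 := by simpa using hvw
  have hone : G.edist v w = 1 → (S ∩ T).card = 0 := fun h => by
    simpa [Finset.disjoint_iff_inter_eq_empty] using hadj (edist_eq_one_iff_adj.mp h)
  have htwo : G.edist v w = 2 → (S ∩ T).card ≠ 2 := fun h h2 => by
    have hST : S ⊆ T := Finset.inter_eq_left.mp
      (Finset.eq_of_subset_of_card_le Finset.inter_subset_left (by omega))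
    exact hne h (Finset.eq_of_subset_of_card_le hST (by omega)).symm
  generalize G.edist v w = d at *
  induction d with
  | top => exact ENat.natCast_lt_top _
  | coe n =>
    norm_cast at *
    by_contra! hn
    have hn2 : n ≤ 2 := hn.trans hle
    interval_cases n <;> grind

/-- If `φ` is a partial 2-tone `k`-coloring of `G`, `v` is uncolored, and
`C(k - 2|N(v)|, 2) > |N²(v)|`, then `φ` can be extended to color `v`. -/
theorem partial_two_tone_extension {V : Type*} [Fintype V] (G : SimpleGraph V) (k : ℕ)
    (f : V → Finset ℕ) (hf : IsPartialTToneColoring G 2 k f) (v : V) (hv : f v = ∅)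
    (hcount : {w : V | G.edist v w = 2}.ncard <
      (k - 2 * (G.neighborSet v).ncard).choose 2) :
    ∃ g : V → Finset ℕ, IsPartialTToneColoring G 2 k g ∧
      (∀ w : V, w ≠ v → g w = f w) ∧ (g v).card = 2 := by
  classical
  have hcard (w : V) : (f w).card ≤ 2 := by
    rcases hf.2.1 w with h | h <;> simp [h]
  have hB : ((G.neighborFinset v).biUnion f).card ≤ 2 * (G.neighborSet v).ncard := by
    rw [Set.ncard_eq_toFinset_card', mul_comm]
    exact Finset.card_biUnion_le_card_mul _ _ _ fun w _ => hcard w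
  have hF : ({w : V | G.edist v w = 2}.toFinset.image f).card <
      ((Finset.Icc 1 k).card - 2 * (G.neighborSet v).ncard).choose 2 := by
    rw [Nat.card_Icc, Nat.add_sub_cancel]
    exact Finset.card_image_le.trans_lt (by rwa [← Set.ncard_eq_toFinset_card'])
  obtain ⟨S, hS, hSF⟩ := Finset.exists_powersetCard_sdiff_notMem hB hF
  obtain ⟨hSsub, hS2⟩ := Finset.mem_powersetCard.mp hS
  obtain ⟨hSk, hSB⟩ := Finset.subset_sdiff.mp hSsub
  refine ⟨Function.update f v S, hf.update hSk hS2 fun w hvw => ?_,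
    fun w hw => Function.update_of_ne hw _ _, by simpa using hS2⟩
  refine card_inter_lt_edist hvw hS2 (hcard w) (fun h => ?_) (fun h hw => ?_)
  · exact (Finset.disjoint_biUnion_right _ _ _).mp hSB w (by simpa using h)
  · exact hSF (Finset.mem_image.mpr ⟨w, by simpa using h, hw⟩)
end

section
/- For each t ≥ 1, let H_t be the graph formed from K₃ by replacing each edge vw of K₃ with a copy of K_{2,t}, identifying the two vertices of degree t with v and w. Then ⌈√(3Δ(H_t)+0.25) + 0.5⌉ ≤ τ₂(H_t) ≤ ⌈√(3Δ(H_t)+30.25) + 0.5⌉. -/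
open SimpleGraph

/-- The graph `H_t`, formed from `K₃` (on hub vertices `Fin 3`) by replacing each edge `vw`
with a copy of `K_{2,t}`, identifying the two degree-`t` vertices with `v` and `w`:
for each `e : Fin 3`, the `t` vertices `(e, i)` are joined to hubs `e` and `e + 1`. -/
def fatTriangle (t : ℕ) : SimpleGraph (Fin 3 ⊕ Fin 3 × Fin t) :=
  SimpleGraph.fromRel fun x y =>
    match x, y with
    | Sum.inl a, Sum.inr (e, _) => a = e ∨ a = e + 1
    | _, _ => False

theorem isTToneColoring_two_of_injective {V : Type*} {G : SimpleGraph V} {k : ℕ}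
    {f : V → Finset ℕ} (hsub : ∀ v, f v ⊆ Finset.Icc 1 k) (hcard : ∀ v, (f v).card = 2)
    (hinj : Function.Injective f) (hadj : ∀ ⦃v w⦄, G.Adj v w → Disjoint (f v) (f w)) :
    IsTToneColoring G 2 k f := by
  refine ⟨hsub, hcard, fun v w hvw => ?_⟩
  by_cases h : G.Adj v w
  · rw [Finset.disjoint_iff_inter_eq_empty.1 (hadj h)]
    simpa using SimpleGraph.edist_pos_of_ne hvw
  · have hlt : (f v ∩ f w).card < 2 := by
      by_contra! hge
      have h₁ : f v ∩ f w = f v :=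
        Finset.eq_of_subset_of_card_le Finset.inter_subset_left (by rw [hcard]; exact hge)
      have h₂ : f v ∩ f w = f w :=
        Finset.eq_of_subset_of_card_le Finset.inter_subset_right (by rw [hcard]; exact hge)
      exact hvw (hinj (h₁.symm.trans h₂))
    have hpos : 0 < G.edist v w := SimpleGraph.edist_pos_of_ne hvw
    have hone : G.edist v w ≠ 1 := fun h' => h (SimpleGraph.edist_eq_one_iff_adj.1 h')
    have hgt : (1 : ℕ∞) < G.edist v w :=
      lt_of_le_of_ne (Order.one_le_iff_pos.2 hpos) hone.symm
    refine lt_of_le_of_lt ?_ hgt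
    exact_mod_cast Nat.lt_succ_iff.1 hlt

theorem fatTriangle_adj_inl_inr {t : ℕ} {a e : Fin 3} {i : Fin t} :
    (fatTriangle t).Adj (Sum.inl a) (Sum.inr (e, i)) ↔ a = e ∨ a = e + 1 := by
  simp [fatTriangle]

theorem fatTriangle_adj_inr_inl {t : ℕ} {a e : Fin 3} {i : Fin t} :
    (fatTriangle t).Adj (Sum.inr (e, i)) (Sum.inl a) ↔ a = e ∨ a = e + 1 := by
  rw [SimpleGraph.adj_comm, fatTriangle_adj_inl_inr]

theorem fatTriangle_not_adj_inl_inl {t : ℕ} {a b : Fin 3} :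
    ¬ (fatTriangle t).Adj (Sum.inl a) (Sum.inl b) := by
  simp [fatTriangle]

theorem fatTriangle_not_adj_inr_inr {t : ℕ} {p q : Fin 3 × Fin t} :
    ¬ (fatTriangle t).Adj (Sum.inr p) (Sum.inr q) := by
  simp [fatTriangle]

theorem neighborSet_fatTriangle_inl {t : ℕ} (a : Fin 3) :
    (fatTriangle t).neighborSet (Sum.inl a) =
      ((({a, a + 2} : Finset (Fin 3)) ×ˢ (Finset.univ : Finset (Fin t))).map
        Function.Embedding.inr : Finset (Fin 3 ⊕ Fin 3 × Fin t)) := by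
  have key : ∀ a e : Fin 3, a = e ∨ a = e + 1 ↔ e = a ∨ e = a + 2 := by decide
  ext x
  rcases x with b | ⟨e, i⟩
  · simp [fatTriangle_not_adj_inl_inl]
  · simp [fatTriangle_adj_inl_inr, key a e]

theorem neighborSet_fatTriangle_inr {t : ℕ} (e : Fin 3) (i : Fin t) :
    (fatTriangle t).neighborSet (Sum.inr (e, i)) = {Sum.inl e, Sum.inl (e + 1)} := by
  ext x
  rcases x with b | q
  · simp [fatTriangle_adj_inr_inl]
  · simp [fatTriangle_not_adj_inr_inr]

theorem maxDeg_fatTriangle {t : ℕ} (ht : 1 ≤ t) : maxDeg (fatTriangle t) = 2 * t := by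
  have hinl (a : Fin 3) : ((fatTriangle t).neighborSet (Sum.inl a)).ncard = 2 * t := by
    have hne : a ≠ a + 2 := by revert a; decide
    rw [neighborSet_fatTriangle_inl, Set.ncard_coe_finset, Finset.card_map, Finset.card_product,
      Finset.card_pair hne, Finset.card_univ, Fintype.card_fin]
  apply le_antisymm
  · refine Finset.sup_le fun v _ => ?_
    rcases v with a | ⟨e, i⟩
    · exact (hinl a).le
    · rw [neighborSet_fatTriangle_inr]
      exact (Set.ncard_insert_le _ _).trans (by rw [Set.ncard_singleton]; omega)
  · rw [← hinl 0]
    exact Finset.le_sup (f := fun v => ((fatTriangle t).neighborSet v).ncard)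
      (Finset.mem_univ (Sum.inl 0))

theorem edist_fatTriangle_inr_inr_le {t : ℕ} (p q : Fin 3 × Fin t) :
    (fatTriangle t).edist (Sum.inr p) (Sum.inr q) ≤ 2 := by
  obtain ⟨d, i⟩ := p
  obtain ⟨e, j⟩ := q
  obtain ⟨a, had, hae⟩ : ∃ a : Fin 3, (a = d ∨ a = d + 1) ∧ (a = e ∨ a = e + 1) := by
    revert d e; decide
  exact SimpleGraph.edist_le
    (.cons (fatTriangle_adj_inr_inl.2 had) (.cons (fatTriangle_adj_inl_inr.2 hae) .nil))

theorem three_mul_le_choose_of_isTToneColoring {t k : ℕ} {f : Fin 3 ⊕ Fin 3 × Fin t → Finset ℕ}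
    (hf : IsTToneColoring (fatTriangle t) 2 k f) : 3 * t ≤ k.choose 2 := by
  obtain ⟨hsub, hcard, hdist⟩ := hf
  have hinj : Function.Injective fun p => f (Sum.inr p) := by
    intro p q hpq
    by_contra hne
    have h := hdist (fun h => hne (Sum.inr_injective h) :
      (Sum.inr p : Fin 3 ⊕ Fin 3 × Fin t) ≠ Sum.inr q)
    dsimp only at hpq
    rw [hpq, Finset.inter_self, hcard] at h
    exact absurd h (not_lt.2 (edist_fatTriangle_inr_inr_le p q))
  have hmaps : ∀ p ∈ (Finset.univ : Finset (Fin 3 × Fin t)),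
      f (Sum.inr p) ∈ (Finset.Icc 1 k).powersetCard 2 := fun p _ =>
    Finset.mem_powersetCard.2 ⟨hsub _, hcard _⟩
  simpa using Finset.card_le_card_of_injOn _ hmaps hinj.injOn

/-- The color pair given to the hub `e`. -/
def hubLabel (e : Fin 3) : Finset ℕ := {2 * (e : ℕ) + 1, 2 * (e : ℕ) + 2}

/-- The color pairs using only colors from `7` on or from the hub `e + 2`, other than the label of
that hub. -/
def middleLabels (j : ℕ) (e : Fin 3) : Finset (Finset ℕ) :=
  ((hubLabel (e + 2) ∪ Finset.Icc 7 (j + 6)).powersetCard 2).erase (hubLabel (e + 2))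

theorem card_hubLabel (e : Fin 3) : (hubLabel e).card = 2 := by
  revert e; decide

theorem hubLabel_subset (e : Fin 3) : hubLabel e ⊆ Finset.Icc 1 6 := by
  revert e; decide

theorem disjoint_hubLabel {d e : Fin 3} (h : d ≠ e) : Disjoint (hubLabel d) (hubLabel e) := by
  revert d e; decide

theorem disjoint_hubLabel_Icc (j : ℕ) (e : Fin 3) :
    Disjoint (hubLabel e) (Finset.Icc 7 (j + 6)) :=
  Finset.disjoint_left.2 fun x hx hx' => by
    have := Finset.mem_Icc.1 (hubLabel_subset e hx)
    have := Finset.mem_Icc.1 hx'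
    omega

theorem powersetCard_Icc_subset_middleLabels (j : ℕ) (e : Fin 3) :
    (Finset.Icc 7 (j + 6)).powersetCard 2 ⊆ middleLabels j e := by
  intro s hs
  rw [middleLabels, Finset.mem_erase]
  refine ⟨?_, Finset.powersetCard_mono Finset.subset_union_right hs⟩
  rintro rfl
  have h := Finset.disjoint_self_iff_empty _ |>.1
    ((disjoint_hubLabel_Icc j (e + 2)).mono_right (Finset.mem_powersetCard.1 hs).1)
  have := card_hubLabel (e + 2)
  simp [h] at this

theorem card_middleLabels (j : ℕ) (e : Fin 3) :
    (middleLabels j e).card = j.choose 2 + 2 * j := by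
  have hmem : hubLabel (e + 2) ∈ (hubLabel (e + 2) ∪ Finset.Icc 7 (j + 6)).powersetCard 2 :=
    Finset.mem_powersetCard.2 ⟨Finset.subset_union_left, card_hubLabel _⟩
  rw [middleLabels, Finset.card_erase_of_mem hmem, Finset.card_powersetCard,
    Finset.card_union_of_disjoint (disjoint_hubLabel_Icc j _), card_hubLabel, Nat.card_Icc,
    show 2 + (j + 6 + 1 - 7) = j + 1 + 1 by omega, Nat.choose_succ_succ' (j + 1) 1,
    Nat.choose_succ_succ' j 1]
  simp
  omega

theorem card_middleLabels_sdiff (j : ℕ) (e : Fin 3) :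
    (middleLabels j e \ (Finset.Icc 7 (j + 6)).powersetCard 2).card = 2 * j := by
  rw [Finset.card_sdiff_of_subset (powersetCard_Icc_subset_middleLabels j e), card_middleLabels,
    Finset.card_powersetCard, Nat.card_Icc]
  simp

theorem disjoint_middleLabels_sdiff (j : ℕ) {d e : Fin 3} (h : d ≠ e) :
    Disjoint (middleLabels j d \ (Finset.Icc 7 (j + 6)).powersetCard 2)
      (middleLabels j e \ (Finset.Icc 7 (j + 6)).powersetCard 2) := by
  refine Finset.disjoint_left.2 fun s hd he => ?_
  simp only [middleLabels, Finset.mem_sdiff, Finset.mem_erase, Finset.mem_powersetCard] at hd he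
  refine hd.2 ⟨fun x hx => ?_, hd.1.2.2⟩
  have hdis := disjoint_hubLabel (show d + 2 ≠ e + 2 from fun h' => h (add_right_cancel h'))
  rcases Finset.mem_union.1 (hd.1.2.1 hx) with h₁ | h₁
  · rcases Finset.mem_union.1 (he.1.2.1 hx) with h₂ | h₂
    · exact absurd h₂ (Finset.disjoint_left.1 hdis h₁)
    · exact h₂
  · exact h₁

theorem le_card_biUnion_middleLabels (j : ℕ) {E : Finset (Fin 3)} (hE : E.Nonempty) :
    j.choose 2 + E.card * (2 * j) ≤ (E.biUnion (middleLabels j)).card := by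
  set F := (Finset.Icc 7 (j + 6)).powersetCard 2 with hF
  have hdis : Disjoint F (E.biUnion fun e => middleLabels j e \ F) := by
    rw [Finset.disjoint_biUnion_right]
    exact fun e _ => Finset.disjoint_sdiff
  have hcard : (F ∪ E.biUnion fun e => middleLabels j e \ F).card =
      j.choose 2 + E.card * (2 * j) := by
    rw [Finset.card_union_of_disjoint hdis,
      Finset.card_biUnion fun d _ e _ h => disjoint_middleLabels_sdiff j h,
      Finset.sum_congr rfl fun e _ => card_middleLabels_sdiff j e, Finset.sum_const, smul_eq_mul,
      hF, Finset.card_powersetCard, Nat.card_Icc]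
    simp
  rw [← hcard]
  refine Finset.card_le_card (Finset.union_subset ?_ ?_)
  · obtain ⟨e, he⟩ := hE
    exact (powersetCard_Icc_subset_middleLabels j e).trans
      (Finset.subset_biUnion_of_mem (middleLabels j) he)
  · exact Finset.biUnion_mono fun e _ => Finset.sdiff_subset

theorem exists_injective_middleLabels {t j : ℕ} (h : 3 * t ≤ j.choose 2 + 6 * j) :
    ∃ g : Fin 3 × Fin t → Finset ℕ,
      Function.Injective g ∧ ∀ p, g p ∈ middleLabels j p.1 := by
  refine (Finset.all_card_le_biUnion_card_iff_exists_injective _).1 fun s => ?_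
  rcases s.eq_empty_or_nonempty with rfl | hs
  · simp
  set E := s.image Prod.fst with hEdef
  have hsE : s.card ≤ E.card * t := by
    calc s.card ≤ (E ×ˢ (Finset.univ : Finset (Fin t))).card :=
          Finset.card_le_card fun p hp => Finset.mem_product.2
            ⟨Finset.mem_image_of_mem _ hp, Finset.mem_univ _⟩
      _ = E.card * t := by simp
  have hE3 : E.card ≤ 3 := by simpa using E.card_le_univ
  have hunion : s.biUnion (fun p => middleLabels j p.1) = E.biUnion (middleLabels j) := by
    rw [hEdef, Finset.image_biUnion]
  rw [hunion]
  refine (hsE.trans ?_).trans (le_card_biUnion_middleLabels j (hs.image _))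
  generalize E.card = n at hE3
  interval_cases n <;> omega

theorem exists_isTToneColoring_fatTriangle {t j : ℕ} (h : 3 * t ≤ j.choose 2 + 6 * j) :
    ∃ f, IsTToneColoring (fatTriangle t) 2 (j + 6) f := by
  obtain ⟨g, hg, hmem⟩ := exists_injective_middleLabels h
  have hmem' (p) : g p ≠ hubLabel (p.1 + 2) ∧
      g p ⊆ hubLabel (p.1 + 2) ∪ Finset.Icc 7 (j + 6) ∧ (g p).card = 2 := by
    simpa [middleLabels] using hmem p
  have hhub (a : Fin 3) : hubLabel a ⊆ Finset.Icc 1 (j + 6) :=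
    (hubLabel_subset a).trans (Finset.Icc_subset_Icc_right (by omega))
  have hdis {a : Fin 3} {p : Fin 3 × Fin t} (ha : a ≠ p.1 + 2) :
      Disjoint (hubLabel a) (g p) :=
    (Finset.disjoint_union_right.2 ⟨disjoint_hubLabel ha, disjoint_hubLabel_Icc j a⟩).mono_right
      (hmem' p).2.1
  have hne_of_disjoint {a : Fin 3} {s : Finset ℕ} (hd : Disjoint (hubLabel a) s) :
      hubLabel a ≠ s := by
    rintro rfl
    have := card_hubLabel a
    simp [(Finset.disjoint_self_iff_empty _).1 hd] at this
  have hne (a : Fin 3) (p : Fin 3 × Fin t) : hubLabel a ≠ g p := by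
    by_cases ha : a = p.1 + 2
    · exact ha ▸ (hmem' p).1.symm
    · exact hne_of_disjoint (hdis ha)
  have hnot : ∀ a e : Fin 3, a = e ∨ a = e + 1 → a ≠ e + 2 := by decide
  refine ⟨Sum.elim hubLabel g, isTToneColoring_two_of_injective ?_ ?_ ?_ ?_⟩
  · rintro (a | p)
    · exact hhub a
    · exact (hmem' p).2.1.trans
        (Finset.union_subset (hhub _) (Finset.Icc_subset_Icc_left (by omega)))
  · rintro (a | p)
    · exact card_hubLabel a
    · exact (hmem' p).2.2
  · refine Function.Injective.sumElim (fun a b hab => ?_) hg hne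
    by_contra hn
    exact hne_of_disjoint (disjoint_hubLabel hn) hab
  · rintro (a | ⟨e, i⟩) (b | ⟨d, l⟩) hadj
    · exact absurd hadj fatTriangle_not_adj_inl_inl
    · exact hdis (hnot _ _ (fatTriangle_adj_inl_inr.1 hadj))
    · exact (hdis (p := (e, i)) (hnot _ _ (fatTriangle_adj_inr_inl.1 hadj))).symm
    · exact absurd hadj fatTriangle_not_adj_inr_inr

theorem exists_isTToneColoring_ceil (t : ℕ) (ht : 1 ≤ t) :
    ∃ f, IsTToneColoring (fatTriangle t) 2 ⌈Real.sqrt (6 * (t : ℝ) + 30.25) + 0.5⌉₊ f := by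
  set k := ⌈Real.sqrt (6 * (t : ℝ) + 30.25) + 0.5⌉₊
  have ht' : (1 : ℝ) ≤ t := by exact_mod_cast ht
  have hk : Real.sqrt (6 * (t : ℝ) + 30.25) + 0.5 ≤ k := Nat.le_ceil _
  have hsq := Real.sq_sqrt (show (0 : ℝ) ≤ 6 * (t : ℝ) + 30.25 by positivity)
  have h6 : (5.5 : ℝ) ≤ Real.sqrt (6 * (t : ℝ) + 30.25) := Real.le_sqrt_of_sq_le (by linarith)
  have h6k : 6 ≤ k := by
    have : (6 : ℝ) ≤ k := by linarith
    exact_mod_cast this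
  obtain ⟨j, hj⟩ := Nat.exists_eq_add_of_le' h6k
  rw [hj] at hk ⊢
  push_cast at hk
  refine exists_isTToneColoring_fatTriangle ?_
  have hcast : (3 * t : ℝ) ≤ j.choose 2 + 6 * j := by
    rw [Nat.cast_choose_two]
    nlinarith
  exact_mod_cast hcast

/-- For every `t ≥ 1`,
`⌈√(3Δ(H_t)+0.25) + 0.5⌉ ≤ τ₂(H_t) ≤ ⌈√(3Δ(H_t)+30.25) + 0.5⌉`. -/
theorem two_tone_fatTriangle (t : ℕ) (ht : 1 ≤ t) :
    ⌈Real.sqrt (3 * (maxDeg (fatTriangle t) : ℝ) + 0.25) + 0.5⌉₊ ≤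
        toneChromaticNumber (fatTriangle t) 2 ∧
      toneChromaticNumber (fatTriangle t) 2 ≤
        ⌈Real.sqrt (3 * (maxDeg (fatTriangle t) : ℝ) + 30.25) + 0.5⌉₊ := by
  have hdeg : 3 * (maxDeg (fatTriangle t) : ℝ) = 6 * t := by
    rw [maxDeg_fatTriangle ht]
    push_cast
    ring
  rw [hdeg]
  have hex := exists_isTToneColoring_ceil t ht
  refine ⟨?_, Nat.sInf_le hex⟩
  obtain ⟨f, hf⟩ :
      ∃ f, IsTToneColoring (fatTriangle t) 2 (toneChromaticNumber (fatTriangle t) 2) f :=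
    Nat.sInf_mem (s := {k | ∃ f, IsTToneColoring (fatTriangle t) 2 k f}) ⟨_, hex⟩
  have hle := three_mul_le_choose_of_isTToneColoring hf
  generalize toneChromaticNumber (fatTriangle t) 2 = k at hle
  have hk : 1 ≤ k := by
    by_contra! h0
    rw [Nat.lt_one_iff.1 h0, Nat.choose_eq_zero_of_lt (by norm_num)] at hle
    omega
  have hk' : (1 : ℝ) ≤ k := by exact_mod_cast hk
  have hcast : (3 * t : ℝ) ≤ (k.choose 2 : ℕ) := by exact_mod_cast hle
  rw [Nat.cast_choose_two] at hcast
  refine Nat.ceil_le.2 ?_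
  have : Real.sqrt (6 * (t : ℝ) + 0.25) ≤ k - 0.5 :=
    Real.sqrt_le_iff.2 ⟨by linarith, by nlinarith⟩
  linarith
end

section
/- For every n ≥ 3, the 3-tone chromatic number of the cycle C_n satisfies: τ₃(C_n) = 10 if n ∈ {4,5}; τ₃(C_n) = 9 if n ∈ {3,7,10,13}; and τ₃(C_n) = 8 otherwise. -/
open SimpleGraph

namespace ToneCycle

/-- `g 0, …, g (n - 1)` is a cyclic sequence of triples, continued periodically for three more
terms, whose entries at distance `d ∈ {1, 2, 3}` share fewer than `d` elements. -/
def IsToneWalk (k n : ℕ) (g : ℕ → Finset ℕ) : Prop :=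
  (∀ i < 3, g (n + i) = g i) ∧
    ∀ i < n, g i ⊆ Finset.Icc 1 k ∧ (g i).card = 3 ∧ ∀ d < 3, (g i ∩ g (i + (d + 1))).card < d + 1

instance (k n : ℕ) (g : ℕ → Finset ℕ) : Decidable (IsToneWalk k n g) := by
  unfold IsToneWalk; infer_instance

lemma IsToneWalk.append {k m n : ℕ} {g h : ℕ → Finset ℕ} (hg : IsToneWalk k m g)
    (hh : IsToneWalk k n h) (hgh : ∀ i < 3, g i = h i) (hm : 3 ≤ m) :
    IsToneWalk k (m + n) (fun i => if i < m then g i else h (i - m)) := by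
  have e1 : ∀ i < m + 3, (if i < m then g i else h (i - m)) = g i := by
    intro i hi
    split_ifs with him
    · rfl
    · rw [← hgh _ (by omega), ← hg.1 _ (by omega)]
      congr 1; omega
  have e2 : ∀ i, (if m + i < m then g (m + i) else h (m + i - m)) = h i := fun i => by simp
  refine ⟨fun i hi => ?_, fun i hi => ?_⟩
  · simp only [add_assoc, e2]
    rw [hh.1 i hi, e1 i (by omega), hgh i hi]
  · by_cases him : i < m
    · simp only [e1 i (by omega)]
      refine ⟨(hg.2 i him).1, (hg.2 i him).2.1, fun d hd => ?_⟩
      rw [e1 (i + (d + 1)) (by omega)]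
      exact (hg.2 i him).2.2 d hd
    · obtain ⟨j, rfl⟩ := Nat.exists_eq_add_of_le (not_lt.1 him)
      simp only [add_assoc, e2]
      exact hh.2 j (by omega)

lemma exists_int_of_walk {n : ℕ} {v w : Fin n} (p : (cycleGraph n).Walk v w) :
    ∃ d : ℤ, |d| ≤ p.length ∧ (n : ℤ) ∣ (w : ℤ) - v - d := by
  induction p with
  | nil => exact ⟨0, by simp⟩
  | @cons a b c hab q ih =>
    obtain ⟨d, hd, hdvd⟩ := ih
    have key : ∃ e : ℤ, |e| ≤ 1 ∧ (n : ℤ) ∣ (b : ℤ) - a - e := by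
      rw [cycleGraph_adj', Fin.sub_def, Fin.sub_def] at hab
      have ha := a.isLt
      have hb := b.isLt
      rcases hab with h | h
      · refine ⟨-1, by simp, ?_⟩
        have h' := Nat.div_add_mod (n - b.val + a.val) n
        simp only at h
        rw [h] at h'
        refine ⟨1 - ((n - b.val + a.val) / n : ℕ), ?_⟩
        zify [hb.le] at h' ⊢
        linarith
      · refine ⟨1, by simp, ?_⟩
        have h' := Nat.div_add_mod (n - a.val + b.val) n
        simp only at h
        rw [h] at h'
        refine ⟨((n - a.val + b.val) / n : ℕ) - 1, ?_⟩
        zify [ha.le] at h' ⊢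
        linarith
    obtain ⟨e, he, hedvd⟩ := key
    refine ⟨e + d, ?_, ?_⟩
    · rw [Walk.length_cons]
      push_cast
      linarith [abs_add_le e d]
    · rw [show (c : ℤ) - a - (e + d) = (c - b - d) + (b - a - e) by ring]
      exact dvd_add hdvd hedvd

lemma IsToneWalk.exists_coloring {k n : ℕ} {g : ℕ → Finset ℕ} (hg : IsToneWalk k n g)
    (hn : 3 ≤ n) : ∃ f, IsTToneColoring (cycleGraph n) 3 k f := by
  have hstep : ∀ v w : Fin n, ∀ d < 3, (n : ℤ) ∣ (w : ℤ) - v - (d + 1 : ℕ) →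
      (g v ∩ g w).card < d + 1 := by
    rintro ⟨v, hv⟩ ⟨w, hw⟩ d hd hdvd
    have hlt := (hg.2 v hv).2.2 d hd
    suffices g (v + (d + 1)) = g w by rwa [this] at hlt
    simp only at hdvd
    by_cases hvd : v + (d + 1) < n
    · have := Int.eq_zero_of_abs_lt_dvd hdvd (by rw [abs_lt]; constructor <;> push_cast <;> omega)
      congr 1; omega
    · have := Int.eq_zero_of_abs_lt_dvd (dvd_add_self_right.2 hdvd)
        (by rw [abs_lt]; constructor <;> push_cast <;> omega)
      rw [← hg.1 w (by omega)]
      congr 1; omega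
  refine ⟨fun v => g v, fun v => (hg.2 v v.isLt).1, fun v => (hg.2 v v.isLt).2.1, ?_⟩
  intro v w hvw
  by_contra! hle
  obtain ⟨p, hp⟩ := exists_walk_of_edist_ne_top (ne_top_of_le_ne_top (ENat.natCast_ne_top _) hle)
  rw [← hp, Nat.cast_le] at hle
  have h3 : (g v ∩ g w).card ≤ 3 :=
    (Finset.card_le_card Finset.inter_subset_left).trans (hg.2 v v.isLt).2.1.le
  obtain ⟨d, hd, hdvd⟩ := exists_int_of_walk p
  have hd0 : d ≠ 0 := by
    rintro rfl
    have := Int.eq_zero_of_abs_lt_dvd hdvd (by rw [abs_lt]; constructor <;> omega)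
    exact hvw (Fin.ext (by omega))
  have hcast : ((d.natAbs - 1 + 1 : ℕ) : ℤ) = |d| := by
    rw [Nat.sub_add_cancel (by omega), Int.natCast_natAbs]
  rcases abs_choice d with hs | hs
  · have := hstep v w (d.natAbs - 1) (by omega) (by rwa [hcast, hs])
    omega
  · have := hstep w v (d.natAbs - 1) (by omega) (by
      rw [hcast, hs, show (v : ℤ) - w - -d = -(w - v - d) by ring]
      exact dvd_neg.2 hdvd)
    rw [Finset.inter_comm] at this
    omega

lemma exists_coloring_of_list {k : ℕ} (L : List (Finset ℕ)) (hL : 3 ≤ L.length)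
    (h : IsToneWalk k L.length (fun i => L.getD (i % L.length) ∅)) :
    ∃ f, IsTToneColoring (cycleGraph L.length) 3 k f :=
  h.exists_coloring hL

/-- Closed tone walks with eight colors, sharing their first three entries. -/
def HasBasedWalk (n : ℕ) : Prop :=
  ∃ g, IsToneWalk 8 n g ∧ g 0 = {1, 2, 3} ∧ g 1 = {4, 5, 6} ∧ g 2 = {1, 7, 8}

lemma HasBasedWalk.add {m n : ℕ} (hm : HasBasedWalk m) (hn : HasBasedWalk n) (h3 : 3 ≤ m) :
    HasBasedWalk (m + n) := by
  obtain ⟨g, hg, g0, g1, g2⟩ := hm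
  obtain ⟨h, hh, h0, h1, h2⟩ := hn
  refine ⟨_, hg.append hh ?_ h3, ?_, ?_, ?_⟩
  · intro i hi
    interval_cases i
    · rw [g0, h0]
    · rw [g1, h1]
    · rw [g2, h2]
  · rwa [if_pos (by omega)]
  · rwa [if_pos (by omega)]
  · rwa [if_pos (by omega)]

lemma hasBasedWalk_six : HasBasedWalk 6 :=
  ⟨fun i => [{1, 2, 3}, {4, 5, 6}, {1, 7, 8}, {2, 3, 4}, {1, 5, 6}, {4, 7, 8}].getD (i % 6) ∅,
    by decide, rfl, rfl, rfl⟩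

lemma hasBasedWalk_eight : HasBasedWalk 8 :=
  ⟨fun i => [{1, 2, 3}, {4, 5, 6}, {1, 7, 8}, {2, 3, 4}, {5, 6, 7}, {1, 2, 8}, {3, 4, 5},
    {6, 7, 8}].getD (i % 8) ∅, by decide, rfl, rfl, rfl⟩

lemma hasBasedWalk_nine : HasBasedWalk 9 :=
  ⟨fun i => [{1, 2, 3}, {4, 5, 6}, {1, 7, 8}, {2, 3, 4}, {1, 5, 6}, {2, 7, 8}, {1, 3, 4},
    {2, 5, 6}, {4, 7, 8}].getD (i % 9) ∅, by decide, rfl, rfl, rfl⟩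

lemma hasBasedWalk_eleven : HasBasedWalk 11 :=
  ⟨fun i => [{1, 2, 3}, {4, 5, 6}, {1, 7, 8}, {2, 3, 4}, {1, 5, 6}, {2, 7, 8}, {1, 3, 4},
    {5, 6, 7}, {1, 2, 8}, {3, 4, 5}, {6, 7, 8}].getD (i % 11) ∅, by decide, rfl, rfl, rfl⟩

lemma hasBasedWalk (n : ℕ) (hn : 6 ≤ n) (h7 : n ≠ 7) (h10 : n ≠ 10) (h13 : n ≠ 13) :
    HasBasedWalk n := by
  induction n using Nat.strong_induction_on with
  | _ n ih =>
    by_cases hlarge : 20 ≤ n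
    · have := hasBasedWalk_six.add
        (ih (n - 6) (by omega) (by omega) (by omega) (by omega) (by omega)) (by norm_num)
      rwa [Nat.add_sub_cancel' (by omega)] at this
    · have h6 := hasBasedWalk_six
      have h8 := hasBasedWalk_eight
      have h9 := hasBasedWalk_nine
      have h11 := hasBasedWalk_eleven
      interval_cases n
      · exact h6
      · contradiction
      · exact h8
      · exact h9
      · contradiction
      · exact h11
      · exact h6.add h6 (by norm_num)
      · contradiction
      · exact h6.add h8 (by norm_num)
      · exact h6.add h9 (by norm_num)
      · exact h8.add h8 (by norm_num)
      · exact h6.add h11 (by norm_num)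
      · exact h9.add h9 (by norm_num)
      · exact h8.add h11 (by norm_num)

lemma exists_coloring_three : ∃ f, IsTToneColoring (cycleGraph 3) 3 9 f := by
  refine ⟨![{1, 2, 3}, {4, 5, 6}, {7, 8, 9}], by decide, by decide, fun v w hvw => ?_⟩
  have : (![{1, 2, 3}, {4, 5, 6}, {7, 8, 9}] v ∩
      ![{1, 2, 3}, {4, 5, 6}, {7, 8, 9}] w : Finset ℕ).card = 0 := by
    revert v w; decide
  rw [this]
  exact edist_pos_of_ne hvw

lemma exists_coloring_four : ∃ f, IsTToneColoring (cycleGraph 4) 3 10 f :=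
  exists_coloring_of_list [{1, 2, 3}, {4, 5, 6}, {1, 7, 8}, {4, 9, 10}] (by decide) (by decide)

lemma exists_coloring_five : ∃ f, IsTToneColoring (cycleGraph 5) 3 10 f :=
  exists_coloring_of_list [{1, 2, 3}, {4, 5, 6}, {1, 7, 8}, {2, 4, 9}, {5, 7, 10}]
    (by decide) (by decide)

lemma exists_coloring_seven : ∃ f, IsTToneColoring (cycleGraph 7) 3 9 f :=
  exists_coloring_of_list [{1, 2, 3}, {4, 5, 6}, {1, 7, 8}, {2, 3, 4}, {1, 5, 9}, {2, 6, 7},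
    {4, 8, 9}] (by decide) (by decide)

lemma exists_coloring_ten : ∃ f, IsTToneColoring (cycleGraph 10) 3 9 f :=
  exists_coloring_of_list [{1, 2, 3}, {4, 5, 6}, {1, 7, 8}, {2, 3, 4}, {1, 5, 6}, {2, 7, 8},
    {1, 3, 4}, {2, 5, 9}, {1, 6, 7}, {4, 8, 9}] (by decide) (by decide)

lemma exists_coloring_thirteen : ∃ f, IsTToneColoring (cycleGraph 13) 3 9 f :=
  exists_coloring_of_list [{1, 2, 3}, {4, 5, 6}, {1, 7, 8}, {2, 3, 4}, {1, 5, 6}, {2, 7, 8},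
    {1, 3, 4}, {2, 5, 6}, {1, 7, 8}, {2, 3, 4}, {1, 5, 9}, {2, 6, 7}, {4, 8, 9}]
    (by decide) (by decide)

section LowerBound

variable {V : Type*} {G : SimpleGraph V} {k : ℕ} {f : V → Finset ℕ}

lemma disjoint_of_adj {t : ℕ} (hf : IsTToneColoring G t k f) {v w : V} (h : G.Adj v w) :
    Disjoint (f v) (f w) := by
  have := hf.2.2 h.ne
  rw [edist_eq_one_iff_adj.2 h, Order.lt_one_iff] at this
  rw [Finset.disjoint_iff_inter_eq_empty]
  simpa using this

lemma card_inter_le_one {t : ℕ} (hf : IsTToneColoring G t k f) {u v w : V} (huv : G.Adj u v)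
    (hvw : G.Adj v w) (h : u ≠ w) : (f u ∩ f w).card ≤ 1 := by
  have h1 := hf.2.2 h
  have h2 : G.edist u w ≤ 2 := by simpa using edist_le (Walk.cons huv (Walk.cons hvw .nil))
  have h3 : (f u ∩ f w).card < 2 := by exact_mod_cast h1.trans_le h2
  omega

lemma sum_indicator {s : Finset ℕ} (hs : s ⊆ Finset.Icc 1 k) :
    ∑ c ∈ Finset.Icc 1 k, (if c ∈ s then 1 else 0) = s.card := by
  rw [Finset.sum_boole, Finset.filter_mem_eq_inter, Finset.inter_eq_right.2 hs, Nat.cast_id]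

lemma sum_indicator_inter {t : ℕ} (hf : IsTToneColoring G t k f) (v w : V) :
    ∑ c ∈ Finset.Icc 1 k, (if c ∈ f v ∩ f w then 1 else 0) = (f v ∩ f w).card :=
  sum_indicator (Finset.inter_subset_left.trans (hf.1 v))

lemma indicator_path_le {t : ℕ} (hf : IsTToneColoring G t k f) {u v w : V} (huv : G.Adj u v)
    (hvw : G.Adj v w) (c : ℕ) :
    ((if c ∈ f u then 1 else 0) + (if c ∈ f v then 1 else 0) + if c ∈ f w then 1 else 0) ≤
      1 + if c ∈ f u ∩ f w then 1 else 0 := by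
  have h1 : c ∈ f u → c ∉ f v := fun h => Finset.disjoint_left.1 (disjoint_of_adj hf huv) h
  have h2 : c ∈ f v → c ∉ f w := fun h => Finset.disjoint_left.1 (disjoint_of_adj hf hvw) h
  simp only [Finset.mem_inter]
  split_ifs <;> simp_all

lemma sum_indicator_path (hf : IsTToneColoring G 3 k f) (u v w : V) :
    ∑ c ∈ Finset.Icc 1 k, ((if c ∈ f u then 1 else 0) + (if c ∈ f v then 1 else 0) +
      if c ∈ f w then 1 else 0) = 9 := by
  rw [Finset.sum_add_distrib, Finset.sum_add_distrib, sum_indicator (hf.1 u),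
    sum_indicator (hf.1 v), sum_indicator (hf.1 w), hf.2.1, hf.2.1, hf.2.1]

lemma sum_one_add_indicator_inter (hf : IsTToneColoring G 3 k f) (u w : V) :
    ∑ c ∈ Finset.Icc 1 k, (1 + if c ∈ f u ∩ f w then 1 else 0) = k + (f u ∩ f w).card := by
  rw [Finset.sum_add_distrib, sum_indicator_inter hf]
  simp

lemma eight_le_of_path (hf : IsTToneColoring G 3 k f) {u v w : V} (huv : G.Adj u v)
    (hvw : G.Adj v w) (h : u ≠ w) : 8 ≤ k := by
  have h1 := Finset.sum_le_sum fun c (_ : c ∈ Finset.Icc 1 k) => indicator_path_le hf huv hvw c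
  rw [sum_indicator_path hf, sum_one_add_indicator_inter hf] at h1
  have := card_inter_le_one hf huv hvw h
  omega

lemma indicator_path_eq (hf : IsTToneColoring G 3 8 f) {u v w : V} (huv : G.Adj u v)
    (hvw : G.Adj v w) (h : u ≠ w) {c : ℕ} (hc : c ∈ Finset.Icc 1 8) :
    ((if c ∈ f u then 1 else 0) + (if c ∈ f v then 1 else 0) + if c ∈ f w then 1 else 0) =
      1 + if c ∈ f u ∩ f w then 1 else 0 := by
  have hle : ∀ c ∈ Finset.Icc 1 8, _ := fun c _ => indicator_path_le hf huv hvw c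
  refine (Finset.sum_eq_sum_iff_of_le hle).1 ?_ c hc
  have h1 := Finset.sum_le_sum hle
  rw [sum_indicator_path hf, sum_one_add_indicator_inter hf] at h1 ⊢
  have := card_inter_le_one hf huv hvw h
  omega

end LowerBound

section Cycle

variable {m k : ℕ} {f : Fin (m + 3) → Finset ℕ}

lemma adj_add_one (v : Fin (m + 3)) : (cycleGraph (m + 3)).Adj v (v + 1) := by
  simp [cycleGraph_adj]

lemma ne_add_one_add_one (v : Fin (m + 3)) : v ≠ v + 1 + 1 := by
  rw [add_assoc, ne_eq, left_eq_add, Fin.ext_iff]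
  simp [Fin.val_add, Nat.mod_eq_of_lt (show 2 < m + 3 by omega)]

lemma eight_le (hf : IsTToneColoring (cycleGraph (m + 3)) 3 k f) : 8 ≤ k :=
  eight_le_of_path hf (adj_add_one 0) (adj_add_one _) (ne_add_one_add_one 0)

lemma sixteen_le_of_mod_three (hf : IsTToneColoring (cycleGraph (m + 3)) 3 8 f)
    (hm : m % 3 = 1) : 16 ≤ m + 3 := by
  have hshift : ∀ F : Fin (m + 3) → ℕ, ∑ v, F (v + 1) = ∑ v, F v := fun F =>
    Equiv.sum_comp (Equiv.addRight 1) F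
  have hcolor : ∀ c ∈ Finset.Icc 1 8,
      2 ≤ ∑ v, if c ∈ f v ∩ f (v + 1 + 1) then 1 else 0 := by
    intro c hc
    have h := Finset.sum_congr rfl fun v (_ : v ∈ Finset.univ) =>
      indicator_path_eq hf (adj_add_one v) (adj_add_one _) (ne_add_one_add_one v) hc
    have h1 := hshift fun v => if c ∈ f v then 1 else 0
    have h2 := hshift fun v => if c ∈ f (v + 1) then 1 else 0
    rw [Finset.sum_add_distrib, Finset.sum_add_distrib, Finset.sum_add_distrib, h2, h1] at h
    simp only [Finset.sum_const, Finset.card_univ, Fintype.card_fin, smul_eq_mul, mul_one] at h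
    omega
  have hlow := Finset.sum_le_sum hcolor
  rw [Finset.sum_comm] at hlow
  have hup := Finset.sum_le_sum fun v (_ : v ∈ Finset.univ) =>
    card_inter_le_one hf (adj_add_one v) (adj_add_one _) (ne_add_one_add_one v)
  simp only [sum_indicator_inter hf] at hlow
  simp only [Finset.sum_const, Finset.card_univ, Fintype.card_fin, Nat.card_Icc,
    smul_eq_mul] at hlow hup
  omega

lemma nine_le_of_mod_three (hf : IsTToneColoring (cycleGraph (m + 3)) 3 k f)
    (hm : m % 3 = 1) (hlt : m < 13) : 9 ≤ k := by
  have h8 := eight_le hf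
  by_contra! h
  obtain rfl : k = 8 := by omega
  have := sixteen_le_of_mod_three hf hm
  omega

lemma nine_le_of_triangle {f : Fin 3 → Finset ℕ}
    (hf : IsTToneColoring (cycleGraph 3) 3 k f) : 9 ≤ k := by
  have hle : ∀ c ∈ Finset.Icc 1 k, ((if c ∈ f 0 then 1 else 0) + (if c ∈ f 1 then 1 else 0) +
      if c ∈ f 2 then 1 else 0) ≤ 1 := by
    intro c _
    have h1 : c ∈ f 0 → c ∉ f 1 := fun h =>
      Finset.disjoint_left.1 (disjoint_of_adj hf (by decide)) h
    have h2 : c ∈ f 1 → c ∉ f 2 := fun h =>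
      Finset.disjoint_left.1 (disjoint_of_adj hf (by decide)) h
    have h3 : c ∈ f 0 → c ∉ f 2 := fun h =>
      Finset.disjoint_left.1 (disjoint_of_adj hf (by decide)) h
    split_ifs <;> simp_all
  simpa [sum_indicator_path hf] using Finset.sum_le_sum hle

lemma ten_le_of_four {f : Fin 4 → Finset ℕ}
    (hf : IsTToneColoring (cycleGraph 4) 3 k f) : 10 ≤ k := by
  have hle : ∀ c ∈ Finset.Icc 1 k, ∑ v, (if c ∈ f v then 1 else 0) ≤
      1 + (if c ∈ f 0 ∩ f 2 then 1 else 0) + (if c ∈ f 1 ∩ f 3 then 1 else 0) := by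
    intro c _
    have h : ∀ v : Fin 4, c ∈ f v → c ∉ f (v + 1) := fun v hv =>
      Finset.disjoint_left.1 (disjoint_of_adj hf (adj_add_one v)) hv
    have h0 := h 0
    have h1 := h 1
    have h2 := h 2
    have h3 := h 3
    simp only [Fin.sum_univ_four, Finset.mem_inter, Fin.reduceAdd] at *
    split_ifs <;> simp_all
  have h := Finset.sum_le_sum hle
  have hi := fun v : Fin 4 =>
    card_inter_le_one hf (adj_add_one v) (adj_add_one _) (ne_add_one_add_one v)
  have h0 := hi 0
  have h1 := hi 1
  rw [Finset.sum_comm] at h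
  simp only [Finset.sum_add_distrib, sum_indicator_inter hf, sum_indicator (hf.1 _), hf.2.1,
    Finset.sum_const, Finset.card_univ, Fintype.card_fin, Nat.card_Icc, smul_eq_mul] at h
  simp only [Fin.reduceAdd] at h0 h1
  omega

lemma ten_le_of_five {f : Fin 5 → Finset ℕ}
    (hf : IsTToneColoring (cycleGraph 5) 3 k f) : 10 ≤ k := by
  have hle : ∀ c ∈ Finset.Icc 1 k, ∑ v, (if c ∈ f v then 1 else 0) ≤
      1 + ∑ v, (if c ∈ f v ∩ f (v + 1 + 1) then 1 else 0) := by
    intro c _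
    have h : ∀ v : Fin 5, c ∈ f v → c ∉ f (v + 1) := fun v hv =>
      Finset.disjoint_left.1 (disjoint_of_adj hf (adj_add_one v)) hv
    have h0 := h 0
    have h1 := h 1
    have h2 := h 2
    have h3 := h 3
    have h4 := h 4
    simp only [Fin.sum_univ_five, Finset.mem_inter, Fin.reduceAdd] at *
    clear h hf
    by_cases c ∈ f 0 <;> by_cases c ∈ f 1 <;> by_cases c ∈ f 2 <;> by_cases c ∈ f 3 <;>
      by_cases c ∈ f 4 <;> simp_all
  have h := Finset.sum_le_sum hle
  have hi : ∑ v : Fin 5, (f v ∩ f (v + 1 + 1)).card ≤ ∑ v : Fin 5, 1 :=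
    Finset.sum_le_sum fun v _ =>
      card_inter_le_one hf (adj_add_one v) (adj_add_one _) (ne_add_one_add_one v)
  rw [Finset.sum_comm, Finset.sum_add_distrib, Finset.sum_comm (t := Finset.univ)] at h
  simp only [sum_indicator_inter hf, sum_indicator (hf.1 _), hf.2.1,
    Finset.sum_const, Finset.card_univ, Fintype.card_fin, Nat.card_Icc, smul_eq_mul] at h hi
  omega

end Cycle

lemma toneChromaticNumber_eq {V : Type*} {G : SimpleGraph V} {t k : ℕ}
    (hex : ∃ f, IsTToneColoring G t k f)
    (hmin : ∀ (k' : ℕ) (f : V → Finset ℕ), IsTToneColoring G t k' f → k ≤ k') :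
    toneChromaticNumber G t = k :=
  le_antisymm (Nat.sInf_le hex) (le_csInf ⟨k, hex⟩ fun k' ⟨f, hf⟩ => hmin k' f hf)

end ToneCycle

/-- `τ₃(C_n) = 10` if `n ∈ {4,5}`; `τ₃(C_n) = 9` if `n ∈ {3,7,10,13}`; else `τ₃(C_n) = 8`. -/
theorem three_tone_cycles (n : ℕ) (hn : 3 ≤ n) :
    toneChromaticNumber (cycleGraph n) 3 =
      if n = 4 ∨ n = 5 then 10
      else if n = 3 ∨ n = 7 ∨ n = 10 ∨ n = 13 then 9
      else 8 := by
  open ToneCycle in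
  split_ifs with h45 h9
  · rcases h45 with rfl | rfl
    · exact toneChromaticNumber_eq exists_coloring_four fun _ _ => ten_le_of_four
    · exact toneChromaticNumber_eq exists_coloring_five fun _ _ => ten_le_of_five
  · rcases h9 with rfl | rfl | rfl | rfl
    · exact toneChromaticNumber_eq exists_coloring_three fun _ _ => nine_le_of_triangle
    · exact toneChromaticNumber_eq exists_coloring_seven fun _ _ hf =>
        nine_le_of_mod_three (m := 4) hf rfl (by norm_num)
    · exact toneChromaticNumber_eq exists_coloring_ten fun _ _ hf =>
        nine_le_of_mod_three (m := 7) hf rfl (by norm_num)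
    · exact toneChromaticNumber_eq exists_coloring_thirteen fun _ _ hf =>
        nine_le_of_mod_three (m := 10) hf rfl (by norm_num)
  · obtain ⟨g, hg, -⟩ := hasBasedWalk n (by omega) (by omega) (by omega) (by omega)
    obtain ⟨m, rfl⟩ := Nat.exists_eq_add_of_le' hn
    exact toneChromaticNumber_eq (hg.exists_coloring hn) fun _ _ => eight_le
end

section
/- For every n ≥ 3, the 4-tone chromatic number of the cycle C_n satisfies: τ₄(C_n) = 15 if n = 5; τ₄(C_n) = 14 if n = 4; τ₄(C_n) = 13 if n = 7; and τ₄(C_n) = 12 otherwise. -/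
open SimpleGraph

/-- `g 0, …, g (n - 1)` is the sequence of labels of a 4-tone `k`-coloring of an `n`-cycle,
listed in cyclic order. -/
def IsToneWord (n k : ℕ) (g : ℕ → Finset ℕ) : Prop :=
  ∀ i < n, g i ⊆ Finset.Icc 1 k ∧ (g i).card = 4 ∧
    ∀ j < 5, (i + j) % n ≠ i → (g i ∩ g ((i + j) % n)).card < j

instance (n k : ℕ) (g : ℕ → Finset ℕ) : Decidable (IsToneWord n k g) :=
  inferInstanceAs (Decidable (∀ i < n, g i ⊆ Finset.Icc 1 k ∧ (g i).card = 4 ∧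
    ∀ j < 5, (i + j) % n ≠ i → (g i ∩ g ((i + j) % n)).card < j))

lemma cycleGraph_adj_modEq {n : ℕ} {u v : Fin n} (h : (cycleGraph n).Adj u v) :
    ((u : ℤ) ≡ v + 1 [ZMOD n]) ∨ ((v : ℤ) ≡ u + 1 [ZMOD n]) := by
  have key : ∀ a b : Fin n, (a - b).val = 1 → ((a : ℤ) ≡ b + 1 [ZMOD n]) := by
    intro a b hab
    rw [Fin.sub_def] at hab
    have hb := b.isLt
    have h1 := Nat.div_add_mod (n - b.val + a.val) n
    simp only at hab
    rw [hab] at h1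
    rw [Int.modEq_iff_dvd]
    refine ⟨1 - ((n - b.val + a.val) / n : ℕ), ?_⟩
    zify [hb.le] at h1
    push_cast [hb.le]
    linarith
  rcases cycleGraph_adj'.1 h with h | h
  exacts [Or.inl (key _ _ h), Or.inr (key _ _ h)]

lemma cycleGraph_walk_modEq {n : ℕ} {u v : Fin n} (p : (cycleGraph n).Walk u v) :
    ∃ m : ℤ, |m| ≤ p.length ∧ (v : ℤ) ≡ u + m [ZMOD n] := by
  induction p with
  | nil => exact ⟨0, by simp, by simp [Int.ModEq.refl]⟩
  | @cons u w v h p ih =>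
    obtain ⟨m, hm, hv⟩ := ih
    rw [abs_le] at hm
    rcases cycleGraph_adj_modEq h with h | h
    · refine ⟨m - 1, ?_, hv.trans ?_⟩
      · rw [abs_le, Walk.length_cons]; push_cast; constructor <;> linarith
      · have := (h.add_right (m - 1)).symm
        convert this using 1; ring
    · refine ⟨m + 1, ?_, hv.trans ?_⟩
      · rw [abs_le, Walk.length_cons]; push_cast; constructor <;> linarith
      · have := h.add_right m
        convert this using 1; ring

lemma IsToneWord.isTToneColoring {n k : ℕ} {g : ℕ → Finset ℕ} (hg : IsToneWord n k g) :
    IsTToneColoring (cycleGraph n) 4 k (fun v => g v) := by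
  refine ⟨fun v => (hg v v.isLt).1, fun v => (hg v v.isLt).2.1, ?_⟩
  have forward : ∀ (u v : Fin n) (m L : ℕ), u ≠ v → m ≤ L → ((v : ℤ) ≡ u + m [ZMOD n]) →
      (g u ∩ g v).card < L := by
    intro u v m L huv hmL hm
    have hv : ((u : ℕ) + m) % n = v := by
      have h1 : ((u : ℕ) + m) ≡ v [MOD n] := by
        rw [← Int.natCast_modEq_iff]; push_cast; exact hm.symm
      rw [h1, Nat.mod_eq_of_lt v.isLt]
    by_cases h5 : m < 5
    · have := (hg u u.isLt).2.2 m h5 (by rw [hv]; exact fun h => huv (Fin.ext h.symm))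
      rw [hv] at this
      omega
    · have := Finset.card_le_card (Finset.inter_subset_left : g u ∩ g v ⊆ g u)
      have := (hg u u.isLt).2.1
      omega
  intro u v huv
  by_cases hr : (cycleGraph n).edist u v = ⊤
  · rw [hr]; exact ENat.natCast_lt_top _
  obtain ⟨p, hp⟩ := exists_walk_of_edist_ne_top hr
  rw [← hp]
  norm_cast
  obtain ⟨m, hm, hv⟩ := cycleGraph_walk_modEq p
  rw [abs_le] at hm
  obtain ⟨a, rfl | rfl⟩ := m.eq_nat_or_neg
  · exact forward u v a _ huv (by omega) hv
  · rw [Finset.inter_comm]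
    refine forward v u a _ huv.symm (by omega) ?_
    have := (hv.add_right a).symm
    convert this using 1; ring

/-- Two tone words with the same first four letters can be concatenated repeatedly. -/
lemma IsToneWord.append_repeat {r s k : ℕ} {g h : ℕ → Finset ℕ} (hg : IsToneWord r k g)
    (hh : IsToneWord s k h) (hr : 5 ≤ r) (hs : 5 ≤ s) (hpre : ∀ i < 4, g i = h i) (q : ℕ) :
    IsToneWord (r + s * q) k (fun i => if i < r then g i else h ((i - r) % s)) := by
  rcases Nat.eq_zero_or_pos q with rfl | hq
  · intro i hi
    simp only [mul_zero, add_zero] at hi ⊢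
    obtain ⟨h1, h2, h3⟩ := hg i hi
    simp only [hi, if_true, Nat.mod_lt (i + _) (by omega : 0 < r)]
    exact ⟨h1, h2, h3⟩
  set n := r + s * q with hn
  set w : ℕ → Finset ℕ := fun i => if i < r then g i else h ((i - r) % s) with hw
  have hsq : s ≤ s * q := Nat.le_mul_of_pos_right s hq
  have ne_of_lt : ∀ l i j, 5 ≤ l → i < l → 0 < j → j < 5 → (i + j) % l ≠ i := by
    intro l i j hl hi hj hj5 h
    rcases lt_or_ge (i + j) l with h' | h'
    · rw [Nat.mod_eq_of_lt h'] at h; omega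
    · rw [Nat.mod_eq_sub_mod h', Nat.mod_eq_of_lt (by omega)] at h; omega
  have w_left : ∀ i < r + 4, w (i % n) = g (i % r) := by
    intro i hi
    rw [Nat.mod_eq_of_lt (by omega : i < n)]
    by_cases hir : i < r
    · simp [hw, hir, Nat.mod_eq_of_lt hir]
    · rw [Nat.mod_eq_sub_mod (by omega : r ≤ i), Nat.mod_eq_of_lt (by omega : i - r < r),
        hpre _ (by omega)]
      simp [hw, hir, Nat.mod_eq_of_lt (by omega : i - r < s)]
  have w_right : ∀ i, r ≤ i → i < n + 4 → w (i % n) = h ((i - r) % s) := by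
    intro i hi hin
    by_cases h' : i < n
    · rw [Nat.mod_eq_of_lt h']
      simp [hw, not_lt.2 hi]
    · rw [Nat.mod_eq_sub_mod (by omega : n ≤ i), Nat.mod_eq_of_lt (by omega : i - n < n)]
      have e : i - r = (i - n) + s * q := by omega
      rw [e, Nat.add_mul_mod_self_left, Nat.mod_eq_of_lt (by omega : i - n < s),
        ← hpre _ (by omega)]
      simp [hw, (by omega : i - n < r)]
  intro i hi
  rcases lt_or_ge i r with hir | hir
  · obtain ⟨h1, h2, h3⟩ := hg i hir
    have e : w i = g i := by simp [hw, hir]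
    rw [e]
    refine ⟨h1, h2, fun j hj hne => ?_⟩
    have hj0 : 0 < j := by
      rcases Nat.eq_zero_or_pos j with rfl | h
      · exact absurd (Nat.mod_eq_of_lt hi) hne
      · exact h
    rw [w_left _ (by omega)]
    exact h3 j hj (ne_of_lt r i j hr hir hj0 hj)
  · obtain ⟨h1, h2, h3⟩ := hh ((i - r) % s) (Nat.mod_lt _ (by omega))
    have e : w i = h ((i - r) % s) := by simp [hw, not_lt.2 hir]
    rw [e]
    refine ⟨h1, h2, fun j hj hne => ?_⟩
    have hj0 : 0 < j := by
      rcases Nat.eq_zero_or_pos j with rfl | h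
      · exact absurd (Nat.mod_eq_of_lt hi) hne
      · exact h
    rw [w_right _ (by omega) (by omega)]
    have := h3 j hj (ne_of_lt s _ j hs (Nat.mod_lt _ (by omega)) hj0 hj)
    rwa [Nat.mod_add_mod, ← Nat.sub_add_comm hir] at this

lemma exists_isToneWord_twelve {n : ℕ} (hn : n = 6 ∨ 8 ≤ n) : ∃ g, IsToneWord n 12 g := by
  let word (l : List (Finset ℕ)) : ℕ → Finset ℕ := fun i => l.getD i ∅
  let w6 := word [{1,2,3,4}, {5,6,7,8}, {1,9,10,11}, {2,3,5,12}, {4,6,7,9}, {8,10,11,12}]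
  let w8 := word [{1,2,3,4}, {5,6,7,8}, {1,9,10,11}, {2,3,5,12}, {4,6,7,9}, {1,2,8,10},
    {3,5,6,11}, {7,9,10,12}]
  let w9 := word [{1,2,3,4}, {5,6,7,8}, {1,9,10,11}, {2,3,5,12}, {4,6,7,9}, {2,8,10,11},
    {1,4,5,12}, {3,6,8,9}, {7,10,11,12}]
  let w10 := word [{1,2,3,4}, {5,6,7,8}, {1,9,10,11}, {2,3,5,12}, {1,4,6,7}, {2,8,9,10},
    {1,3,5,11}, {2,4,6,12}, {1,7,8,9}, {5,10,11,12}]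
  let w11 := word [{1,2,3,4}, {5,6,7,8}, {1,9,10,11}, {2,3,5,12}, {1,4,6,7}, {2,8,9,10},
    {1,3,5,11}, {2,6,7,12}, {1,4,8,9}, {3,5,6,10}, {7,9,11,12}]
  let w13 := word [{1,2,3,4}, {5,6,7,8}, {1,9,10,11}, {2,3,5,12}, {1,4,6,7}, {2,8,9,10},
    {1,3,5,11}, {2,4,6,12}, {1,7,8,9}, {2,3,10,11}, {1,4,5,12}, {2,6,7,9}, {8,10,11,12}]
  have h6 : IsToneWord 6 12 w6 := by decide +kernel
  have extend : ∀ (r : ℕ) (g : ℕ → Finset ℕ), IsToneWord r 12 g → (∀ i < 4, g i = w6 i) →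
      5 ≤ r → r ≤ n → n % 6 = r % 6 → ∃ g, IsToneWord n 12 g := by
    intro r g hg hpre hr hrn hmod
    have e : n = r + 6 * ((n - r) / 6) := by omega
    rw [e]
    exact ⟨_, hg.append_repeat h6 hr (by norm_num) hpre _⟩
  have hlt : n % 6 < 6 := Nat.mod_lt _ (by norm_num)
  interval_cases h : n % 6
  · exact extend 6 w6 h6 (fun _ _ => rfl) (by omega) (by omega) (by omega)
  · exact extend 13 w13 (by decide +kernel) (by decide +kernel) (by omega) (by omega) (by omega)
  · exact extend 8 w8 (by decide +kernel) (by decide +kernel) (by omega) (by omega) (by omega)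
  · exact extend 9 w9 (by decide +kernel) (by decide +kernel) (by omega) (by omega) (by omega)
  · exact extend 10 w10 (by decide +kernel) (by decide +kernel) (by omega) (by omega) (by omega)
  · exact extend 11 w11 (by decide +kernel) (by decide +kernel) (by omega) (by omega) (by omega)

lemma toneChromaticNumber_eq_of_isToneWord {n k : ℕ} {g : ℕ → Finset ℕ} (hg : IsToneWord n k g)
    (hk : ∀ l f, IsTToneColoring (cycleGraph n) 4 l f → k ≤ l) :
    toneChromaticNumber (cycleGraph n) 4 = k :=
  le_antisymm (Nat.sInf_le ⟨_, hg.isTToneColoring⟩)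
    (le_csInf ⟨k, _, hg.isTToneColoring⟩ fun l ⟨f, hf⟩ => hk l f hf)

namespace IsTToneColoring

variable {V : Type*} {G : SimpleGraph V} {t k : ℕ} {f : V → Finset ℕ}

lemma card_inter_lt (hf : IsTToneColoring G t k f) {u v : V} (huv : u ≠ v) (p : G.Walk u v) :
    (f u ∩ f v).card < p.length := by
  exact_mod_cast (hf.2.2 huv).trans_le (edist_le p)

lemma disjoint (hf : IsTToneColoring G t k f) {u v : V} (h : G.Adj u v) :
    Disjoint (f u) (f v) := by
  rw [Finset.disjoint_iff_inter_eq_empty, ← Finset.card_eq_zero]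
  simpa using hf.card_inter_lt h.ne (.cons h .nil)

lemma card_inter_le_one (hf : IsTToneColoring G t k f) {u v w : V} (h₁ : G.Adj u v)
    (h₂ : G.Adj v w) (hne : u ≠ w) : (f u ∩ f w).card ≤ 1 := by
  simpa [Nat.lt_succ_iff] using hf.card_inter_lt hne (.cons h₁ (.cons h₂ .nil))

lemma card_inter_le_two (hf : IsTToneColoring G t k f) {u v w x : V} (h₁ : G.Adj u v)
    (h₂ : G.Adj v w) (h₃ : G.Adj w x) (hne : u ≠ x) : (f u ∩ f x).card ≤ 2 := by
  simpa [Nat.lt_succ_iff] using hf.card_inter_lt hne (.cons h₁ (.cons h₂ (.cons h₃ .nil)))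

lemma card_le_of_subset {s : Finset ℕ} (h : s ⊆ Finset.Icc 1 k) : s.card ≤ k := by
  simpa using Finset.card_le_card h

/-- Four consecutive vertices of a path already need twelve colors. -/
lemma twelve_le_of_path (hf : IsTToneColoring G 4 k f) {a b c d : V} (hab : G.Adj a b)
    (hbc : G.Adj b c) (hcd : G.Adj c d) (hac : a ≠ c) (hbd : b ≠ d) (had : a ≠ d) : 12 ≤ k := by
  have dab := hf.disjoint hab
  have dbc := hf.disjoint hbc
  have dcd := hf.disjoint hcd
  have iac := hf.card_inter_le_one hab hbc hac
  have ibd := hf.card_inter_le_one hbc hcd hbd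
  have iad := hf.card_inter_le_two hab hbc hcd had
  have hk := card_le_of_subset (Finset.union_subset (Finset.union_subset
    (Finset.union_subset (hf.1 a) (hf.1 c)) (hf.1 b)) (hf.1 d))
  have e1 := Finset.card_union_add_card_inter (f a ∪ f c ∪ f b) (f d)
  have e2 := Finset.card_union_of_disjoint (Finset.disjoint_union_left.2 ⟨dab, dbc.symm⟩)
  have e3 := Finset.card_union_add_card_inter (f a) (f c)
  have e4 : ((f a ∪ f c ∪ f b) ∩ f d).card ≤ (f a ∩ f d).card + (f b ∩ f d).card := by
    rw [Finset.union_inter_distrib_right, Finset.union_inter_distrib_right,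
      Finset.disjoint_iff_inter_eq_empty.1 dcd, Finset.union_empty]
    exact Finset.card_union_le _ _
  simp only [hf.2.1] at *
  omega

lemma twelve_le_of_triangle (hf : IsTToneColoring G 4 k f) {a b c : V} (hab : G.Adj a b)
    (hac : G.Adj a c) (hbc : G.Adj b c) : 12 ≤ k := by
  have hk := card_le_of_subset
    (Finset.union_subset (Finset.union_subset (hf.1 a) (hf.1 b)) (hf.1 c))
  rwa [Finset.card_union_of_disjoint
    (Finset.disjoint_union_left.2 ⟨hf.disjoint hac, hf.disjoint hbc⟩),
    Finset.card_union_of_disjoint (hf.disjoint hab), hf.2.1, hf.2.1, hf.2.1] at hk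

lemma fourteen_le_of_four_cycle (hf : IsTToneColoring G 4 k f) {a b c d : V} (hab : G.Adj a b)
    (hbc : G.Adj b c) (hcd : G.Adj c d) (hda : G.Adj d a) (hac : a ≠ c) (hbd : b ≠ d) :
    14 ≤ k := by
  have hk := card_le_of_subset (Finset.union_subset
    (Finset.union_subset (hf.1 a) (hf.1 c)) (Finset.union_subset (hf.1 b) (hf.1 d)))
  have iac := hf.card_inter_le_one hab hbc hac
  have ibd := hf.card_inter_le_one hbc hcd hbd
  have e1 : Disjoint (f a ∪ f c) (f b ∪ f d) := by
    simp only [Finset.disjoint_union_left, Finset.disjoint_union_right]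
    exact ⟨⟨hf.disjoint hab, hf.disjoint hbc.symm⟩, hf.disjoint hda.symm, hf.disjoint hcd⟩
  have e2 := Finset.card_union_of_disjoint e1
  have e3 := Finset.card_union_add_card_inter (f a) (f c)
  have e4 := Finset.card_union_add_card_inter (f b) (f d)
  simp only [hf.2.1] at *
  omega

lemma twelve_le_of_cycleGraph {n : ℕ} (hn : 3 ≤ n) {f : Fin n → Finset ℕ}
    (hf : IsTToneColoring (cycleGraph n) 4 k f) : 12 ≤ k := by
  obtain rfl | hn := hn.eq_or_lt
  · exact hf.twelve_le_of_triangle (a := 0) (b := 1) (c := 2) (by decide) (by decide) (by decide)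
  have adj : ∀ i (hi : i + 1 < n),
      (cycleGraph n).Adj ⟨i, by omega⟩ ⟨i + 1, hi⟩ := by
    intro i hi
    refine pathGraph_le_cycleGraph ?_
    simp [pathGraph_adj]
  exact hf.twelve_le_of_path (adj 0 (by omega)) (adj 1 (by omega)) (adj 2 (by omega))
    (by simp) (by simp) (by simp)

/-- Double counting of the incidences between vertices and colors, when every color class `s`
contains enough pairs of vertices at distance two. -/
lemma mul_le_of_colorClass {n a b : ℕ} {f : Fin (n + 5) → Finset ℕ}
    (hf : IsTToneColoring (cycleGraph (n + 5)) 4 k f)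
    (hs : ∀ s : Finset (Fin (n + 5)), (∀ i ∈ s, i + 1 ∉ s) →
      a * s.card ≤ b + (s.filter fun i => i + 1 + 1 ∈ s).card) :
    a * (4 * (n + 5)) ≤ b * k + (n + 5) := by
  have adj : ∀ i : Fin (n + 5), (cycleGraph (n + 5)).Adj i (i + 1) := by
    intro i
    rw [cycleGraph_adj]
    simp
  let S : ℕ → Finset (Fin (n + 5)) := fun c => Finset.univ.filter fun i => c ∈ f i
  have hS : ∀ c i, i ∈ S c ↔ c ∈ f i := by simp [S]
  have h1 : ∑ c ∈ Finset.Icc 1 k, (S c).card = 4 * (n + 5) := by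
    simp only [S, Finset.card_filter]
    rw [Finset.sum_comm]
    simp only [← Finset.card_filter, Finset.filter_mem_eq_inter,
      Finset.inter_eq_right.2 (hf.1 _), hf.2.1]
    simp [mul_comm]
  have h2 : ∑ c ∈ Finset.Icc 1 k, ((S c).filter fun i => i + 1 + 1 ∈ S c).card ≤ n + 5 := by
    have e : ∀ c, ((S c).filter fun i => i + 1 + 1 ∈ S c)
        = Finset.univ.filter fun i => c ∈ f i ∩ f (i + 1 + 1) := by
      intro c; ext i; simp [hS]
    simp only [e, Finset.card_filter]
    rw [Finset.sum_comm]
    simp only [← Finset.card_filter, Finset.filter_mem_eq_inter]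
    calc _ ≤ ∑ i : Fin (n + 5), 1 := by
          refine Finset.sum_le_sum fun i _ => ?_
          refine (Finset.card_le_card Finset.inter_subset_right).trans
            (hf.card_inter_le_one (adj i) (adj (i + 1)) ?_)
          intro h
          rw [add_assoc, left_eq_add, Fin.ext_iff, Fin.val_add] at h
          simp [Nat.mod_eq_of_lt] at h
      _ = n + 5 := by simp
  have h3 : ∀ c ∈ Finset.Icc 1 k,
      a * (S c).card ≤ b + ((S c).filter fun i => i + 1 + 1 ∈ S c).card := by
    intro c _
    refine hs _ fun i hi hi' => ?_
    rw [hS] at hi hi'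
    exact Finset.disjoint_left.1 (hf.disjoint (adj i)) hi hi'
  have h4 := Finset.sum_le_sum h3
  rw [← Finset.mul_sum, h1, Finset.sum_add_distrib] at h4
  simp only [Finset.sum_const, Nat.card_Icc, smul_eq_mul, Nat.add_sub_cancel] at h4
  rw [mul_comm k b] at h4
  omega

end IsTToneColoring

/-- `τ₄(C_n) = 15` if `n = 5`; `14` if `n = 4`; `13` if `n = 7`; else `12`. -/
theorem four_tone_cycles (n : ℕ) (hn : 3 ≤ n) :
    toneChromaticNumber (cycleGraph n) 4 =
      if n = 5 then 15
      else if n = 4 then 14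
      else if n = 7 then 13
      else 12 := by
  let word (l : List (Finset ℕ)) : ℕ → Finset ℕ := fun i => l.getD i ∅
  split_ifs with h5 h4 h7
  · subst h5
    refine toneChromaticNumber_eq_of_isToneWord (g := word
      [{1,2,3,4}, {5,6,7,8}, {1,9,10,11}, {2,5,12,13}, {6,9,14,15}]) (by decide +kernel) ?_
    intro l f hf
    have := hf.mul_le_of_colorClass (n := 0) (a := 1) (b := 1) (by decide +kernel)
    omega
  · subst h4
    refine toneChromaticNumber_eq_of_isToneWord (g := word
      [{1,2,3,4}, {5,6,7,8}, {1,9,10,11}, {5,12,13,14}]) (by decide +kernel) ?_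
    intro l f hf
    exact hf.fourteen_le_of_four_cycle (a := 0) (b := 1) (c := 2) (d := 3) (by decide)
      (by decide) (by decide) (by decide) (by decide) (by decide)
  · subst h7
    refine toneChromaticNumber_eq_of_isToneWord (g := word
      [{1,2,3,4}, {5,6,7,8}, {1,9,10,11}, {2,3,5,12}, {1,4,6,7}, {2,8,9,10}, {5,11,12,13}])
      (by decide +kernel) ?_
    intro l f hf
    have := hf.mul_le_of_colorClass (n := 2) (a := 2) (b := 4) (by decide +kernel)
    omega
  · have lower : ∀ l f, IsTToneColoring (cycleGraph n) 4 l f → 12 ≤ l :=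
      fun l f hf => hf.twelve_le_of_cycleGraph hn
    by_cases h3 : n = 3
    · subst h3
      exact toneChromaticNumber_eq_of_isToneWord (g := word
        [{1,2,3,4}, {5,6,7,8}, {9,10,11,12}]) (by decide +kernel) lower
    · obtain ⟨g, hg⟩ := exists_isToneWord_twelve (n := n) (by omega)
      exact toneChromaticNumber_eq_of_isToneWord hg lower
end
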